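/- Approximation of submanifolds with boundary in critical codimension with fixed boundary: let O ⊂ ℍ^n be open and let S be an oriented n-codimensional C¹_ℍ-regular submanifold with boundary in O such that S and ∂S have locally finite measures on O (𝒮^{n+2}⌊S and the n-dimensional measure on ∂S locally finite). Then for each p ∈ O ∩ ∂S there exist an open set U with p ∈ U and a sequence (S_h)_{h∈ℕ} of oriented submanifolds of codimension n in U which are both Euclidean C¹ and C¹_ℍ-regular, with boundary satisfying U ∩ ∂S_h = U ∩ ∂S for every h ∈ ℕ and with locally finite measures in O, such that ⟦S_h⟧(ω) → ⟦S⟧(ω) as h → ∞ for every ω ∈ 𝒟^{n+1}_ℍ(U). -/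

import Mathlib

open MeasureTheory Topology Filter Set ENNReal

noncomputable section
namespace Heis

/-- Points of the `n`-th Heisenberg group `ℍⁿ ≡ ℝⁿ × ℝⁿ × ℝ`, `p = (x, y, t)`. -/
abbrev Hpt (n : ℕ) : Type := (Fin n → ℝ) × (Fin n → ℝ) × ℝ

variable {n : ℕ}

/-- The Heisenberg group operation. -/
def hmul (p q : Hpt n) : Hpt n :=
  (p.1 + q.1, p.2.1 + q.2.1,
    p.2.2 + q.2.2 + (∑ j, p.1 j * q.2.1 j) / 2 - (∑ j, q.1 j * p.2.1 j) / 2)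

/-- Group inverse. -/
def hinv (p : Hpt n) : Hpt n := (-p.1, -p.2.1, -p.2.2)

/-- Anisotropic dilations `δ_λ(x,y,t) = (λx, λy, λ²t)`. -/
def hdil (l : ℝ) (p : Hpt n) : Hpt n := (l • p.1, l • p.2.1, l ^ 2 * p.2.2)

/-- The value at `p` of the `j`-th left invariant frame field `X₁,…,Xₙ,Y₁,…,Yₙ,T`,
expressed in the coordinates of `ℝ^{2n+1}`. -/
def frameVec (j : Fin (2*n+1)) (p : Hpt n) : Hpt n :=
  if h : (j : ℕ) < n then
    (Pi.single (⟨j, h⟩ : Fin n) 1, 0, -(p.2.1 ⟨j, h⟩) / 2)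
  else if h' : (j : ℕ) < 2*n then
    (0, Pi.single (⟨(j:ℕ) - n, by omega⟩ : Fin n) 1, p.1 ⟨(j:ℕ) - n, by omega⟩ / 2)
  else (0, 0, 1)

/-- Inclusion of horizontal indices. -/
def hIdx (j : Fin (2*n)) : Fin (2*n+1) := Fin.castLE (by omega) j

/-- Horizontal gradient `∇_ℍ f = (X₁f,…,Xₙf,Y₁f,…,Yₙf)` (pointwise derivatives along the
horizontal left-invariant fields). -/
def gradH (f : Hpt n → ℝ) (p : Hpt n) : Fin (2*n) → ℝ :=
  fun j => lineDeriv ℝ f p (frameVec (hIdx j) p)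

/-- `f` is of class `C¹_ℍ` on `U`: it is continuous and its horizontal derivatives exist and
are (represented by) continuous functions on `U`. -/
structure IsC1H (U : Set (Hpt n)) (f : Hpt n → ℝ) : Prop where
  contOn : ContinuousOn f U
  ldiff : ∀ p ∈ U, ∀ j : Fin (2*n), LineDifferentiableAt ℝ f p (frameVec (hIdx j) p)
  contGrad : ∀ j : Fin (2*n), ContinuousOn (fun p => gradH f p j) U

/-- Horizontal gradient as a frame-coefficient vector in `ℝ^{2n+1}` (with zero `T`-component). -/
def gradF (f : Hpt n → ℝ) (q : Hpt n) : Fin (2*n+1) → ℝ :=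
  fun j => if h : (j:ℕ) < 2*n then gradH f q ⟨j, h⟩ else 0

/-- Horizontal derivative indexed by a natural number (0 outside the horizontal range). -/
def gradNat (f : Hpt n → ℝ) (q : Hpt n) (i : ℕ) : ℝ :=
  if h : i < 2*n then gradH f q ⟨i, h⟩ else 0

/-- The Pansu differential of a `C¹_ℍ` function: `d_ℍf_p(x,y,t) = Σⱼ(xⱼXⱼf(p) + yⱼYⱼf(p))`. -/
def pansuD (f : Hpt n → ℝ) (p : Hpt n) (q : Hpt n) : ℝ :=
  ∑ j : Fin n, (q.1 j * gradH f p ⟨(j:ℕ), by omega⟩ + q.2.1 j * gradH f p ⟨n + (j:ℕ), by omega⟩)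

/-- `S` is a `k`-codimensional `C¹_ℍ`-regular submanifold. -/
def IsC1HCodim (k : ℕ) (S : Set (Hpt n)) : Prop :=
  ∀ p ∈ S, ∃ U : Set (Hpt n), IsOpen U ∧ p ∈ U ∧
    ∃ f : Fin k → Hpt n → ℝ,
      (∀ i, IsC1H U (f i)) ∧
      (∀ q ∈ U, LinearIndependent ℝ (fun i => gradH (f i) q)) ∧
      S ∩ U = {q ∈ U | ∀ i, f i q = 0}

/-- `L : ℝ^k → ℍⁿ` is a group homomorphism. -/
def IsGroupHomH {k : ℕ} (L : (Fin k → ℝ) → Hpt n) : Prop :=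
  ∀ a b, L (a + b) = hmul (L a) (L b)

/-- Pansu differentiability of `f : ℝ^k → ℍⁿ` at `a`:
`δ_{1/λ}(f(a)⁻¹ ⬝ f(a + λb)) → L(b)` locally uniformly in `b`, with `L` a group homomorphism. -/
def HasPansuDerivAt {k : ℕ} (f : (Fin k → ℝ) → Hpt n) (L : (Fin k → ℝ) → Hpt n)
    (a : Fin k → ℝ) : Prop :=
  IsGroupHomH L ∧
    TendstoLocallyUniformly
      (fun (l : ℝ) (b : Fin k → ℝ) => hdil l⁻¹ (hmul (hinv (f a)) (f (a + l • b)))) L (𝓝[>] 0)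

/-- `S` is a `k`-dimensional (`k ≤ n`) `C¹_ℍ`-regular submanifold: locally the injective image
of an open set of `ℝ^k` under a continuously Pansu differentiable map with injective
Pansu differential. -/
def IsC1HDim (k : ℕ) (S : Set (Hpt n)) : Prop :=
  ∀ p ∈ S, ∃ U : Set (Hpt n), IsOpen U ∧ p ∈ U ∧
    ∃ V : Set (Fin k → ℝ), IsOpen V ∧
    ∃ (f : (Fin k → ℝ) → Hpt n) (Df : (Fin k → ℝ) → (Fin k → ℝ) → Hpt n),
      Set.InjOn f V ∧ Set.MapsTo f V U ∧
      (∀ a ∈ V, HasPansuDerivAt f (Df a) a ∧ Function.Injective (Df a)) ∧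
      (∀ b, ContinuousOn (fun a => Df a b) V) ∧
      S ∩ U = f '' V

/-- `C¹_ℍ`-regular submanifold of codimension `k`, for any `1 ≤ k ≤ 2n+1` (for `k ≥ n+1` this
means a low-dimensional submanifold of dimension `2n+1-k`). -/
def IsC1HSub (k : ℕ) (S : Set (Hpt n)) : Prop :=
  if k ≤ n then IsC1HCodim k S else IsC1HDim (2*n+1-k) S

/-! ## Distances and measures -/

/-- Open ball of a distance function. -/
def rawBall (d : Hpt n → Hpt n → ℝ) (p : Hpt n) (r : ℝ) : Set (Hpt n) := {q | d p q < r}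

/-- The gauge used to define the spherical Hausdorff measure of dimension `m` at scale `r`. -/
def sphGauge (d : Hpt n → Hpt n → ℝ) (m r : ℝ) (s : Set (Hpt n)) : ℝ≥0∞ :=
  ⨅ (c : Hpt n) (ρ : ℝ) (_ : 0 < ρ) (_ : ρ < r) (_ : s ⊆ rawBall d c ρ),
    ENNReal.ofReal ((2*ρ) ^ m)

/-- Spherical pre-measure at scale `r`. -/
def sphPre (d : Hpt n → Hpt n → ℝ) (m r : ℝ) : OuterMeasure (Hpt n) :=
  OuterMeasure.boundedBy (sphGauge d m r)

/-- The spherical Hausdorff outer measure `𝒮^m` associated with `d`. -/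
def sphOuter (d : Hpt n → Hpt n → ℝ) (m : ℝ) : OuterMeasure (Hpt n) :=
  ⨆ (r : ℝ) (_ : 0 < r), sphPre d m r

/-- A left invariant, homogeneous, rotationally invariant distance on `ℍⁿ`.
(The field `carat` records the — automatically true — fact that Borel sets are
Carathéodory measurable for the associated spherical measures.) -/
structure HomDist (n : ℕ) where
  d : Hpt n → Hpt n → ℝ
  symm : ∀ p q, d p q = d q p
  triangle : ∀ p q r, d p r ≤ d p q + d q r
  eq_iff : ∀ p q, d p q = 0 ↔ p = q
  leftInv : ∀ g p q, d (hmul g p) (hmul g q) = d p q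
  homog : ∀ l : ℝ, 0 < l → ∀ p q, d (hdil l p) (hdil l q) = l * d p q
  rotInv : ∀ p q : Hpt n,
    (∑ j, (p.1 j ^ 2 + p.2.1 j ^ 2)) = (∑ j, (q.1 j ^ 2 + q.2.1 j ^ 2)) →
    p.2.2 = q.2.2 → d 0 p = d 0 q
  carat : ∀ m : ℝ,
    (inferInstance : MeasurableSpace (Hpt n)) ≤ (sphOuter d m).caratheodory

/-- Open ball `U(p,r)` of a homogeneous distance. -/
def hball (D : HomDist n) (p : Hpt n) (r : ℝ) : Set (Hpt n) := rawBall D.d p r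

/-- The spherical Hausdorff measure `𝒮^m` of a homogeneous distance, as a measure. -/
def sphMeasure (D : HomDist n) (m : ℝ) : Measure (Hpt n) :=
  (sphOuter D.d m).toMeasure (D.carat m)

/-- `μ⌊A` is locally finite on `O`. -/
def LocFin (μ : Measure (Hpt n)) (A O : Set (Hpt n)) : Prop :=
  ∀ p ∈ O, ∃ U : Set (Hpt n), IsOpen U ∧ p ∈ U ∧ μ (A ∩ U) < ⊤

/-! ## Euclidean coordinates and Euclidean Hausdorff measures -/

/-- Realization of a coordinate vector `c ∈ ℝ^{2n+1}` as a point/tangent vector of `ℍⁿ`. -/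
def rE (c : Fin (2*n+1) → ℝ) : Hpt n :=
  (fun i => c ⟨(i:ℕ), by omega⟩, fun i => c ⟨n + (i:ℕ), by omega⟩, c ⟨2*n, by omega⟩)

/-- Coordinates of a point/tangent vector of `ℍⁿ` as a vector of `ℝ^{2n+1}`. -/
def toEc (q : Hpt n) : Fin (2*n+1) → ℝ := fun j =>
  if h : (j:ℕ) < n then q.1 ⟨j, h⟩
  else if h' : (j:ℕ) < 2*n then q.2.1 ⟨(j:ℕ) - n, by omega⟩
  else q.2.2

/-- Identification of `ℍⁿ` with the Euclidean space `ℝ^{2n+1}`. -/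
def ofE (q : EuclideanSpace ℝ (Fin (2*n+1))) : Hpt n := rE (fun j => q j)

/-- The `m`-dimensional Euclidean Hausdorff measure on `ℍⁿ ≡ ℝ^{2n+1}`. -/
def muE (n : ℕ) (m : ℝ) : Measure (Hpt n) :=
  Measure.map ofE (μH[m] : Measure (EuclideanSpace ℝ (Fin (2*n+1))))

/-! ## Multivectors -/

/-- Index sets for a basis of `Λ_k 𝔥`. -/
def IdxSet (n k : ℕ) := {s : Finset (Fin (2*n+1)) // s.card = k}

instance (n k : ℕ) : Fintype (IdxSet n k) := by unfold IdxSet; infer_instance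

/-- The increasing enumeration of an index set. -/
def idxTuple {k : ℕ} (s : IdxSet n k) (i : Fin k) : Fin (2*n+1) :=
  ((s.1.orderIsoOfFin s.2) i).1

/-- `k`-vectors, as coefficients with respect to the canonical basis of `Λ_k ℝ^{2n+1}`. -/
abbrev MVec (n k : ℕ) := IdxSet n k → ℝ

/-- The simple `k`-vector `v₁ ∧ ⋯ ∧ v_k`. -/
def simpleWedge {k : ℕ} (v : Fin k → (Fin (2*n+1) → ℝ)) : MVec n k :=
  fun s => Matrix.det (Matrix.of fun i j => v i (idxTuple s j))

/-- Degree cast for multivectors. -/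
def mvCast {a b : ℕ} (h : a = b) (t : MVec n a) : MVec n b :=
  fun s => t ⟨s.1, by rw [h]; exact s.2⟩

/-- Euclidean scalar product of coefficient vectors. -/
def dotC (a b : Fin (2*n+1) → ℝ) : ℝ := ∑ j, a j * b j

/-- Pairing `⟨t | η⟩` at `p` of a `k`-vector (in the left invariant frame `X₁,…,Yₙ,T`)
with a `k`-form. -/
def pairF {k : ℕ} (t : MVec n k) (p : Hpt n) (η : (Fin k → Hpt n) → ℝ) : ℝ :=
  ∑ s, t s * η (fun i => frameVec (idxTuple s i) p)

/-- The `j`-th coordinate basis vector of `ℝ^{2n+1}`. -/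
def coordC (j : Fin (2*n+1)) : Fin (2*n+1) → ℝ := fun j' => if j' = j then 1 else 0

/-- Pairing `⟨t | η⟩` of a `k`-vector (in the coordinate basis `∂x,∂y,∂t`) with a `k`-form. -/
def pairE {k : ℕ} (t : MVec n k) (η : (Fin k → Hpt n) → ℝ) : ℝ :=
  ∑ s, t s * η (fun i => rE (coordC (idxTuple s i)))

/-- Realization of a frame-coefficient vector as a tangent vector at `p`. -/
def rF (c : Fin (2*n+1) → ℝ) (p : Hpt n) : Hpt n := ∑ j, c j • frameVec j p

/-! ## Covectors and Heisenberg forms -/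

/-- `k`-covectors on `ℍⁿ`. -/
abbrev Cov (n k : ℕ) := AlternatingMap ℝ (Hpt n) ℝ (Fin k)

/-- Wedge product of covectors. -/
def cwedge {k l : ℕ} (α : Cov n k) (β : Cov n l) : Cov n (k + l) :=
  AlternatingMap.domDomCongr finSumFinEquiv
    ((TensorProduct.lid ℝ ℝ).toLinearMap.compAlternatingMap (AlternatingMap.domCoprod α β))

/-- Degree cast for covectors. -/
def covCast {a b : ℕ} (h : a = b) (α : Cov n a) : Cov n b :=
  AlternatingMap.domDomCongr (finCongr h) α

def projX (j : Fin n) : Hpt n →ₗ[ℝ] ℝ := (LinearMap.proj j).comp (LinearMap.fst ℝ _ _)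

def projY (j : Fin n) : Hpt n →ₗ[ℝ] ℝ :=
  (LinearMap.proj j).comp ((LinearMap.fst ℝ _ _).comp (LinearMap.snd ℝ _ _))

def projT : Hpt n →ₗ[ℝ] ℝ := (LinearMap.snd ℝ _ _).comp (LinearMap.snd ℝ _ _)

/-- The contact form `θ = dt + ½Σⱼ(yⱼdxⱼ − xⱼdyⱼ)` at `p`, as a linear functional. -/
def thetaLin (p : Hpt n) : Hpt n →ₗ[ℝ] ℝ :=
  projT + (2:ℝ)⁻¹ • (∑ j : Fin n, (p.2.1 j • projX j - p.1 j • projY j))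

/-- A linear functional as a `1`-covector. -/
def cov1 (L : Hpt n →ₗ[ℝ] ℝ) : Cov n 1 :=
  AlternatingMap.ofSubsingleton ℝ (Hpt n) ℝ (0 : Fin 1) L

/-- `θ` as a `1`-covector. -/
def thetaC (p : Hpt n) : Cov n 1 := cov1 (thetaLin p)

/-- `dθ = −Σⱼ dxⱼ∧dyⱼ` as a (constant) `2`-covector. -/
def dthetaC : Cov n 2 := -∑ j : Fin n, cwedge (cov1 (projX j)) (cov1 (projY j))

/-- Membership in the Rumin ideal `ℐ^k = {λ∧θ + μ∧dθ}` at the point `p`. -/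
def memI {k : ℕ} (p : Hpt n) (ω : Cov n k) : Prop :=
  ∃ (a : Cov n (k-1)) (ω₂ : Cov n k) (h1 : (k-1)+1 = k),
    ω = covCast h1 (cwedge a (thetaC p)) + ω₂ ∧
    (ω₂ = 0 ∨ ∃ (b : Cov n (k-2)) (h2 : (k-2)+2 = k), ω₂ = covCast h2 (cwedge b dthetaC))

/-- Membership in `𝒥^k = {λ : λ∧θ = λ∧dθ = 0}` at the point `p`. -/
def memJ {k : ℕ} (p : Hpt n) (ω : Cov n k) : Prop :=
  cwedge ω (thetaC p) = 0 ∧ cwedge ω dthetaC = 0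

/-- A compactly supported smooth Heisenberg `k`-form on `O` (for `k ≤ n` the values are
representatives of classes modulo `ℐ^k`; for `k ≥ n+1` they lie in `𝒥^k`). -/
structure IsHFormD (k : ℕ) (O : Set (Hpt n)) (ω : Hpt n → Cov n k) : Prop where
  smooth : ∀ v : Fin k → Hpt n, ContDiff ℝ (⊤ : ℕ∞) fun p => ω p v
  cptSupp : ∃ K : Set (Hpt n), IsCompact K ∧ K ⊆ O ∧ ∀ p ∉ K, ω p = 0
  vert : n + 1 ≤ k → ∀ p, memJ p (ω p)

/-- Exterior derivative (as a raw multilinear expression):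
`dω_p(v₀,…,v_k) = Σᵢ (−1)ⁱ ∂_{vᵢ}(q ↦ ω_q(v₀,…,v̂ᵢ,…,v_k))(p)`. -/
def extD {k : ℕ} (ω : Hpt n → Cov n k) (p : Hpt n) (v : Fin (k+1) → Hpt n) : ℝ :=
  ∑ i : Fin (k+1), (-1 : ℝ)^(i:ℕ) * fderiv ℝ (fun q => ω q (v ∘ i.succAbove)) p (v i)

/-- `η` is the Rumin operator `D` applied to `ω` (only meaningful in degree `k = n`):
`Dω = d(ω − θ∧β)` where `β = L⁻¹((dω)_{𝔥₁})`, i.e. `β` is horizontal and `β∧dθ` agrees with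
`dω` on horizontal vectors. -/
def IsRuminD {k : ℕ} (ω : Hpt n → Cov n k) (η : Hpt n → (Fin (k+1) → Hpt n) → ℝ) : Prop :=
  ∃ (β : Hpt n → Cov n (k-1)) (h1 : 1 + (k-1) = k) (h2 : (k-1)+2 = k+1),
    (∀ v, ContDiff ℝ (⊤ : ℕ∞) fun p => β p v) ∧
    (∀ (p : Hpt n) (v : Fin (k-1) → Hpt n) (i : Fin (k-1)),
      v i = ((0:Fin n → ℝ), (0:Fin n → ℝ), (1:ℝ)) → β p v = 0) ∧
    (∀ (p : Hpt n) (v : Fin (k+1) → Hpt n), (∀ i, thetaLin p (v i) = 0) →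
      extD ω p v = covCast h2 (cwedge (β p) dthetaC) v) ∧
    η = extD (fun p => ω p - covCast h1 (cwedge (thetaC p) (β p)))

/-- The Rumin differential `d_c`: the exterior derivative in degree `k ≠ n`, the second order
operator `D` in the critical degree `k = n`. -/
def IsDc {k : ℕ} (ω : Hpt n → Cov n k) (η : Hpt n → (Fin (k+1) → Hpt n) → ℝ) : Prop :=
  if k = n then IsRuminD ω η else η = extD ω

/-- Degree cast for raw forms. -/
def rawCast {a b : ℕ} (h : a = b) (η : (Fin a → Hpt n) → ℝ) : (Fin b → Hpt n) → ℝ :=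
  fun v => η (fun i => v (Fin.cast h i))

/-! ## Orientations and currents -/

/-- `t` is a unit tangent `m`-vector of the `k`-codimensional `C¹_ℍ` submanifold `S` at `p`,
i.e. `t = ±*n^ℍ_S(p)`: `t` is the wedge of an orthonormal basis of `ker d_ℍf_p`
(in the left invariant frame). -/
def IsHTangentVecAt (k m : ℕ) (S : Set (Hpt n)) (p : Hpt n) (t : MVec n m) : Prop :=
  ∃ (U : Set (Hpt n)) (f : Fin k → Hpt n → ℝ), IsOpen U ∧ p ∈ U ∧
    (∀ i, IsC1H U (f i)) ∧
    (∀ q ∈ U, LinearIndependent ℝ (fun i => gradH (f i) q)) ∧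
    S ∩ U = {q ∈ U | ∀ i, f i q = 0} ∧
    ∃ v : Fin m → (Fin (2*n+1) → ℝ),
      (∀ i j, dotC (v i) (v j) = if i = j then 1 else 0) ∧
      (∀ i l, dotC (v i) (gradF (f l) p) = 0) ∧
      t = simpleWedge v

/-- An orientation of a `k`-codimensional `C¹_ℍ` submanifold: a continuous global choice of
the unit tangent `(2n+1−k)`-vector `t^ℍ_S` (here of formal degree `m`). -/
def IsHOrient (k m : ℕ) (S : Set (Hpt n)) (t : Hpt n → MVec n m) : Prop :=
  ContinuousOn t S ∧ ∀ p ∈ S, IsHTangentVecAt k m S p (t p)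

/-- Classical Euclidean unit tangent `m`-vector at a point of an `m`-dimensional submanifold
(coefficients in the coordinate basis). -/
def IsEuclTangentVecAt (m : ℕ) (S : Set (Hpt n)) (p : Hpt n) (t : MVec n m) : Prop :=
  ∃ v : Fin m → (Fin (2*n+1) → ℝ),
    (∀ i j, dotC (v i) (v j) = if i = j then 1 else 0) ∧
    (∀ i, rE (v i) ∈ tangentConeAt ℝ S p) ∧ t = simpleWedge v

/-- Classical (Euclidean) orientation of a low-dimensional submanifold. -/
def IsEuclOrient (m : ℕ) (S : Set (Hpt n)) (t : Hpt n → MVec n m) : Prop :=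
  ContinuousOn t S ∧ ∀ p ∈ S, IsEuclTangentVecAt m S p (t p)

/-- The standard vertical subgroup `𝕎` of codimension `k`. -/
def Wstd (n k : ℕ) : Set (Hpt n) := {p | ∀ i : Fin n, (i:ℕ) < k → p.1 i = 0}

/-- Embedding realizing `𝕎` as a Euclidean space. -/
def wEmbed (n k : ℕ) (a : ({i : Fin n // k ≤ (i:ℕ)} → ℝ) × (Fin n → ℝ) × ℝ) : Hpt n :=
  (fun i => if h : k ≤ (i:ℕ) then a.1 ⟨i, h⟩ else 0, a.2.1, a.2.2)

/-- Lebesgue measure `ℒ^{2n+1−k}` on the vertical subgroup `𝕎`. -/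
def wLeb (n k : ℕ) : Measure (Hpt n) := Measure.map (wEmbed n k) volume

/-- The geometric constant
`C_{n,k} = (sup{ℒ^{2n+1−k}(𝕎 ∩ U(p,1)) : p ∈ U(0,1)})⁻¹`. -/
def CnkC (D : HomDist n) (k : ℕ) : ℝ :=
  (sSup {v : ℝ | ∃ p ∈ hball D 0 1, v = (wLeb n k (Wstd n k ∩ hball D p 1)).toReal})⁻¹

/-- The Heisenberg current `⟦S⟧` of an oriented `k`-codimensional (`k ≤ n`) submanifold:
`⟦S⟧(ω) = (1/C_{n,k}) ∫_S ⟨t^ℍ_S | ω⟩ d𝒮^{Q−k}`. -/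
def currF (D : HomDist n) (k : ℕ) (S : Set (Hpt n)) (t : Hpt n → MVec n (2*n+1-k))
    (η : Hpt n → (Fin (2*n+1-k) → Hpt n) → ℝ) : ℝ :=
  (CnkC D k)⁻¹ * ∫ p in S, pairF (t p) p (η p) ∂(sphMeasure D ((2*n+2 : ℝ) - (k : ℝ)))

/-- The current of an oriented low-dimensional (`m ≤ n`) submanifold: the classical integral
`⟦S⟧(ω) = ∫_S ⟨τ_S | ω⟩ d𝓗^m_E`. -/
def currE {n : ℕ} (m : ℕ) (S : Set (Hpt n)) (t : Hpt n → MVec n m)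
    (η : Hpt n → (Fin m → Hpt n) → ℝ) : ℝ :=
  ∫ p in S, pairE (t p) (η p) ∂(muE n (m : ℝ))

/-- The Heisenberg current of an oriented `m`-dimensional submanifold (any `m`). -/
def hCurr (D : HomDist n) (m : ℕ) (S : Set (Hpt n)) (t : Hpt n → MVec n m)
    (η : Hpt n → (Fin m → Hpt n) → ℝ) : ℝ :=
  if m ≤ n then currE m S t η
  else if h2 : m ≤ 2*n+1 then
    currF D (2*n+1-m) S (fun p => mvCast (by omega) (t p)) (fun p => rawCast (by omega) (η p))
  else 0

/-- Orientation of an `m`-dimensional submanifold (any `m`): Euclidean in low dimension,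
the continuous unit tangent field `t^ℍ_S` in low codimension. -/
def IsOrientS (m : ℕ) (S : Set (Hpt n)) (t : Hpt n → MVec n m) : Prop :=
  if m ≤ n then IsEuclOrient m S t else IsHOrient (2*n+1-m) m S t

/-! ## Submanifolds with boundary -/

/-- The boundary `∂S = S̄ ∖ S`. -/
def bdry (S : Set (Hpt n)) : Set (Hpt n) := closure S \ S

/-- `S` is a `k`-codimensional `C¹_ℍ`-regular submanifold with boundary in `O`. -/
def IsC1HSubWithBdry (D : HomDist n) (k : ℕ) (O : Set (Hpt n)) (S : Set (Hpt n)) : Prop :=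
  (O ∩ S).Nonempty ∧ IsC1HSub k (O ∩ S) ∧
  (O ∩ bdry S).Nonempty ∧ IsC1HSub (k+1) (O ∩ bdry S) ∧
  ∀ p ∈ O ∩ bdry S, ∃ U : Set (Hpt n), IsOpen U ∧ p ∈ U ∧
    ∃ S' : Set (Hpt n), S' ⊆ U ∧ IsC1HSub k S' ∧ U ∩ closure S ⊆ S' ∧
      ∀ r : ℝ, 0 < r → (hball D p r ∩ (S' \ closure S)).Nonempty

/-- A family `f₁,…,f_{k+1}` of local defining functions at a boundary point `p`, as in the
characterization of `k`-codimensional submanifolds with boundary: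
`U ∩ S = {f₁ = ⋯ = f_k = 0, f_{k+1} > 0}` and `f_{k+1}(p) = 0`. -/
def IsBdryFrame (k : ℕ) (S : Set (Hpt n)) (p : Hpt n) (U : Set (Hpt n))
    (f : Fin (k+1) → Hpt n → ℝ) : Prop :=
  IsOpen U ∧ p ∈ U ∧ (∀ i, IsC1H U (f i)) ∧
  (∀ q ∈ U, LinearIndependent ℝ (fun i => gradH (f i) q)) ∧
  U ∩ S = {q ∈ U | (∀ i : Fin k, f i.castSucc q = 0) ∧ 0 < f (Fin.last k) q} ∧
  f (Fin.last k) p = 0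

/-! ## Smooth and Euclidean submanifolds -/

/-- `S` is a smooth (Euclidean `C^∞`) submanifold of codimension `k`. -/
def IsSmoothCodim (k : ℕ) (S : Set (Hpt n)) : Prop :=
  ∀ p ∈ S, ∃ U : Set (Hpt n), IsOpen U ∧ p ∈ U ∧ ∃ f : Fin k → Hpt n → ℝ,
    (∀ i, ContDiff ℝ (⊤ : ℕ∞) (f i)) ∧
    (∀ q ∈ U, LinearIndependent ℝ (fun i => fderiv ℝ (f i) q)) ∧
    S ∩ U = {q ∈ U | ∀ i, f i q = 0}

/-- `S` is a Euclidean `C¹` submanifold of codimension `k`. -/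
def IsC1ECodim (k : ℕ) (S : Set (Hpt n)) : Prop :=
  ∀ p ∈ S, ∃ U : Set (Hpt n), IsOpen U ∧ p ∈ U ∧ ∃ f : Fin k → Hpt n → ℝ,
    (∀ i, ContDiff ℝ 1 (f i)) ∧
    (∀ q ∈ U, LinearIndependent ℝ (fun i => fderiv ℝ (f i) q)) ∧
    S ∩ U = {q ∈ U | ∀ i, f i q = 0}

/-- `M` is a Euclidean `k`-dimensional `C¹` submanifold with boundary (`M` closed in its
charts; boundary charts are half-spaces). -/
def IsC1EuclSubWithBdryDim (k : ℕ) (M : Set (Hpt n)) : Prop :=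
  ∀ p ∈ M, ∃ (V : Set (Fin k → ℝ)) (φ : (Fin k → ℝ) → Hpt n) (U : Set (Hpt n)) (a : Fin k → ℝ)
      (i₀ : Fin k),
    IsOpen V ∧ IsOpen U ∧ p ∈ U ∧ a ∈ V ∧ φ a = p ∧
    ContDiffOn ℝ 1 φ V ∧ Set.InjOn φ V ∧
    (∀ b ∈ V, Function.Injective (fderivWithin ℝ φ V b)) ∧
    (M ∩ U = φ '' (V ∩ {x | 0 ≤ x i₀}) ∨ M ∩ U = φ '' V)

/-! ## Isometries -/

/-- A rotation of the horizontal layer: a linear group automorphism commuting with dilations,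
preserving the vertical coordinate and the horizontal Euclidean norm. -/
def IsRotation (R : Hpt n → Hpt n) : Prop :=
  IsLinearMap ℝ R ∧ (∀ p q, R (hmul p q) = hmul (R p) (R q)) ∧
  (∀ l p, R (hdil l p) = hdil l (R p)) ∧
  (∀ p, (R p).2.2 = p.2.2) ∧
  (∀ p, (∑ j, ((R p).1 j ^ 2 + (R p).2.1 j ^ 2)) = ∑ j, (p.1 j ^ 2 + p.2.1 j ^ 2))

/-- An isometry of `ℍⁿ`: the composition of a left translation and a rotation. -/
def IsHIsom (φ : Hpt n → Hpt n) : Prop :=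
  ∃ (g : Hpt n) (R : Hpt n → Hpt n), IsRotation R ∧ φ = fun p => hmul g (R p)

/-! ## Tangent cones and blow-ups -/

/-- The tangent cone `T^ℍ_0 E` at the origin. -/
def tangentConeH (E : Set (Hpt n)) : Set (Hpt n) :=
  {x | ∃ (xh : ℕ → Hpt n) (rh : ℕ → ℝ), (∀ h, xh h ∈ E) ∧ Tendsto rh atTop atTop ∧
        Tendsto (fun h => hdil (rh h) (xh h)) atTop (𝓝 x)}

/-- The tangent cone `T^ℍ_p E = T^ℍ_0(p⁻¹ ⬝ E)`. -/
def tangentConeHAt (E : Set (Hpt n)) (p : Hpt n) : Set (Hpt n) :=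
  tangentConeH ((fun q => hmul (hinv p) q) '' E)

/-- Local Hausdorff convergence of the sets `F l` to `E` as `l → 0⁺`, with respect to the
homogeneous distance `D`. -/
def LocHausConv (D : HomDist n) (F : ℝ → Set (Hpt n)) (E : Set (Hpt n)) : Prop :=
  ∀ (c : Hpt n) (R ε : ℝ), 0 < R → 0 < ε → ∃ l0 : ℝ, 0 < l0 ∧ ∀ l : ℝ, 0 < l → l < l0 →
    (∀ x ∈ F l ∩ {q | D.d c q ≤ R}, ∃ e ∈ E, D.d x e < ε) ∧
    (∀ x ∈ E ∩ {q | D.d c q ≤ R}, ∃ y ∈ F l, D.d x y < ε)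

/-! ## Induced orientation on the boundary -/

/-- `tB` is the value at `p ∈ ∂S` of the orientation induced on `∂S` by the orientation `tS`
of the `m`-dimensional submanifold with boundary `S`. -/
def InducedBdryOrientAt (D : HomDist n) (m : ℕ) (S : Set (Hpt n)) (p : Hpt n)
    (tS : MVec n m) (tB : MVec n (m-1)) : Prop :=
  if m ≤ n then
    -- low dimension: classical Euclidean induced orientation via the outward normal
    ∃ (νc : Fin (2*n+1) → ℝ) (w : Fin (m-1) → (Fin (2*n+1) → ℝ)) (h : (m-1)+1 = m),
      (∀ i j : Fin ((m-1)+1), dotC (Matrix.vecCons νc w i) (Matrix.vecCons νc w j) = if i = j then 1 else 0) ∧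
      rE νc ∉ tangentConeAt ℝ (closure S) p ∧
      -(rE νc) ∈ tangentConeAt ℝ (closure S) p ∧
      (∀ i, rE (w i) ∈ tangentConeAt ℝ (bdry S) p) ∧
      tB = simpleWedge w ∧ tS = mvCast h (simpleWedge (Matrix.vecCons νc w))
  else if m = n+1 then
    -- critical codimension: `±T ∧ τ_{∂S} = t^ℍ_S` according to whether `S` lies below/above ∂S
    ∃ (U : Set (Hpt n)) (f : Fin n → Hpt n → ℝ), IsOpen U ∧ p ∈ U ∧
      (∀ i, IsC1H U (f i)) ∧ (∀ q ∈ U, LinearIndependent ℝ (fun i => gradH (f i) q)) ∧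
      U ∩ closure S ⊆ {q ∈ U | ∀ i, f i q = 0} ∧
      (∀ r : ℝ, 0 < r →
        (hball D p r ∩ ({q ∈ U | ∀ i, f i q = 0} \ closure S)).Nonempty) ∧
      ∃ (ε : ℝ) (w : Fin (m-1) → (Fin (2*n+1) → ℝ)) (h : (m-1)+1 = m),
        (ε = 1 ∨ ε = -1) ∧
        (∀ i j, dotC (w i) (w j) = if i = j then 1 else 0) ∧
        (∀ i, w i ⟨2*n, by omega⟩ = 0) ∧
        (∀ i, rF (w i) p ∈ tangentConeAt ℝ (bdry S) p) ∧
        -- `ε = −1` iff `S` lies above its boundary around `p`: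
        -- the blow-up of `S` at `p` is the corresponding open half of `T^ℍ_pS`
        LocHausConv D (fun l => (fun q => hdil l⁻¹ (hmul (hinv p) q)) '' S)
          ({v | ∀ i, pansuD (f i) p v = 0} ∩ {q | 0 < (-ε) * q.2.2}) ∧
        tB = simpleWedge (fun i => toEc (rF (w i) p)) ∧
        tS = mvCast h (simpleWedge (Matrix.vecCons (fun j => if (j:ℕ) = 2*n then ε else 0) w))
  else
    -- non-critical low codimension: `ν_{∂S} ∧ t^ℍ_{∂S} = t^ℍ_S` with `ν` the outward normal
    ∃ (U : Set (Hpt n)) (f : Fin (2*n+1-m+1) → Hpt n → ℝ),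
      IsBdryFrame (2*n+1-m) S p U f ∧
      ∃ (νc : Fin (2*n+1) → ℝ) (w : Fin (m-1) → (Fin (2*n+1) → ℝ)) (h : (m-1)+1 = m),
        (∀ i j : Fin ((m-1)+1), dotC (Matrix.vecCons νc w i) (Matrix.vecCons νc w j) = if i = j then 1 else 0) ∧
        (∀ i : Fin (2*n+1-m), pansuD (f i.castSucc) p (rE νc) = 0) ∧
        pansuD (f (Fin.last (2*n+1-m))) p (rE νc) < 0 ∧
        (∀ i, ∀ l : Fin (2*n+1-m+1), pansuD (f l) p (rE (w i)) = 0) ∧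
        tB = simpleWedge w ∧ tS = mvCast h (simpleWedge (Matrix.vecCons νc w))

/-! ## Miscellaneous -/

/-- The projection `π_p(q) = Σⱼ xⱼXⱼ(p) + Σⱼ yⱼYⱼ(p) ∈ H_pℍⁿ`. -/
def piProj (p q : Hpt n) : Hpt n :=
  (∑ j : Fin n, q.1 j • frameVec ⟨(j:ℕ), by omega⟩ p) +
  (∑ j : Fin n, q.2.1 j • frameVec ⟨n + (j:ℕ), by omega⟩ p)

/-- The norm `|·|_p` on the horizontal fibre `H_pℍⁿ` making `X₁(p),…,Yₙ(p)` orthonormal. -/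
def hnormAt (_p : Hpt n) (v : Hpt n) : ℝ :=
  Real.sqrt (∑ j, ((v.1 j) ^ 2 + (v.2.1 j) ^ 2))

/-- The left-invariant scalar product making `X₁,…,Yₙ,T` orthonormal. -/
def dotH (v w : Hpt n) : ℝ :=
  (∑ j, v.1 j * w.1 j) + (∑ j, v.2.1 j * w.2.1 j) + v.2.2 * w.2.2

section
/-! ## P1: group algebra and the distance -/

abbrev Hz (n : ℕ) : Type := (Fin n → ℝ) × (Fin n → ℝ)

def hor (q : Hpt n) : Hz n := (q.1, q.2.1)

def emb (u : Hz n) (t : ℝ) : Hpt n := (u.1, u.2, t)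

def om (u v : Hz n) : ℝ := (∑ j, u.1 j * v.2 j) - ∑ j, v.1 j * u.2 j

@[simp] lemma hor_emb (u : Hz n) (t : ℝ) : hor (emb u t) = u := rfl
@[simp] lemma emb_t (u : Hz n) (t : ℝ) : (emb u t).2.2 = t := rfl
@[simp] lemma emb_hor (q : Hpt n) : emb (hor q) q.2.2 = q := rfl
@[simp] lemma hor_zero : hor (0 : Hpt n) = 0 := rfl
@[simp] lemma emb_zero : emb (0 : Hz n) 0 = 0 := rfl

lemma hpt_ext {p q : Hpt n} (h : hor p = hor q) (h' : p.2.2 = q.2.2) : p = q := by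
  rw [← emb_hor p, ← emb_hor q, h, h']

lemma om_add_left (u v w : Hz n) : om (u + v) w = om u w + om v w := by
  simp only [om, Prod.fst_add, Prod.snd_add, Pi.add_apply, add_mul, mul_add,
    Finset.sum_add_distrib]; ring
lemma om_smul_left (c : ℝ) (u w : Hz n) : om (c • u) w = c * om u w := by
  simp only [om, Prod.smul_fst, Prod.smul_snd, Pi.smul_apply, smul_eq_mul, mul_sub, Finset.mul_sum]
  congr 1 <;> refine Finset.sum_congr rfl fun j _ => ?_ <;> ring
lemma om_swap (u v : Hz n) : om u v = - om v u := by
  simp only [om, neg_sub]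
lemma om_self (u : Hz n) : om u u = 0 := by
  have := om_swap u u; linarith
lemma om_add_right (u v w : Hz n) : om u (v + w) = om u v + om u w := by
  rw [om_swap, om_add_left, om_swap u v, om_swap u w]; ring
lemma om_smul_right (c : ℝ) (u w : Hz n) : om u (c • w) = c * om u w := by
  rw [om_swap, om_smul_left, om_swap u w]; ring
@[simp] lemma om_zero_left (w : Hz n) : om 0 w = 0 := by simp [om]
@[simp] lemma om_zero_right (w : Hz n) : om w 0 = 0 := by simp [om]
lemma om_neg_left (u w : Hz n) : om (-u) w = - om u w := by
  have := om_smul_left (-1) u w; simpa using this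
lemma om_neg_right (u w : Hz n) : om u (-w) = - om u w := by
  have := om_smul_right (-1) u w; simpa using this

lemma hmul_def' (p q : Hpt n) :
    hmul p q = emb (hor p + hor q) (p.2.2 + q.2.2 + om (hor p) (hor q) / 2) := by
  refine hpt_ext rfl ?_
  simp only [hmul, emb, om, hor]; ring

@[simp] lemma hor_hmul (p q : Hpt n) : hor (hmul p q) = hor p + hor q := rfl
lemma hmul_t (p q : Hpt n) : (hmul p q).2.2 = p.2.2 + q.2.2 + om (hor p) (hor q) / 2 := by
  rw [hmul_def']; rfl
@[simp] lemma hor_hinv (p : Hpt n) : hor (hinv p) = - hor p := rfl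
@[simp] lemma hinv_t (p : Hpt n) : (hinv p).2.2 = - p.2.2 := rfl
@[simp] lemma hor_hdil (l : ℝ) (p : Hpt n) : hor (hdil l p) = l • hor p := rfl
@[simp] lemma hdil_t (l : ℝ) (p : Hpt n) : (hdil l p).2.2 = l ^ 2 * p.2.2 := rfl

lemma hmul_assoc (p q r : Hpt n) : hmul (hmul p q) r = hmul p (hmul q r) := by
  refine hpt_ext (by simp [add_assoc]) ?_
  simp only [hmul_t, hor_hmul, om_add_left, om_add_right]; ring
@[simp] lemma hmul_zero (p : Hpt n) : hmul p 0 = p :=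
  hpt_ext (by simp) (by simp [hmul_t])
@[simp] lemma zero_hmul (p : Hpt n) : hmul 0 p = p :=
  hpt_ext (by simp) (by simp [hmul_t])
@[simp] lemma hinv_hmul (p : Hpt n) : hmul (hinv p) p = 0 :=
  hpt_ext (by simp) (by simp [hmul_t, om_neg_left, om_self])
@[simp] lemma hmul_hinv (p : Hpt n) : hmul p (hinv p) = 0 :=
  hpt_ext (by simp) (by simp [hmul_t, om_neg_right, om_self])
@[simp] lemma hinv_hmul_cancel (p q : Hpt n) : hmul (hinv p) (hmul p q) = q := by
  rw [← hmul_assoc, hinv_hmul, zero_hmul]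
@[simp] lemma hmul_hinv_cancel (p q : Hpt n) : hmul p (hmul (hinv p) q) = q := by
  rw [← hmul_assoc, hmul_hinv, zero_hmul]
lemma hdil_hmul (l : ℝ) (p q : Hpt n) : hdil l (hmul p q) = hmul (hdil l p) (hdil l q) := by
  refine hpt_ext (by simp) ?_
  simp only [hmul_t, hdil_t, hor_hdil, om_smul_left, om_smul_right]; ring
@[simp] lemma hdil_zero (l : ℝ) : hdil l (0 : Hpt n) = 0 :=
  hpt_ext (by simp) (by simp)
lemma hdil_hdil (l m : ℝ) (p : Hpt n) : hdil l (hdil m p) = hdil (l * m) p :=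
  hpt_ext (by simp [smul_smul]) (by simp; ring)
@[simp] lemma hdil_one (p : Hpt n) : hdil 1 p = p := hpt_ext (by simp) (by simp)
lemma hinv_hinv (p : Hpt n) : hinv (hinv p) = p := hpt_ext (by simp) (by simp)
lemma hinv_hmul_rev (p q : Hpt n) : hinv (hmul p q) = hmul (hinv q) (hinv p) := by
  refine hpt_ext (by simp [add_comm]) ?_
  simp only [hmul_t, hinv_t, hor_hinv, om_neg_left, om_neg_right]
  rw [om_swap (hor p) (hor q)]; ring

lemma continuous_hor : Continuous (hor : Hpt n → Hz n) := by unfold hor; fun_prop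
lemma continuous_emb : Continuous (fun x : Hz n × ℝ => emb x.1 x.2) := by unfold emb; fun_prop
lemma continuous_hmul : Continuous (fun x : Hpt n × Hpt n => hmul x.1 x.2) := by
  unfold hmul; fun_prop
lemma continuous_hinv : Continuous (hinv : Hpt n → Hpt n) := by unfold hinv; fun_prop
lemma continuous_hdil (l : ℝ) : Continuous (hdil l : Hpt n → Hpt n) := by unfold hdil; fun_prop

/-- Homogeneous gauge. -/
def gN (q : Hpt n) : ℝ := max ‖hor q‖ (√|q.2.2|)

lemma gN_nonneg (q : Hpt n) : 0 ≤ gN q := le_max_of_le_left (norm_nonneg _)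
lemma continuous_gN : Continuous (gN : Hpt n → ℝ) := by
  unfold gN
  have := continuous_hor (n := n)
  fun_prop
lemma gN_hdil {l : ℝ} (hl : 0 ≤ l) (q : Hpt n) : gN (hdil l q) = l * gN q := by
  unfold gN
  rw [mul_max_of_nonneg _ _ hl, hor_hdil, norm_smul, Real.norm_of_nonneg hl, hdil_t, abs_mul,
    abs_of_nonneg (sq_nonneg l), Real.sqrt_mul (sq_nonneg l), Real.sqrt_sq hl]
@[simp] lemma gN_zero : gN (0 : Hpt n) = 0 := by simp [gN]
lemma gN_eq_zero {q : Hpt n} : gN q = 0 ↔ q = 0 := by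
  constructor
  · intro h
    have h1 : ‖hor q‖ ≤ 0 := h ▸ le_max_left _ _
    have h2 : √|q.2.2| ≤ 0 := h ▸ le_max_right _ _
    refine hpt_ext (norm_le_zero_iff.1 h1) ?_
    have := Real.sqrt_eq_zero'.1 (le_antisymm h2 (Real.sqrt_nonneg _))
    exact abs_nonpos_iff.1 this
  · rintro rfl; simp
lemma hor_le_gN (q : Hpt n) : ‖hor q‖ ≤ gN q := le_max_left _ _
lemma t_le_gN (q : Hpt n) : |q.2.2| ≤ gN q ^ 2 := by
  have h2 : √|q.2.2| ≤ gN q := le_max_right _ _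
  calc |q.2.2| = √|q.2.2| ^ 2 := (Real.sq_sqrt (abs_nonneg _)).symm
    _ ≤ _ := by gcongr
lemma gN_emb_zero (u : Hz n) : gN (emb u 0) = ‖u‖ := by simp [gN]

namespace HomDist
variable (D : HomDist n)

lemma self (p : Hpt n) : D.d p p = 0 := (D.eq_iff p p).2 rfl
lemma nonneg (p q : Hpt n) : 0 ≤ D.d p q := by
  have := D.triangle p q p
  rw [D.self, D.symm q p] at this; linarith
lemma eq_zero_inv (p q : Hpt n) : D.d p q = D.d 0 (hmul (hinv p) q) := by
  rw [← D.leftInv (hinv p) p q, hinv_hmul]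
lemma d_mul_right (p q : Hpt n) : D.d p (hmul p q) = D.d 0 q := by
  rw [D.eq_zero_inv, hinv_hmul_cancel]
lemma d_dil {l : ℝ} (hl : 0 < l) (q : Hpt n) : D.d 0 (hdil l q) = l * D.d 0 q := by
  have := D.homog l hl 0 q; rwa [hdil_zero] at this

lemma exists_upper (hn : 1 ≤ n) : ∃ C : ℝ, 0 < C ∧ ∀ q : Hpt n, D.d 0 q ≤ C * gN q := by
  let i0 : Fin n := ⟨0, by omega⟩
  let e : Hpt n := (Pi.single i0 1, 0, 0)
  set c1 := D.d 0 e
  set c2 := D.d 0 (emb 0 1) + D.d 0 (emb 0 (-1))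
  have hc1 : 0 ≤ c1 := D.nonneg _ _
  have hc2 : 0 ≤ c2 := add_nonneg (D.nonneg _ _) (D.nonneg _ _)
  have hA : ∀ u : Hz n, D.d 0 (emb u 0) ≤ (2 * n + 1) * c1 * ‖u‖ := by
    intro u
    set s := ∑ j, (u.1 j ^ 2 + u.2 j ^ 2)
    have hs0 : 0 ≤ s := Finset.sum_nonneg fun j _ => by positivity
    have hs : s ≤ ((2 * n + 1) * ‖u‖) ^ 2 := by
      have : s ≤ ∑ j : Fin n, (2 * ‖u‖ ^ 2) := by
        refine Finset.sum_le_sum fun j _ => ?_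
        have h1 : |u.1 j| ≤ ‖u‖ := (norm_le_pi_norm u.1 j).trans (norm_fst_le u)
        have h2 : |u.2 j| ≤ ‖u‖ := (norm_le_pi_norm u.2 j).trans (norm_snd_le u)
        have h1' := sq_le_sq' (by linarith [abs_nonneg (u.1 j), norm_nonneg u]) h1
        have h2' := sq_le_sq' (by linarith [abs_nonneg (u.2 j), norm_nonneg u]) h2
        rw [sq_abs] at h1' h2'; linarith
      refine this.trans ?_
      simp only [Finset.sum_const, Finset.card_univ, Fintype.card_fin, nsmul_eq_mul]
      have h0 : (0:ℝ) ≤ n := Nat.cast_nonneg n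
      nlinarith [sq_nonneg ‖u‖, mul_nonneg h0 (sq_nonneg ‖u‖), mul_nonneg (mul_nonneg h0 h0) (sq_nonneg ‖u‖)]
    have hrot : D.d 0 (emb u 0) = D.d 0 (hdil (√s) e) := by
      refine D.rotInv _ _ ?_ ?_
      · simp only [emb, hdil, e]
        have : ∀ j, ((√s • (Pi.single i0 1 : Fin n → ℝ)) j ^ 2 + (√s • (0 : Fin n → ℝ)) j ^ 2)
          = Pi.single (M := fun _ => ℝ) i0 s j := by
          intro j
          by_cases h : j = i0
          · subst h; simp [Real.sq_sqrt hs0]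
          · simp [h]
        simp only [this, Finset.sum_pi_single', Finset.mem_univ, if_true]
        rfl
      · simp [emb, hdil, e]
    rw [hrot]
    rcases hs0.eq_or_lt with h | h
    · rw [← h, Real.sqrt_zero]
      have : hdil 0 e = 0 := hpt_ext (by simp) (by simp)
      rw [this, D.self]; positivity
    · rw [D.d_dil (Real.sqrt_pos.2 h)]
      have : √s ≤ (2 * n + 1) * ‖u‖ := Real.sqrt_le_iff.2 ⟨by positivity, hs⟩
      calc √s * D.d 0 e ≤ ((2 * n + 1) * ‖u‖) * c1 := by gcongr
        _ = _ := by ring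
  have hB : ∀ t : ℝ, D.d 0 (emb 0 t) ≤ c2 * √|t| := by
    intro t
    rcases lt_trichotomy t 0 with h | h | h
    · have : (emb 0 t : Hpt n) = hdil (√|t|) (emb 0 (-1)) :=
        hpt_ext (by simp) (by simp only [emb_t, hdil_t, abs_of_neg h]; rw [Real.sq_sqrt (by linarith)]; ring)
      rw [this, D.d_dil (Real.sqrt_pos.2 (abs_pos.2 h.ne)), mul_comm]
      gcongr
      exact le_add_of_nonneg_left (D.nonneg _ _)
    · subst h; simp [D.self]
    · have : (emb 0 t : Hpt n) = hdil (√|t|) (emb 0 1) :=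
        hpt_ext (by simp) (by simp only [emb_t, hdil_t, abs_of_pos h]; rw [Real.sq_sqrt (by linarith)]; ring)
      rw [this, D.d_dil (Real.sqrt_pos.2 (abs_pos.2 h.ne')), mul_comm]
      gcongr
      exact le_add_of_nonneg_right (D.nonneg _ _)
  refine ⟨(2 * n + 1) * c1 + c2 + 1, by positivity, fun q => ?_⟩
  have hq : q = hmul (emb (hor q) 0) (emb 0 q.2.2) := hpt_ext (by simp) (by simp [hmul_t])
  have h1 := D.triangle 0 (emb (hor q) 0) q
  have h2 : D.d (emb (hor q) 0) q = D.d 0 (emb 0 q.2.2) := by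
    conv_lhs => rw [hq]
    rw [hor_hmul, hor_emb, hor_emb, add_zero, D.d_mul_right]
  rw [h2] at h1
  have h3 := hA (hor q)
  have h4 := hB q.2.2
  have h5 : √|q.2.2| ≤ gN q := le_max_right _ _
  have h6 := hor_le_gN q
  calc D.d 0 q ≤ (2 * n + 1) * c1 * ‖hor q‖ + c2 * √|q.2.2| := by linarith
    _ ≤ (2 * n + 1) * c1 * gN q + c2 * gN q := by gcongr
    _ ≤ _ := by nlinarith [gN_nonneg q]

lemma tendsto_of_gN (D : HomDist n) (hn : 1 ≤ n) (p : Hpt n) : Tendsto (fun q => D.d p q) (𝓝 p) (𝓝 0) := by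
  obtain ⟨C, hC, h⟩ := D.exists_upper hn
  have h1 : Tendsto (fun q => C * gN (hmul (hinv p) q)) (𝓝 p) (𝓝 0) := by
    have : Continuous fun q => C * gN (hmul (hinv p) q) := by
      refine continuous_const.mul (continuous_gN.comp ?_)
      exact continuous_hmul.comp (continuous_const.prodMk continuous_id)
    have := this.tendsto p
    simpa using this
  refine squeeze_zero (fun q => D.nonneg _ _) (fun q => ?_) h1
  rw [D.eq_zero_inv]; exact h _

lemma continuous_d (hn : 1 ≤ n) : Continuous fun x : Hpt n × Hpt n => D.d x.1 x.2 := by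
  rw [continuous_iff_continuousAt]
  rintro ⟨p, q⟩
  have h1 : Tendsto (fun x : Hpt n × Hpt n => D.d p x.1 + D.d q x.2) (𝓝 (p, q)) (𝓝 0) := by
    have a := (D.tendsto_of_gN hn p).comp (continuous_fst.tendsto (p, q))
    have b := (D.tendsto_of_gN hn q).comp (continuous_snd.tendsto (p, q))
    simpa using a.add b
  rw [ContinuousAt, tendsto_iff_dist_tendsto_zero]
  refine squeeze_zero (fun _ => dist_nonneg) (fun x => ?_) h1
  rw [Real.dist_eq, abs_le]
  have t1 := D.triangle x.1 p x.2
  have t2 := D.triangle p q x.2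
  have t3 := D.triangle p x.1 q
  have t4 := D.triangle x.1 x.2 q
  have s1 := D.symm x.1 p
  have s2 := D.symm x.2 q
  constructor <;> linarith

lemma exists_lower (hn : 1 ≤ n) : ∃ c : ℝ, 0 < c ∧ ∀ q : Hpt n, c * gN q ≤ D.d 0 q := by
  set K : Set (Hpt n) := {q | gN q = 1}
  have hKc : IsClosed K := isClosed_eq continuous_gN continuous_const
  have hK : IsCompact K := by
    refine Metric.isCompact_of_isClosed_isBounded hKc ?_
    refine (Metric.isBounded_closedBall (x := (0 : Hpt n)) (r := 1)).subset fun q hq => ?_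
    rw [mem_closedBall_zero_iff]
    have h1 : ‖hor q‖ ≤ 1 := (hor_le_gN q).trans hq.le
    have h2 : |q.2.2| ≤ 1 := (t_le_gN q).trans (by rw [show gN q = 1 from hq]; norm_num)
    refine max_le ((norm_fst_le (hor q)).trans h1) (max_le ((norm_snd_le (hor q)).trans h1) h2)
  rcases K.eq_empty_or_nonempty with h | h
  · refine ⟨1, one_pos, fun q => ?_⟩
    by_cases h0 : gN q = 0
    · rw [h0, mul_zero]; exact D.nonneg _ _
    · exfalso
      have hp : 0 < gN q := lt_of_le_of_ne (gN_nonneg q) (Ne.symm h0)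
      have : hdil (gN q)⁻¹ q ∈ K := by
        show gN _ = 1
        rw [gN_hdil (by positivity), inv_mul_cancel₀ h0]
      rw [h] at this; exact this
  · have hcont : Continuous fun q => D.d 0 q :=
      (D.continuous_d hn).comp (continuous_const.prodMk continuous_id)
    obtain ⟨q0, hq0, hmin⟩ := hK.exists_isMinOn h hcont.continuousOn
    have hpos : 0 < D.d 0 q0 := by
      refine lt_of_le_of_ne (D.nonneg _ _) fun h0 => ?_
      have h1 := (D.eq_iff 0 q0).1 h0.symm
      have : gN q0 = 1 := hq0
      rw [← h1] at this; simp at this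
    refine ⟨D.d 0 q0, hpos, fun q => ?_⟩
    by_cases h0 : gN q = 0
    · rw [h0, mul_zero]; exact D.nonneg _ _
    · have hp : 0 < gN q := lt_of_le_of_ne (gN_nonneg q) (Ne.symm h0)
      have hm : hdil (gN q)⁻¹ q ∈ K := by
        show gN _ = 1
        rw [gN_hdil (by positivity), inv_mul_cancel₀ h0]
      have h1 : D.d 0 q0 ≤ D.d 0 (hdil (gN q)⁻¹ q) := hmin hm
      rw [D.d_dil (by positivity)] at h1
      rw [inv_mul_eq_div, le_div_iff₀ hp] at h1
      exact h1

/-- The metric structure, whose topology is the standard one. -/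
lemma nhds_eq (hn : 1 ≤ n) (p : Hpt n) : 𝓝 p = ⨅ ε > (0:ℝ), 𝓟 {q | D.d p q < ε} := by
  obtain ⟨c, hc, hlow⟩ := D.exists_lower hn
  have hb : (⨅ ε > (0:ℝ), 𝓟 {q | D.d p q < ε}).HasBasis (fun ε : ℝ => 0 < ε)
      (fun ε => {q | D.d p q < ε}) := by
    refine hasBasis_biInf_principal' (fun a ha b hb => ?_) ⟨1, one_pos⟩
    refine ⟨min a b, lt_min ha hb, fun q hq => ?_, fun q hq => ?_⟩
    · exact lt_of_lt_of_le (show D.d p q < min a b from hq) (min_le_left _ _)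
    · exact lt_of_lt_of_le (show D.d p q < min a b from hq) (min_le_right _ _)
  apply le_antisymm
  · refine le_iInf₂ fun ε hε => ?_
    rw [le_principal_iff]
    exact (D.tendsto_of_gN hn p).eventually (gt_mem_nhds hε)
  · -- convergence in `d` implies Euclidean convergence
    have h1 : Tendsto (fun q => D.d p q) (⨅ ε > (0:ℝ), 𝓟 {q | D.d p q < ε}) (𝓝 0) := by
      rw [Metric.tendsto_nhds]
      intro ε hε
      refine hb.mem_iff.2 ⟨ε, hε, fun q hq => ?_⟩
      simp only [Set.mem_ofPred_eq, Real.dist_eq, sub_zero, abs_of_nonneg (D.nonneg _ _)] at hq ⊢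
      exact hq
    have h2 : Tendsto (fun q => gN (hmul (hinv p) q)) (⨅ ε > (0:ℝ), 𝓟 {q | D.d p q < ε}) (𝓝 0) := by
      have : Tendsto (fun q => c⁻¹ * D.d p q) (⨅ ε > (0:ℝ), 𝓟 {q | D.d p q < ε}) (𝓝 0) := by
        simpa using h1.const_mul c⁻¹
      refine squeeze_zero (fun _ => gN_nonneg _) (fun q => ?_) this
      rw [D.eq_zero_inv, inv_mul_eq_div, le_div_iff₀ hc, mul_comm]; exact hlow _
    have h3 : Tendsto (fun q => hmul (hinv p) q) (⨅ ε > (0:ℝ), 𝓟 {q | D.d p q < ε}) (𝓝 0) := by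
      have hh : Tendsto (fun q => hor (hmul (hinv p) q)) (⨅ ε > (0:ℝ), 𝓟 {q | D.d p q < ε}) (𝓝 0) :=
        squeeze_zero_norm (fun q => hor_le_gN _) h2
      have ht : Tendsto (fun q => (hmul (hinv p) q).2.2) (⨅ ε > (0:ℝ), 𝓟 {q | D.d p q < ε}) (𝓝 0) :=
        squeeze_zero_norm (fun q => t_le_gN _) (by simpa using h2.pow 2)
      have := (continuous_emb (n := n)).tendsto ((0 : Hz n), (0:ℝ))
      exact this.comp (hh.prodMk_nhds ht)
    have h4 : Tendsto (fun q => hmul p (hmul (hinv p) q)) (⨅ ε > (0:ℝ), 𝓟 {q | D.d p q < ε})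
        (𝓝 (hmul p 0)) :=
      ((continuous_hmul.comp (continuous_const.prodMk continuous_id)).tendsto (0 : Hpt n)).comp h3
    simp only [hmul_hinv_cancel, hmul_zero] at h4
    exact h4

lemma nhds_basis (hn : 1 ≤ n) (p : Hpt n) :
    (𝓝 p).HasBasis (fun ε : ℝ => 0 < ε) (fun ε => {q | D.d p q < ε}) := by
  rw [D.nhds_eq hn p]
  refine hasBasis_biInf_principal' (fun a ha b hb => ?_) ⟨1, one_pos⟩
  refine ⟨min a b, lt_min ha hb, fun q hq => ?_, fun q hq => ?_⟩
  · exact lt_of_lt_of_le (show D.d p q < min a b from hq) (min_le_left _ _)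
  · exact lt_of_lt_of_le (show D.d p q < min a b from hq) (min_le_right _ _)

@[reducible] def metric (hn : 1 ≤ n) : MetricSpace (Hpt n) :=
  let m : MetricSpace (Hpt n) :=
    { dist := D.d
      dist_self := D.self
      dist_comm := D.symm
      dist_triangle := D.triangle
      eq_of_dist_eq_zero := fun {x y} h => (D.eq_iff x y).1 h }
  m.replaceTopology (by
    refine TopologicalSpace.ext_nhds fun p => ?_
    refine (D.nhds_basis hn p).eq_of_same_basis ?_
    have h := @Metric.nhds_basis_ball (Hpt n) m.toPseudoMetricSpace p
    refine h.to_hasBasis (fun ε hε => ⟨ε, hε, fun q hq => ?_⟩) (fun ε hε => ⟨ε, hε, fun q hq => ?_⟩)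
    · show D.d q p < ε
      rw [D.symm]; exact hq
    · have : D.d q p < ε := hq
      rw [D.symm] at this; exact this)
end HomDist
end

section
/-! ## P2: abstract density theorem for spherical measures -/
section sph
variable {X : Type*} [MetricSpace X]

def gauA (m r : ℝ) (s : Set X) : ℝ≥0∞ :=
  ⨅ (c : X) (ρ : ℝ) (_ : 0 < ρ) (_ : ρ < r) (_ : s ⊆ {q | dist c q < ρ}),
    ENNReal.ofReal ((2*ρ) ^ m)
def preA (m r : ℝ) : OuterMeasure X := OuterMeasure.boundedBy (gauA m r)
def outA (m : ℝ) : OuterMeasure X := ⨆ (r : ℝ) (_ : 0 < r), preA m r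

lemma preA_le_of_subset {m r ρ : ℝ} {c : X} {s : Set X} (h0 : 0 < ρ) (h1 : ρ < r)
    (hs : s ⊆ {q | dist c q < ρ}) : preA m r s ≤ ENNReal.ofReal ((2*ρ)^m) := by
  refine (OuterMeasure.boundedBy_le _).trans ?_
  exact iInf_le_of_le c (iInf_le_of_le ρ (iInf_le_of_le h0 (iInf_le_of_le h1 (iInf_le _ hs))))

lemma preA_le_outA {m r : ℝ} (hr : 0 < r) (s : Set X) : preA m r s ≤ outA m s := by
  unfold outA
  exact (le_iSup₂ (f := fun (r : ℝ) (_ : 0 < r) => (preA m r : OuterMeasure X)) r hr) s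

lemma outA_le {m : ℝ} {s : Set X} {b : ℝ≥0∞} (h : ∀ r : ℝ, 0 < r → preA m r s ≤ b) :
    outA m s ≤ b := by
  unfold outA
  simp only [OuterMeasure.iSup_apply]
  exact iSup₂_le h

variable [MeasurableSpace X] [BorelSpace X] [SecondCountableTopology X]

lemma outA_lower (ν : Measure X) (m : ℝ) (S : Set X) (hνS : ν Sᶜ = 0)
    (H1 : ∀ x ∈ S, ∀ κ : ℝ, 1 < κ → ∃ δ > 0, ∀ r : ℝ, 0 < r → r < δ → ∀ y, dist y x < r →
      ν {q | dist y q < r} ≤ ENNReal.ofReal (κ * (2*r)^m)) (A : Set X) :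
    ν A ≤ outA m A := by
  have key : ∀ κ : ℝ, 1 < κ → ν A ≤ ENNReal.ofReal κ * outA m A := by
    intro κ hκ
    let E : ℕ → Set X := fun k => {x ∈ S | ∀ r : ℝ, 0 < r → r < 1 / ((k:ℝ)+1) → ∀ y, dist y x < r →
      ν {q | dist y q < r} ≤ ENNReal.ofReal (κ * (2*r)^m)}
    have hE : Monotone E := by
      intro k l hkl x hx
      refine ⟨hx.1, fun r h0 h1 y hy => hx.2 r h0 (h1.trans_le ?_) y hy⟩
      exact one_div_le_one_div_of_le (by positivity) (by exact_mod_cast Nat.succ_le_succ hkl)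
    have hU : S ⊆ ⋃ k, E k := by
      intro x hx
      obtain ⟨δ, hδ, h⟩ := H1 x hx κ hκ
      obtain ⟨k, hk⟩ := exists_nat_one_div_lt hδ
      exact mem_iUnion.2 ⟨k, hx, fun r h0 h1 y hy => h r h0 (h1.trans hk) y hy⟩
    have h1 : ∀ k, ν (A ∩ E k) ≤ ENNReal.ofReal κ * outA m A := by
      intro k
      have hpos : (0:ℝ) < 1 / ((k:ℝ)+1) := by positivity
      have hle : OuterMeasure.restrict (E k) ν.toOuterMeasure ≤
          ENNReal.ofReal κ • (preA m (1 / ((k:ℝ)+1)) : OuterMeasure X) := by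
        unfold preA
        rw [OuterMeasure.smul_boundedBy ENNReal.ofReal_ne_top, OuterMeasure.le_boundedBy]
        intro s
        rw [OuterMeasure.restrict_apply]
        simp only [Pi.smul_apply, smul_eq_mul]
        rcases (s ∩ E k).eq_empty_or_nonempty with he | ⟨x, hxs, hxE⟩
        · rw [he]; simp
        · unfold gauA
          have hK0 : ENNReal.ofReal κ ≠ 0 := by simp; linarith
          simp only [ENNReal.mul_iInf_of_ne hK0 ENNReal.ofReal_ne_top]
          refine le_iInf fun c => le_iInf fun ρ => le_iInf fun h0 => le_iInf fun h1 => le_iInf fun hs => ?_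
          rw [← ENNReal.ofReal_mul (by linarith)]
          refine le_trans (measure_mono ?_) (hxE.2 ρ h0 h1 c (hs hxs))
          exact inter_subset_left.trans hs
      have := hle A
      rw [OuterMeasure.restrict_apply] at this
      refine le_trans this ?_
      simp only [smul_apply, smul_eq_mul]
      exact mul_le_mul' le_rfl (preA_le_outA hpos A)
    have h2 : ν A ≤ ν (⋃ k, A ∩ E k) := by
      rw [← inter_iUnion]
      refine (measure_le_inter_add_sdiff ν A S).trans ?_
      have h3 : ν (A \ S) = 0 := measure_mono_null (fun x hx => hx.2) hνS
      rw [h3, add_zero]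
      exact measure_mono (inter_subset_inter_right _ hU)
    refine h2.trans ?_
    rw [Monotone.measure_iUnion (fun k l h => inter_subset_inter_right _ (hE h))]
    exact iSup_le h1
  rcases eq_or_ne (outA m A) ⊤ with ht | ht
  · rw [ht]; exact le_top
  have : Tendsto (fun κ : ℝ => ENNReal.ofReal κ * outA m A) (𝓝[>] 1) (𝓝 (ENNReal.ofReal 1 * outA m A)) := by
    refine ENNReal.Tendsto.mul_const ?_ (Or.inr ht)
    exact (ENNReal.continuous_ofReal.tendsto 1).mono_left nhdsWithin_le_nhds
  rw [ENNReal.ofReal_one, one_mul] at this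
  exact ge_of_tendsto this (eventually_nhdsWithin_of_forall fun κ hκ => key κ hκ)

lemma outA_null (ν : Measure X) [IsFiniteMeasure ν] (m : ℝ) (S : Set X)
    (H2 : ∀ x ∈ S, ∀ κ : ℝ, 1 < κ → ∀ δ > 0, ∃ r : ℝ, 0 < r ∧ r < δ ∧ ∃ y, dist y x < r ∧
      ENNReal.ofReal ((2*r)^m) ≤ ENNReal.ofReal κ * ν {q | dist y q < r}) (N : Set X) (hN : N ⊆ S)
    (h0 : ν N = 0) {R : ℝ} (hR : 0 < R) : preA m R N = 0 := by
  classical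
  have key : ∀ η : ℝ≥0∞, η ≠ 0 → preA m R N ≤ ENNReal.ofReal (6^m) * 2 * η := by
    intro η hη
    obtain ⟨V, hNV, hVo, hV⟩ := N.exists_isOpen_le_add ν hη
    rw [h0, zero_add] at hV
    have hch : ∀ x : N, ∃ (r : ℝ) (y : X), 0 < r ∧ r < R / 6 ∧ dist y x < r ∧
        Metric.closedBall y r ⊆ V ∧ ENNReal.ofReal ((2*r)^m) ≤ 2 * ν {q | dist y q < r} := by
      intro x
      obtain ⟨δ, hδ, hb⟩ := Metric.isOpen_iff.1 hVo x (hNV x.2)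
      obtain ⟨r, hr0, hr, y, hy, h⟩ := H2 x (hN x.2) 2 (by norm_num) (min (R/6) (δ/2)) (by positivity)
      refine ⟨r, y, hr0, hr.trans_le (min_le_left _ _), hy, fun z hz => hb ?_, ?_⟩
      · have := hr.trans_le (min_le_right _ _)
        rw [Metric.mem_closedBall] at hz
        rw [Metric.mem_ball]
        have := dist_triangle z y x
        linarith
      · rwa [ENNReal.ofReal_ofNat] at h
    choose r y hr0 hrR hd hsub hle using hch
    obtain ⟨u, -, hdis, hcov⟩ := Vitali.exists_disjoint_subfamily_covering_enlargement_closedBall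
      (univ : Set N) y r (R/6) (fun a _ => (hrR a).le) 5 (by norm_num)
    have hcount : u.Countable := by
      refine hdis.countable_of_nonempty_interior fun a _ => ⟨y a, ?_⟩
      exact Metric.ball_subset_interior_closedBall (Metric.mem_ball_self (hr0 a))
    have hNc : N ⊆ ⋃ b ∈ u, Metric.closedBall (y b) (5 * r b) := by
      intro x hx
      obtain ⟨b, hb, h⟩ := hcov ⟨x, hx⟩ (mem_univ _)
      refine mem_iUnion₂.2 ⟨b, hb, h ?_⟩
      rw [Metric.mem_closedBall, dist_comm]; exact (hd ⟨x, hx⟩).le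
    have := hcount.to_subtype
    calc preA m R N ≤ preA m R (⋃ b ∈ u, Metric.closedBall (y b) (5 * r b)) := (preA m R).mono hNc
      _ ≤ ∑' b : u, preA m R (Metric.closedBall (y b) (5 * r b)) := by
        rw [biUnion_eq_iUnion]; exact measure_iUnion_le _
      _ ≤ ∑' b : u, ENNReal.ofReal (6^m) * 2 * ν (Metric.closedBall (y b) (r b)) := by
        refine ENNReal.tsum_le_tsum fun b => ?_
        refine (preA_le_of_subset (c := y b) (ρ := 6 * r b) (by linarith [hr0 b]) (by linarith [hrR b]) ?_).trans ?_
        · intro q hq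
          rw [Metric.mem_closedBall, dist_comm] at hq
          show dist (y b) q < 6 * r b
          linarith [hr0 b]
        · rw [show 2 * (6 * r b) = 6 * (2 * r b) by ring, Real.mul_rpow (by norm_num) (by linarith [hr0 b]),
            ENNReal.ofReal_mul (by positivity), mul_assoc]
          gcongr
          refine (hle b).trans ?_
          gcongr
          intro q hq
          have hq : dist (y b) q < r b := hq
          rw [Metric.mem_closedBall, dist_comm]; exact hq.le
      _ = ENNReal.ofReal (6^m) * 2 * ∑' b : u, ν (Metric.closedBall (y b) (r b)) := ENNReal.tsum_mul_left
      _ = ENNReal.ofReal (6^m) * 2 * ν (⋃ b ∈ u, Metric.closedBall (y b) (r b)) := by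
        rw [measure_biUnion hcount hdis (fun _ _ => Metric.isClosed_closedBall.measurableSet)]
      _ ≤ ENNReal.ofReal (6^m) * 2 * η := by
        gcongr
        exact (measure_mono (iUnion₂_subset fun b _ => hsub b)).trans hV
  have ht : Tendsto (fun η : ℝ≥0∞ => ENNReal.ofReal (6^m) * 2 * η) (𝓝[>] 0) (𝓝 (ENNReal.ofReal (6^m) * 2 * 0)) :=
    ENNReal.Tendsto.const_mul (tendsto_id.mono_left nhdsWithin_le_nhds)
      (Or.inr (ENNReal.mul_ne_top ENNReal.ofReal_ne_top (by simp)))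
  rw [mul_zero] at ht
  exact le_antisymm (ge_of_tendsto ht (eventually_nhdsWithin_of_forall fun η hη => key η (ne_of_gt hη))) bot_le

lemma outA_upper (ν : Measure X) [IsFiniteMeasure ν] (m : ℝ) (S : Set X)
    (H1 : ∀ x ∈ S, ∀ κ : ℝ, 1 < κ → ∃ δ > 0, ∀ r : ℝ, 0 < r → r < δ → ∀ y, dist y x < r →
      ν {q | dist y q < r} ≤ ENNReal.ofReal (κ * (2*r)^m))
    (H2 : ∀ x ∈ S, ∀ κ : ℝ, 1 < κ → ∀ δ > 0, ∃ r : ℝ, 0 < r ∧ r < δ ∧ ∃ y, dist y x < r ∧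
      ENNReal.ofReal ((2*r)^m) ≤ ENNReal.ofReal κ * ν {q | dist y q < r}) (A : Set X) (hA : A ⊆ S) :
    outA m A ≤ ν A := by
  classical
  have key : ∀ R : ℝ, 0 < R → ∀ κ : ℝ, 1 < κ → preA m R A ≤ ENNReal.ofReal (κ^m * κ) * (ν A + ENNReal.ofReal (κ - 1)) := by
    intro R hR κ hκ
    have hκ1 : ENNReal.ofReal (κ - 1) ≠ 0 := by simp; linarith
    obtain ⟨V, hAV, hVo, hV⟩ := A.exists_isOpen_le_add ν hκ1
    let t : Set (X × X × ℝ) := {a | a.1 ∈ A ∧ 0 < a.2.2 ∧ a.2.2 < R / κ ∧ dist a.2.1 a.1 < a.2.2 ∧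
      Metric.closedBall a.2.1 a.2.2 ⊆ V ∧
      ENNReal.ofReal ((2*a.2.2)^m) ≤ ENNReal.ofReal κ * ν {q | dist a.2.1 q < a.2.2} ∧
      ν (Metric.closedBall a.1 (3 * (2 * a.2.2))) ≤ (κ * 7 ^ m * κ).toNNReal * ν (Metric.closedBall a.2.1 a.2.2)}
    have hballs : ∀ (y : X) (r : ℝ), {q | dist y q < r} ⊆ Metric.closedBall y r := by
      intro y r q hq
      have hq : dist y q < r := hq
      rw [Metric.mem_closedBall, dist_comm]; exact hq.le
    obtain ⟨u, hut, hcount, hdis, hnull⟩ := Vitali.exists_disjoint_covering_ae ν A t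
      (κ * 7 ^ m * κ).toNNReal (fun a => 2 * a.2.2) (fun a => a.1)
      (fun a => Metric.closedBall a.2.1 a.2.2)
      (fun a ha => by
        obtain ⟨-, h0, -, hd, -⟩ := ha
        intro q hq
        rw [Metric.mem_closedBall] at hq ⊢
        have := dist_triangle q a.2.1 a.1
        linarith)
      (fun a ha => ha.2.2.2.2.2.2)
      (fun a ha => ⟨a.2.1, Metric.ball_subset_interior_closedBall (Metric.mem_ball_self ha.2.1)⟩)
      (fun a ha => Metric.isClosed_closedBall)
      (fun x hx ε hε => by
        obtain ⟨δ, hδ, hb⟩ := Metric.isOpen_iff.1 hVo x (hAV hx)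
        obtain ⟨δ1, hδ1, h1⟩ := H1 x (hA hx) κ hκ
        obtain ⟨r, hr0, hr, y, hy, h⟩ := H2 x (hA hx) κ hκ (min (min (R/κ) (δ/2)) (min (δ1/7) (ε/2)))
          (by have : 0 < κ := by linarith
              positivity)
        simp only [lt_min_iff] at hr
        obtain ⟨⟨hr1, hr2⟩, hr3, hr4⟩ := hr
        refine ⟨(x, y, r), ⟨hx, hr0, hr1, hy, fun z hz => hb ?_, h, ?_⟩, by simp only; linarith, rfl⟩
        · rw [Metric.mem_closedBall] at hz
          rw [Metric.mem_ball]
          have := dist_triangle z y x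
          linarith
        · simp only
          have h3 := h1 (7 * r) (by linarith) (by linarith) x (by rw [dist_self]; linarith)
          calc ν (Metric.closedBall x (3 * (2 * r))) ≤ ν {q | dist x q < 7 * r} := by
                refine measure_mono fun q hq => ?_
                rw [Metric.mem_closedBall, dist_comm] at hq
                show dist x q < 7 * r
                linarith
            _ ≤ ENNReal.ofReal (κ * (2 * (7 * r))^m) := h3
            _ = ENNReal.ofReal (κ * 7 ^ m) * ENNReal.ofReal ((2*r)^m) := by
                rw [← ENNReal.ofReal_mul (by positivity), show 2 * (7 * r) = 7 * (2 * r) by ring,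
                  Real.mul_rpow (by norm_num) (by linarith), mul_assoc]
            _ ≤ ENNReal.ofReal (κ * 7 ^ m) * (ENNReal.ofReal κ * ν {q | dist y q < r}) := by gcongr
            _ = ENNReal.ofReal (κ * 7 ^ m * κ) * ν {q | dist y q < r} := by
                rw [← mul_assoc, ← ENNReal.ofReal_mul (by positivity)]
            _ ≤ (κ * 7 ^ m * κ).toNNReal * ν (Metric.closedBall y r) := by
                refine mul_le_mul' le_rfl (measure_mono (hballs y r)))
    have := hcount.to_subtype
    have hcov : A ⊆ (⋃ a ∈ u, Metric.closedBall a.2.1 a.2.2) ∪ (A \ ⋃ a ∈ u, Metric.closedBall a.2.1 a.2.2) := by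
      intro x hx
      by_cases h : x ∈ ⋃ a ∈ u, Metric.closedBall a.2.1 a.2.2
      · exact Or.inl h
      · exact Or.inr ⟨hx, h⟩
    calc preA m R A ≤ preA m R (⋃ a ∈ u, Metric.closedBall a.2.1 a.2.2) +
          preA m R (A \ ⋃ a ∈ u, Metric.closedBall a.2.1 a.2.2) :=
          ((preA m R).mono hcov).trans (measure_union_le _ _)
      _ = preA m R (⋃ a ∈ u, Metric.closedBall a.2.1 a.2.2) := by
          rw [outA_null ν m S H2 _ (sdiff_subset.trans hA) hnull hR, add_zero]
      _ ≤ ∑' a : u, preA m R (Metric.closedBall a.1.2.1 a.1.2.2) := by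
        rw [biUnion_eq_iUnion]; exact measure_iUnion_le _
      _ ≤ ∑' a : u, ENNReal.ofReal (κ^m * κ) * ν (Metric.closedBall a.1.2.1 a.1.2.2) := by
        refine ENNReal.tsum_le_tsum fun a => ?_
        obtain ⟨-, h0, hr, -, -, h5, -⟩ := hut a.2
        have hκ0 : 0 < κ := by linarith
        refine (preA_le_of_subset (c := a.1.2.1) (ρ := κ * a.1.2.2) (by positivity) ?_ ?_).trans ?_
        · rw [lt_div_iff₀ hκ0] at hr; linarith
        · intro q hq
          rw [Metric.mem_closedBall, dist_comm] at hq
          show dist a.1.2.1 q < κ * a.1.2.2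
          nlinarith
        · rw [show 2 * (κ * a.1.2.2) = κ * (2 * a.1.2.2) by ring, Real.mul_rpow hκ0.le (by linarith),
            ENNReal.ofReal_mul (by positivity), ENNReal.ofReal_mul (by positivity), mul_assoc]
          gcongr
          refine h5.trans ?_
          gcongr
          exact hballs _ _
      _ = ENNReal.ofReal (κ^m * κ) * ν (⋃ a ∈ u, Metric.closedBall a.2.1 a.2.2) := by
        rw [ENNReal.tsum_mul_left, measure_biUnion hcount hdis (fun _ _ => Metric.isClosed_closedBall.measurableSet)]
      _ ≤ _ := by
        gcongr
        exact (measure_mono (iUnion₂_subset fun a ha => (hut ha).2.2.2.2.1)).trans hV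
  refine outA_le fun R hR => ?_
  have ht : Tendsto (fun κ : ℝ => ENNReal.ofReal (κ^m * κ) * (ν A + ENNReal.ofReal (κ - 1))) (𝓝[>] 1)
      (𝓝 (ENNReal.ofReal ((1:ℝ)^m * 1) * (ν A + ENNReal.ofReal (1 - 1)))) := by
    refine Tendsto.mono_left ?_ nhdsWithin_le_nhds
    refine ENNReal.Tendsto.mul ?_ (Or.inl (by simp)) ?_ (Or.inr ENNReal.ofReal_ne_top)
    · refine (ENNReal.continuous_ofReal.tendsto _).comp ?_
      exact ((Real.continuousAt_rpow_const 1 m (Or.inl one_ne_zero)).tendsto).mul tendsto_id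
    · refine tendsto_const_nhds.add ((ENNReal.continuous_ofReal.tendsto _).comp ?_)
      exact (continuous_id.sub continuous_const).tendsto _
  simp only [Real.one_rpow, mul_one, ENNReal.ofReal_one, sub_self, ENNReal.ofReal_zero, add_zero, one_mul] at ht
  exact ge_of_tendsto ht (eventually_nhdsWithin_of_forall fun κ hκ => key R hR κ hκ)

end sph


theorem sphMeasure_restrict_eq (hn : 1 ≤ n) (D : HomDist n) (m : ℝ) (ν : Measure (Hpt n))
    [IsFiniteMeasure ν] (S : Set (Hpt n)) (hSm : MeasurableSet S) (hνS : ν Sᶜ = 0)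
    (H1 : ∀ x ∈ S, ∀ κ : ℝ, 1 < κ → ∃ δ > 0, ∀ r : ℝ, 0 < r → r < δ → ∀ y, D.d y x < r →
      ν {q | D.d y q < r} ≤ ENNReal.ofReal (κ * (2*r)^m))
    (H2 : ∀ x ∈ S, ∀ κ : ℝ, 1 < κ → ∀ δ > 0, ∃ r : ℝ, 0 < r ∧ r < δ ∧ ∃ y, D.d y x < r ∧
      ENNReal.ofReal ((2*r)^m) ≤ ENNReal.ofReal κ * ν {q | D.d y q < r}) :
    (sphMeasure D m).restrict S = ν := by
  ext A hA
  have hAS : MeasurableSet (A ∩ S) := hA.inter hSm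
  rw [Measure.restrict_apply hA, sphMeasure, toMeasure_apply _ _ hAS]
  have e : sphOuter D.d m = @outA (Hpt n) (D.metric hn) m := rfl
  rw [e]
  have h1 := @outA_lower (Hpt n) (D.metric hn) _ _ _ ν m S hνS H1 (A ∩ S)
  have h2 := @outA_upper (Hpt n) (D.metric hn) _ _ _ ν _ m S H1 H2 (A ∩ S) inter_subset_right
  rw [le_antisymm h2 h1]
  refine le_antisymm (measure_mono inter_subset_left) ?_
  refine (measure_le_inter_add_sdiff ν A S).trans ?_
  rw [measure_mono_null (fun x (hx : x ∈ A \ S) => hx.2) hνS, add_zero]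
end

section
/-! ## P3: strict Pansu differentiability -/

/-- horizontal basis vector -/
def bz (j : Fin (2*n)) : Hz n := hor (frameVec (hIdx j) 0)

/-- horizontal coordinates -/
def cz (u : Hz n) (j : Fin (2*n)) : ℝ :=
  if h : (j:ℕ) < n then u.1 ⟨j, h⟩ else u.2 ⟨(j:ℕ) - n, by omega⟩

lemma frame_line (p : Hpt n) (j : Fin (2*n)) (s : ℝ) :
    hmul p (emb (s • bz j) 0) = p + s • frameVec (hIdx j) p := by
  have hj : (hIdx j : ℕ) = (j : ℕ) := rfl
  unfold bz frameVec
  by_cases h : (j:ℕ) < n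
  · simp only [hj, h, dif_pos]
    simp only [hmul, emb, hor, Prod.smul_mk]
    refine Prod.ext ?_ (Prod.ext ?_ ?_)
    · simp
    · simp
    · simp [Pi.single_apply]
      ring
  · have h2 : (j:ℕ) < 2 * n := j.2
    simp only [hj, h, h2, dif_pos, dif_neg, not_false_iff]
    simp only [hmul, emb, hor, Prod.smul_mk]
    refine Prod.ext ?_ (Prod.ext ?_ ?_)
    · simp
    · simp
    · simp [Pi.single_apply]
      ring

lemma sum_fin_two_mul (g : Fin (2*n) → ℝ) :
    ∑ j, g j = ∑ j : Fin n, (g ⟨j, by omega⟩ + g ⟨n + j, by omega⟩) := by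
  have e : n + n = 2 * n := by ring
  rw [Finset.sum_add_distrib, ← (finCongr e).sum_comp, Fin.sum_univ_add]
  rfl

lemma bz_lt {j : Fin (2*n)} (h : (j:ℕ) < n) : bz j = (Pi.single ⟨j, h⟩ 1, 0) := by
  have hj : (hIdx j : ℕ) = (j : ℕ) := rfl
  unfold bz frameVec
  simp [hj, h, hor]
lemma bz_ge {j : Fin (2*n)} (h : ¬ (j:ℕ) < n) :
    bz j = (0, Pi.single ⟨(j:ℕ) - n, by omega⟩ 1) := by
  have hj : (hIdx j : ℕ) = (j : ℕ) := rfl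
  have h2 : (j:ℕ) < 2 * n := j.2
  unfold bz frameVec
  simp [hj, h, h2, hor]

lemma sum_cz_bz (u : Hz n) : ∑ j, cz u j • bz j = u := by
  have e : n + n = 2 * n := by ring
  rw [← (finCongr e).sum_comp, Fin.sum_univ_add]
  have h1 : ∀ i : Fin n, cz u ((finCongr e) (Fin.castAdd n i)) • bz ((finCongr e) (Fin.castAdd n i))
      = (Pi.single i (u.1 i), 0) := by
    intro i
    have h : ((finCongr e (Fin.castAdd n i) : Fin (2*n)) : ℕ) < n := i.2
    rw [bz_lt h, cz, dif_pos h]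
    simp [← Pi.single_smul]
  have h2 : ∀ i : Fin n, cz u ((finCongr e) (Fin.natAdd n i)) • bz ((finCongr e) (Fin.natAdd n i))
      = (0, Pi.single i (u.2 i)) := by
    intro i
    have h : ¬ ((finCongr e (Fin.natAdd n i) : Fin (2*n)) : ℕ) < n := by simp
    rw [bz_ge h, cz, dif_neg h]
    simp [← Pi.single_smul]
  simp only [h1, h2]
  refine Prod.ext ?_ ?_
  · simp [Prod.fst_sum, Finset.univ_sum_single]
  · simp [Prod.snd_sum, Finset.univ_sum_single]

lemma abs_cz_le (u : Hz n) (j : Fin (2*n)) : |cz u j| ≤ ‖u‖ := by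
  unfold cz; split_ifs
  · exact (norm_le_pi_norm u.1 _).trans (norm_fst_le u)
  · exact (norm_le_pi_norm u.2 _).trans (norm_snd_le u)

lemma norm_bz_le (j : Fin (2*n)) : ‖bz j‖ ≤ 1 := by
  by_cases h : (j:ℕ) < n
  · rw [bz_lt h]
    refine max_le ((pi_norm_le_iff_of_nonneg zero_le_one).2 fun i => ?_) (by simp)
    by_cases h : i = ⟨j, h⟩ <;> simp [Pi.single_apply, h]
  · rw [bz_ge h]
    refine max_le (by simp) ((pi_norm_le_iff_of_nonneg zero_le_one).2 fun i => ?_)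
    by_cases h : i = ⟨(j:ℕ) - n, by omega⟩ <;> simp [Pi.single_apply, h]

def czL (j : Fin (2*n)) : Hz n →L[ℝ] ℝ :=
  if h : (j:ℕ) < n then (ContinuousLinearMap.proj (R := ℝ) (φ := fun _ : Fin n => ℝ) ⟨j, h⟩).comp (ContinuousLinearMap.fst ℝ _ _)
  else (ContinuousLinearMap.proj (R := ℝ) (φ := fun _ : Fin n => ℝ) ⟨(j:ℕ) - n, by omega⟩).comp (ContinuousLinearMap.snd ℝ _ _)
lemma czL_apply (j : Fin (2*n)) (u : Hz n) : czL j u = cz u j := by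
  unfold czL cz; split_ifs <;> rfl

/-- horizontal differential -/
def dHL (f : Hpt n → ℝ) (p : Hpt n) : Hz n →L[ℝ] ℝ := ∑ j, gradH f p j • czL j

lemma cz_bz (i j : Fin (2*n)) : cz (bz i) j = if i = j then 1 else 0 := by
  unfold cz
  by_cases h : (i:ℕ) < n
  · rw [bz_lt h]
    split_ifs with h1 h2 h2
    · subst h2; simp
    · simp only
      rw [Pi.single_eq_of_ne]
      intro h3; apply h2; ext; simpa using (congrArg Fin.val h3).symm
    · subst h2; exact absurd h h1
    · simp
  · rw [bz_ge h]
    split_ifs with h1 h2 h2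
    · subst h2; exact absurd h1 h
    · simp
    · subst h2; simp
    · simp only
      rw [Pi.single_eq_of_ne]
      intro h3; apply h2; ext
      have := (congrArg Fin.val h3)
      simp only at this; omega

lemma dHL_apply (f : Hpt n → ℝ) (p : Hpt n) (u : Hz n) : dHL f p u = ∑ j, gradH f p j * cz u j := by
  simp [dHL, czL_apply]
lemma dHL_bz (f : Hpt n → ℝ) (p : Hpt n) (j : Fin (2*n)) : dHL f p (bz j) = gradH f p j := by
  simp [dHL_apply, cz_bz]

/-- derivative along a frame line -/
lemma hasDerivAt_frame {f : Hpt n → ℝ} {p : Hpt n} {j : Fin (2*n)} (s : ℝ)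
    (h : LineDifferentiableAt ℝ f (hmul p (emb (s • bz j) 0))
      (frameVec (hIdx j) (hmul p (emb (s • bz j) 0)))) :
    HasDerivAt (fun s => f (hmul p (emb (s • bz j) 0)))
      (gradH f (hmul p (emb (s • bz j) 0)) j) s := by
  have h1 := h.hasLineDerivAt
  unfold HasLineDerivAt at h1
  have h2 : ∀ s', f (hmul p (emb (s • bz j) 0) + s' • frameVec (hIdx j) (hmul p (emb (s • bz j) 0)))
      = f (hmul p (emb ((s + s') • bz j) 0)) := by
    intro s'
    rw [← frame_line, hmul_assoc]
    congr 2
    refine hpt_ext (by simp [add_smul]) ?_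
    simp [hmul_t, om_smul_left, om_smul_right, om_self]
  simp only [h2] at h1
  have h3 := HasDerivAt.scomp_of_eq s h1 ((hasDerivAt_id s).sub_const s) (by simp)
  simpa [Function.comp_def, gradH] using h3

/-- strict Pansu differentiability -/
def SPD {F : Type*} [NormedAddCommGroup F] [NormedSpace ℝ F] (D : HomDist n) (f : Hpt n → F)
    (L : Hz n →L[ℝ] F) (x0 : Hpt n) : Prop :=
  ∀ ε > 0, ∃ δ > 0, ∀ x y, D.d x0 x < δ → D.d x0 y < δ →
    ‖f y - f x - L (hor (hmul (hinv x) y))‖ ≤ ε * D.d x y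

theorem IsC1H.spd (hn : 1 ≤ n) (D : HomDist n) {U : Set (Hpt n)} (hU : IsOpen U) {f : Hpt n → ℝ}
    (hf : IsC1H U f) {x0 : Hpt n} (hx0 : x0 ∈ U) : SPD D f (dHL f x0) x0 := by
  obtain ⟨C, hC, hup⟩ := D.exists_upper hn
  obtain ⟨c, hc, hlow⟩ := D.exists_lower hn
  -- constants
  set A : ℝ := C * (2 * n) / c with hA
  have hA0 : 0 ≤ A := by positivity
  set M : ℝ := (2 * n + 4 * (1 + A)) / c with hM
  have hM0 : 0 < M := by positivity
  intro ε hε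
  have hε' : 0 < ε / M := by positivity
  obtain ⟨δ, hδ, hball⟩ : ∃ δ > 0, ∀ q, D.d x0 q < δ →
      q ∈ U ∧ ∀ j, |gradH f q j - gradH f x0 j| ≤ ε / M := by
    have h1 : ∀ᶠ q in 𝓝 x0, q ∈ U ∧ ∀ j, |gradH f q j - gradH f x0 j| ≤ ε / M := by
      refine (hU.eventually_mem hx0).and (eventually_all.2 fun j => ?_)
      have := (hf.contGrad j).continuousAt (hU.mem_nhds hx0)
      have := (Metric.continuousAt_iff'.1 this) _ hε'
      filter_upwards [this] with q hq
      rw [Real.dist_eq] at hq; exact hq.le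
    obtain ⟨δ, hδ, h⟩ := (D.nhds_basis hn x0).mem_iff.1 h1
    exact ⟨δ, hδ, fun q hq => h hq⟩
  let G : Hpt n → ℝ → Prop := fun q ℓ => 0 ≤ ℓ ∧ D.d 0 q ≤ C * ℓ ∧ ∀ x, D.d x0 x + C * ℓ < δ →
    |f (hmul x q) - f x - dHL f x0 (hor q)| ≤ ε / M * ℓ
  have Gmul : ∀ q1 q2 l1 l2, G q1 l1 → G q2 l2 → G (hmul q1 q2) (l1 + l2) := by
    rintro q1 q2 l1 l2 ⟨a1, b1, c1⟩ ⟨a2, b2, c2⟩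
    refine ⟨add_nonneg a1 a2, ?_, fun x hx => ?_⟩
    · have := D.triangle 0 q1 (hmul q1 q2)
      rw [D.d_mul_right] at this; linarith
    · have e1 := c1 x (by nlinarith)
      have e2 := c2 (hmul x q1) (by
        have := D.triangle x0 x (hmul x q1)
        rw [D.d_mul_right] at this; nlinarith)
      rw [hmul_assoc] at e2
      have : f (hmul x (hmul q1 q2)) - f x - dHL f x0 (hor (hmul q1 q2)) =
        (f (hmul x (hmul q1 q2)) - f (hmul x q1) - dHL f x0 (hor q2)) + (f (hmul x q1) - f x - dHL f x0 (hor q1)) := by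
        rw [hor_hmul, map_add]; ring
      rw [this]
      refine (abs_add_le _ _).trans ?_
      linarith
  have Gone : G 0 0 := ⟨le_rfl, by simp [D.self], fun x hx => by simp⟩
  have Gstep : ∀ j s, G (emb (s • bz j) 0) |s| := by
    intro j s
    have hd : ∀ s : ℝ, D.d 0 (emb (s • bz j) 0) ≤ C * |s| := by
      intro s
      refine (hup _).trans ?_
      rw [gN_emb_zero, norm_smul, Real.norm_eq_abs]
      have := norm_bz_le j
      have : |s| * ‖bz j‖ ≤ |s| * 1 := by gcongr
      nlinarith
    refine ⟨abs_nonneg _, hd s, fun x hx => ?_⟩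
    have hin : ∀ σ ∈ uIcc 0 s, D.d x0 (hmul x (emb (σ • bz j) 0)) < δ := by
      intro σ hσ
      have h1 : |σ| ≤ |s| := by
        have := abs_sub_left_of_mem_uIcc hσ
        simpa using this
      have := D.triangle x0 x (hmul x (emb (σ • bz j) 0))
      rw [D.d_mul_right] at this
      have := hd σ
      nlinarith
    let g : ℝ → ℝ := fun σ => f (hmul x (emb (σ • bz j) 0)) - σ * gradH f x0 j
    have hg : ∀ σ ∈ uIcc 0 s, HasDerivWithinAt g (gradH f (hmul x (emb (σ • bz j) 0)) j - gradH f x0 j) (uIcc 0 s) σ := by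
      intro σ hσ
      have h1 := hasDerivAt_frame σ (hf.ldiff _ (hball _ (hin σ hσ)).1 j)
      have h2 := h1.sub ((hasDerivAt_id σ).mul_const (gradH f x0 j))
      rw [one_mul] at h2
      exact h2.hasDerivWithinAt
    have := (convex_uIcc 0 s).norm_image_sub_le_of_norm_hasDerivWithin_le hg
      (fun σ hσ => (hball _ (hin σ hσ)).2 j) left_mem_uIcc right_mem_uIcc
    simp only [g, Real.norm_eq_abs] at this
    rw [hor_emb, map_smul, dHL_bz]
    simp only [zero_smul, emb_zero, hmul_zero, zero_mul, sub_zero] at this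
    refine le_trans (le_of_eq ?_) this
    congr 1
    simp only [smul_eq_mul]
    ring
  have Gfin : ∀ (u : Hz n) (s : Finset (Fin (2*n))), ∃ q, hor q = ∑ j ∈ s, cz u j • bz j ∧ ∃ l ≤ (s.card : ℝ) * ‖u‖, G q l := by
    intro u s
    classical
    induction s using Finset.induction_on with
    | empty => exact ⟨0, by simp, 0, by simp, Gone⟩
    | insert j s hj ih =>
      obtain ⟨q, hq, l, hl, hG⟩ := ih
      refine ⟨hmul (emb (cz u j • bz j) 0) q, ?_, |cz u j| + l, ?_, Gmul _ _ _ _ (Gstep j _) hG⟩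
      · rw [Finset.sum_insert hj, hor_hmul, hq, hor_emb]
      · rw [Finset.card_insert_of_notMem hj]
        push_cast
        have := abs_cz_le u j
        linarith
  have Gvert : ∀ τ : ℝ, G (emb 0 τ) (4 * √|τ|) := by
    intro τ
    let j1 : Fin (2*n) := ⟨0, by omega⟩
    let j2 : Fin (2*n) := ⟨n, by omega⟩
    obtain ⟨a, b, hab, ha, hb⟩ : ∃ a b : ℝ, a * b = τ ∧ |a| = √|τ| ∧ |b| = √|τ| := by
      rcases le_total 0 τ with h | h
      · exact ⟨√|τ|, √|τ|, by rw [Real.mul_self_sqrt (abs_nonneg _), abs_of_nonneg h],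
          abs_of_nonneg (Real.sqrt_nonneg _), abs_of_nonneg (Real.sqrt_nonneg _)⟩
      · exact ⟨√|τ|, -√|τ|, by rw [mul_neg, Real.mul_self_sqrt (abs_nonneg _), abs_of_nonpos h, neg_neg],
          abs_of_nonneg (Real.sqrt_nonneg _), by rw [abs_neg, abs_of_nonneg (Real.sqrt_nonneg _)]⟩
    have hom : om (bz j1) (bz j2) = 1 := by
      rw [bz_lt (show (j1 : ℕ) < n from hn), bz_ge (show ¬ (j2 : ℕ) < n by simp [j2])]
      simp [om, Pi.single_apply, j1, j2]
    have hG := Gmul _ _ _ _ (Gmul _ _ _ _ (Gstep j1 a) (Gstep j2 b)) (Gmul _ _ _ _ (Gstep j1 (-a)) (Gstep j2 (-b)))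
    have e : hmul (hmul (emb (a • bz j1) 0) (emb (b • bz j2) 0)) (hmul (emb ((-a) • bz j1) 0) (emb ((-b) • bz j2) 0)) = emb 0 τ := by
      refine hpt_ext ?_ ?_
      · simp only [hor_hmul, hor_emb, neg_smul]; abel
      · simp only [hmul_t, hor_hmul, hor_emb, emb_t, om_add_left, om_add_right, om_smul_left, om_smul_right, om_self,
          om_swap (bz j2) (bz j1), hom]
        rw [← hab]; ring
    rw [e] at hG
    have e2 : |a| + |b| + (|-a| + |-b|) = 4 * √|τ| := by rw [abs_neg, abs_neg, ha, hb]; ring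
    rwa [e2] at hG
  have Gall : ∀ q : Hpt n, ∃ l ≤ M * D.d 0 q, G q l := by
    intro q
    obtain ⟨q', hq', l, hl, hG⟩ := Gfin (hor q) Finset.univ
    rw [sum_cz_bz] at hq'
    have hcard : ((Finset.univ : Finset (Fin (2*n))).card : ℝ) = 2 * n := by simp
    rw [hcard] at hl
    have hq : q = hmul q' (emb 0 (q.2.2 - q'.2.2)) :=
      hpt_ext (by simp [hq']) (by simp [hmul_t])
    refine ⟨l + 4 * √|q.2.2 - q'.2.2|, ?_, ?_⟩
    · have hg : gN q ≤ D.d 0 q / c := by rw [le_div_iff₀ hc, mul_comm]; exact hlow q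
      have hgq' : gN q' ≤ A * gN q := by
        have h1 : c * gN q' ≤ C * l := (hlow q').trans hG.2.1
        have h2 : C * l ≤ C * (2 * n * gN q) := by
          gcongr
          refine hl.trans ?_
          gcongr
          exact hor_le_gN q
        rw [hA, div_mul_eq_mul_div, le_div_iff₀ hc]
        linarith
      have ht : √|q.2.2 - q'.2.2| ≤ (1 + A) * gN q := by
        rw [Real.sqrt_le_iff]
        have h0 := gN_nonneg q
        refine ⟨by positivity, ?_⟩
        have h1 := t_le_gN q
        have h2 := t_le_gN q'
        have h3 : gN q' ^ 2 ≤ (A * gN q)^2 := by gcongr; exact gN_nonneg _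
        have h4 := abs_sub q.2.2 q'.2.2
        nlinarith [mul_nonneg hA0 (sq_nonneg (gN q))]
      have hl' : l ≤ 2 * n * gN q := hl.trans (by gcongr; exact hor_le_gN q)
      calc l + 4 * √|q.2.2 - q'.2.2| ≤ (2 * n + 4 * (1 + A)) * gN q := by linarith
        _ ≤ (2 * n + 4 * (1 + A)) * (D.d 0 q / c) := by gcongr
        _ = _ := by rw [hM]; ring
    · have := Gmul _ _ _ _ hG (Gvert (q.2.2 - q'.2.2))
      rwa [← hq] at this
  refine ⟨δ / (1 + 2 * C * M), by positivity, fun x y hx hy => ?_⟩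
  obtain ⟨l, hl, hG⟩ := Gall (hmul (hinv x) y)
  rw [← D.eq_zero_inv] at hl
  have hdxy : D.d x y < 2 * (δ / (1 + 2 * C * M)) := by
    have := D.triangle x x0 y
    rw [D.symm x x0] at this; linarith
  have h1 := hG.2.2 x (by
    have e : δ = δ / (1 + 2 * C * M) + C * (M * (2 * (δ / (1 + 2 * C * M)))) := by
      field_simp
    have h2 : C * l ≤ C * (M * (2 * (δ / (1 + 2 * C * M)))) := by
      gcongr
      refine hl.trans (by gcongr)
    linarith)
  rw [hmul_hinv_cancel] at h1
  rw [Real.norm_eq_abs]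
  refine h1.trans ?_
  calc ε / M * l ≤ ε / M * (M * D.d x y) := by gcongr
    _ = ε * D.d x y := by field_simp
end

section
/-! ## P4: Graves lemma and kernels -/

lemma HomDist.hor_le (hn : 1 ≤ n) (D : HomDist n) : ∃ C : ℝ, 0 < C ∧ ∀ x y : Hpt n,
    ‖hor (hmul (hinv x) y)‖ ≤ C * D.d x y := by
  obtain ⟨c, hc, hlow⟩ := D.exists_lower hn
  refine ⟨c⁻¹, by positivity, fun x y => ?_⟩
  rw [D.eq_zero_inv, inv_mul_eq_div, le_div_iff₀ hc, mul_comm]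
  exact (mul_le_mul_of_nonneg_left (hor_le_gN _) hc.le).trans (hlow _)

lemma HomDist.isCompact_closedBall (hn : 1 ≤ n) (D : HomDist n) (x : Hpt n) (ρ : ℝ) :
    IsCompact {y | D.d x y ≤ ρ} := by
  obtain ⟨c, hc, hlow⟩ := D.exists_lower hn
  have h0 : IsCompact {q : Hpt n | D.d 0 q ≤ ρ} := by
    refine Metric.isCompact_of_isClosed_isBounded ?_ ?_
    · exact isClosed_le ((D.continuous_d hn).comp (continuous_const.prodMk continuous_id)) continuous_const
    · refine (Metric.isBounded_closedBall (x := (0 : Hpt n)) (r := max (ρ/c) ((ρ/c)^2))).subset fun q hq => ?_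
      have hq : D.d 0 q ≤ ρ := hq
      rw [mem_closedBall_zero_iff]
      have hg : gN q ≤ ρ / c := by rw [le_div_iff₀ hc, mul_comm]; exact (hlow q).trans hq
      have h1 : ‖hor q‖ ≤ ρ/c := (hor_le_gN q).trans hg
      have h2 : |q.2.2| ≤ (ρ/c)^2 := (t_le_gN q).trans (by gcongr; exact gN_nonneg q)
      exact max_le ((norm_fst_le (hor q)).trans (h1.trans (le_max_left _ _)))
        (max_le ((norm_snd_le (hor q)).trans (h1.trans (le_max_left _ _))) (h2.trans (le_max_right _ _)))
  have h1 := h0.image (f := fun q => hmul x q) (continuous_hmul.comp (continuous_const.prodMk continuous_id))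
  convert h1 using 1
  ext y
  constructor
  · intro hy
    have hy : D.d x y ≤ ρ := hy
    refine ⟨hmul (hinv x) y, ?_, by simp⟩
    show D.d 0 _ ≤ ρ
    rwa [← D.eq_zero_inv]
  · rintro ⟨q, hq, rfl⟩
    have hq : D.d 0 q ≤ ρ := hq
    show D.d x (hmul x q) ≤ ρ
    rwa [D.d_mul_right]

section spd
variable {F : Type*} [NormedAddCommGroup F] [NormedSpace ℝ F]

lemma SPD.lip (hn : 1 ≤ n) {D : HomDist n} {f : Hpt n → F} {L : Hz n →L[ℝ] F} {x0 : Hpt n}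
    (h : SPD D f L x0) : ∃ C > 0, ∃ δ > 0, ∀ x y, D.d x0 x < δ → D.d x0 y < δ → ‖f y - f x‖ ≤ C * D.d x y := by
  obtain ⟨C, hC, hh⟩ := D.hor_le hn
  obtain ⟨δ, hδ, h⟩ := h 1 one_pos
  refine ⟨1 + ‖L‖ * C, by positivity, δ, hδ, fun x y hx hy => ?_⟩
  have h1 := h x y hx hy
  have h2 : ‖L (hor (hmul (hinv x) y))‖ ≤ ‖L‖ * (C * D.d x y) :=
    (L.le_opNorm _).trans (mul_le_mul_of_nonneg_left (hh x y) (norm_nonneg _))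
  calc ‖f y - f x‖ = ‖(f y - f x - L (hor (hmul (hinv x) y))) + L (hor (hmul (hinv x) y))‖ := by
        congr 1; abel
    _ ≤ _ := norm_add_le _ _
    _ ≤ _ := by nlinarith

lemma continuousOn_of_lip (hn : 1 ≤ n) {D : HomDist n} {f : Hpt n → F} {C : ℝ} {s : Set (Hpt n)}
    (h : ∀ x ∈ s, ∀ y ∈ s, ‖f y - f x‖ ≤ C * D.d x y) : ContinuousOn f s := by
  intro x hx
  rw [ContinuousWithinAt, tendsto_iff_norm_sub_tendsto_zero]
  have h1 : Tendsto (fun y => C * D.d x y) (𝓝[s] x) (𝓝 0) := by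
    simpa using ((D.tendsto_of_gN hn x).const_mul C).mono_left nhdsWithin_le_nhds
  refine squeeze_zero' (Eventually.of_forall fun _ => norm_nonneg _) ?_ h1
  filter_upwards [self_mem_nhdsWithin] with y hy
  exact h x hx y hy

theorem SPD.graves (hn : 1 ≤ n) {D : HomDist n} {g : Hpt n → F} {L : Hz n →L[ℝ] F} {q : Hpt n}
    (h : SPD D g L q) (R : F →L[ℝ] Hz n) (hR : ∀ v, L (R v) = v) (hq : g q = 0) :
    ∃ C > 0, ∃ δ > 0, ∀ x, D.d q x < δ → ∃ x', g x' = 0 ∧ D.d x x' ≤ C * ‖g x‖ := by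
  obtain ⟨Cu, hCu, hup⟩ := D.exists_upper hn
  set M : ℝ := Cu * (‖R‖ + 1) with hM
  have hM0 : 0 < M := by positivity
  obtain ⟨δ1, hδ1, h1⟩ := h (1/(2*M)) (by positivity)
  obtain ⟨C2, hC2, δ2, hδ2, h2⟩ := h.lip hn
  set δ0 := min δ1 δ2 with hδ0
  have hδ0p : 0 < δ0 := lt_min hδ1 hδ2
  set ρ := δ0 / 4 with hρ
  have hstep : ∀ v : F, D.d 0 (emb (-(R v)) 0) ≤ M * ‖v‖ := by
    intro v
    refine (hup _).trans ?_
    rw [gN_emb_zero, norm_neg, hM, mul_assoc]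
    gcongr
    refine (R.le_opNorm v).trans ?_
    gcongr; linarith
  -- constants for the minimisation
  set c : ℝ := 1 / (4 * M) with hc
  have hc0 : 0 < c := by positivity
  refine ⟨4 * M, by positivity, min ρ (ρ / ((5 * M + 1) * (C2 + 1))), by positivity, fun x hx => ?_⟩
  have hxρ : D.d q x < ρ := hx.trans_le (min_le_left _ _)
  have hxρ' : D.d q x < ρ / ((5 * M + 1) * (C2 + 1)) := hx.trans_le (min_le_right _ _)
  have hgx : ‖g x‖ * (5 * M) ≤ ρ := by
    have e1 := h2 q x (by rw [D.self]; exact hδ2) (by have := min_le_right δ1 δ2; linarith)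
    rw [hq, sub_zero] at e1
    rw [lt_div_iff₀ (by positivity)] at hxρ'
    have hd := D.nonneg q x
    calc ‖g x‖ * (5 * M) ≤ (C2 * D.d q x) * (5 * M) := by gcongr
      _ ≤ D.d q x * ((5 * M + 1) * (C2 + 1)) := by nlinarith [mul_nonneg hd hM0.le, mul_nonneg hd hC2.le]
      _ ≤ ρ := hxρ'.le
  set Kc := {y | D.d x y ≤ ρ} with hKc
  have hKball : ∀ y ∈ Kc, D.d q y < δ0 := by
    intro y hy
    have hy : D.d x y ≤ ρ := hy
    have := D.triangle q x y
    linarith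
  have hgc : ContinuousOn g Kc := by
    refine continuousOn_of_lip hn (D := D) (C := C2) fun a ha b hb => h2 a b ?_ ?_
    · exact (hKball a ha).trans_le (min_le_right _ _)
    · exact (hKball b hb).trans_le (min_le_right _ _)
  have hρ0 : 0 < ρ := by positivity
  have hxK : x ∈ Kc := by show D.d x x ≤ ρ; rw [D.self]; exact hρ0.le
  obtain ⟨z, hz, hmin⟩ := (D.isCompact_closedBall hn x ρ).exists_isMinOn ⟨x, hxK⟩
    (f := fun y => ‖g y‖ + c * D.d x y) (by
      refine hgc.norm.add (continuousOn_const.mul ?_)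
      exact ((D.continuous_d hn).comp (continuous_const.prodMk continuous_id)).continuousOn)
  have hmx : ‖g z‖ + c * D.d x z ≤ ‖g x‖ := by
    have := hmin hxK
    simpa [D.self] using this
  have hdz : D.d x z ≤ 4 * M * ‖g x‖ := by
    have e1 : c * D.d x z ≤ ‖g x‖ := by linarith [norm_nonneg (g z)]
    rw [hc, one_div, inv_mul_eq_div, div_le_iff₀ (by positivity)] at e1
    linarith
  have hgz : ‖g z‖ ≤ ‖g x‖ := by
    have := mul_nonneg hc0.le (D.nonneg x z); linarith
  refine ⟨z, ?_, hdz⟩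
  by_contra hne
  have hnep : 0 < ‖g z‖ := norm_pos_iff.2 hne
  set z' := hmul z (emb (-(R (g z))) 0) with hz'
  have hdzz : D.d z z' ≤ M * ‖g z‖ := by rw [hz', D.d_mul_right]; exact hstep _
  have hz'K : z' ∈ Kc := by
    show D.d x z' ≤ ρ
    have := D.triangle x z z'
    nlinarith
  have e := h1 z z' ((hKball z hz).trans_le (min_le_left _ _)) ((hKball z' hz'K).trans_le (min_le_left _ _))
  rw [hz', hinv_hmul_cancel, hor_emb, map_neg, hR, ← hz'] at e
  have e2 : ‖g z'‖ ≤ ‖g z‖ / 2 := by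
    have : g z' - g z - -g z = g z' := by abel
    rw [this] at e
    refine e.trans ?_
    calc 1/(2*M) * D.d z z' ≤ 1/(2*M) * (M * ‖g z‖) := by gcongr
      _ = ‖g z‖ / 2 := by field_simp
  have e3 : ‖g z‖ + c * D.d x z ≤ ‖g z'‖ + c * D.d x z' := hmin hz'K
  have e4 := D.triangle x z z'
  have e5 : c * D.d x z' ≤ c * (D.d x z + M * ‖g z‖) := by gcongr; linarith
  have e6 : c * (M * ‖g z‖) = ‖g z‖ / 4 := by rw [hc]; field_simp
  nlinarith

lemma exists_right_inverse [FiniteDimensional ℝ F] (L : Hz n →L[ℝ] F) (hL : Function.Surjective L) :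
    ∃ R : F →L[ℝ] Hz n, ∀ v, L (R v) = v := by
  obtain ⟨R, hR⟩ := (L : Hz n →ₗ[ℝ] F).exists_rightInverse_of_surjective (LinearMap.range_eq_top.2 hL)
  exact ⟨LinearMap.toContinuousLinearMap R, fun v => LinearMap.congr_fun hR v⟩

/-- if the zero set of `g` is contained in that of `f`, kernels are nested -/
theorem SPD.ker_le [FiniteDimensional ℝ F] {F' : Type*} [NormedAddCommGroup F'] [NormedSpace ℝ F'] (hn : 1 ≤ n) {D : HomDist n}
    {g : Hpt n → F} {L : Hz n →L[ℝ] F} {f : Hpt n → F'} {L' : Hz n →L[ℝ] F'} {q : Hpt n}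
    (hg : SPD D g L q) (hf : SPD D f L' q) (hL : Function.Surjective L) (hq : g q = 0)
    (hsub : ∀ᶠ x in 𝓝 q, g x = 0 → f x = 0) (v : Hz n) (hv : L v = 0) : L' v = 0 := by
  obtain ⟨R, hR⟩ := exists_right_inverse L hL
  obtain ⟨C, hC, δ, hδ, hgr⟩ := hg.graves hn R hR hq
  obtain ⟨Cu, hCu, hup⟩ := D.exists_upper hn
  obtain ⟨Ch, hCh, hhor⟩ := D.hor_le hn
  obtain ⟨δ3, hδ3, hs⟩ := (D.nhds_basis hn q).mem_iff.1 hsub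
  have hs : ∀ x, D.d q x < δ3 → g x = 0 → f x = 0 := fun x hx => hs hx
  have hfq : f q = 0 := hs q (by rw [D.self]; exact hδ3) hq
  set N := Cu * (‖v‖ + 1) with hN
  have hN0 : 0 < N := by positivity
  -- claim: norm bounded by arbitrarily small
  have key : ∀ ε : ℝ, 0 < ε → ε ≤ 1 → ‖L' v‖ ≤ ε * (N * (1 + C) + ‖L'‖ * Ch * (C * N)) := by
    intro ε hε hε1
    obtain ⟨δ1, hδ1, h1⟩ := hg ε hε
    obtain ⟨δ2, hδ2, h2⟩ := hf ε hε
    set m0 := min (min δ δ1) (min δ2 δ3) with hm0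
    have hm0p : 0 < m0 := by positivity
    set l := m0 / (2 * N * (1 + C)) with hl
    have hl0 : 0 < l := by positivity
    set x := hmul q (emb (l • v) 0) with hx
    have hdx : D.d q x ≤ N * l := by
      rw [hx, D.d_mul_right]
      refine (hup _).trans ?_
      rw [gN_emb_zero, norm_smul, Real.norm_of_nonneg hl0.le, hN]
      nlinarith [mul_pos hCu hl0]
    have hlm : N * l * (1 + C) = m0 / 2 := by rw [hl]; field_simp
    have hdx' : D.d q x < m0 := by
      have : N * l ≤ N * l * (1 + C) := by nlinarith [mul_pos hN0 hl0]
      linarith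
    have hm1 : m0 ≤ δ := (min_le_left _ _).trans (min_le_left _ _)
    have hm2 : m0 ≤ δ1 := (min_le_left _ _).trans (min_le_right _ _)
    have hm3 : m0 ≤ δ2 := (min_le_right _ _).trans (min_le_left _ _)
    have hm4 : m0 ≤ δ3 := (min_le_right _ _).trans (min_le_right _ _)
    have e1 := h1 q x (by rw [D.self]; exact hδ1) (by linarith)
    rw [hq, sub_zero, hx, hinv_hmul_cancel, hor_emb, map_smul, hv, smul_zero, sub_zero, ← hx] at e1
    obtain ⟨x', hx'0, hx'd⟩ := hgr x (by linarith)
    have e2 : D.d x x' ≤ C * (ε * (N * l)) := hx'd.trans (by gcongr; exact e1.trans (by gcongr))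
    have e2' : D.d x x' ≤ C * (N * l) := e2.trans (by
      refine mul_le_mul_of_nonneg_left ?_ hC.le
      nlinarith [mul_pos hN0 hl0])
    have e3 : D.d q x' ≤ N * l * (1 + C) := by
      have := D.triangle q x x'
      nlinarith
    have hfx' : f x' = 0 := hs x' (by linarith) hx'0
    have e4 := h2 q x' (by rw [D.self]; exact hδ2) (by linarith)
    rw [hfx', hfq, sub_zero, zero_sub, norm_neg] at e4
    have e5 : hor (hmul (hinv q) x') = l • v + hor (hmul (hinv x) x') := by
      simp only [hor_hmul, hor_hinv, hx, hor_emb]; abel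
    rw [e5, map_add, map_smul] at e4
    have e6 : ‖L' (hor (hmul (hinv x) x'))‖ ≤ ‖L'‖ * (Ch * (C * (ε * (N * l)))) := by
      refine (L'.le_opNorm _).trans ?_
      gcongr
      exact (hhor _ _).trans (by gcongr)
    have e7 : ‖l • L' v‖ ≤ ε * (N * l * (1 + C)) + ‖L'‖ * (Ch * (C * (ε * (N * l)))) := by
      have : l • L' v = (l • L' v + L' (hor (hmul (hinv x) x'))) - L' (hor (hmul (hinv x) x')) := by abel
      rw [this]
      refine (norm_sub_le _ _).trans (add_le_add (e4.trans (by gcongr)) e6)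
    rw [norm_smul, Real.norm_of_nonneg hl0.le] at e7
    have e8 : l * ‖L' v‖ ≤ l * (ε * (N * (1 + C) + ‖L'‖ * Ch * (C * N))) := e7.trans (le_of_eq (by ring))
    exact le_of_mul_le_mul_left e8 hl0
  set B := N * (1 + C) + ‖L'‖ * Ch * (C * N)
  have hB : 0 < B := by positivity
  by_contra hne
  have hp : 0 < ‖L' v‖ := norm_pos_iff.2 hne
  have := key (min 1 (‖L' v‖ / (2 * B))) (by positivity) (min_le_left _ _)
  have h2 : min 1 (‖L' v‖ / (2 * B)) * B ≤ ‖L' v‖ / (2 * B) * B := by gcongr; exact min_le_right _ _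
  have h3 : ‖L' v‖ / (2 * B) * B = ‖L' v‖ / 2 := by field_simp
  linarith
end spd

/-! vector valued differential -/
def dHv (f : Fin n → Hpt n → ℝ) (x : Hpt n) : Hz n →L[ℝ] (Fin n → ℝ) :=
  ContinuousLinearMap.pi fun i => dHL (f i) x

lemma spd_pi (hn : 1 ≤ n) (D : HomDist n) {U : Set (Hpt n)} (hU : IsOpen U) {f : Fin n → Hpt n → ℝ}
    (hf : ∀ i, IsC1H U (f i)) {x0 : Hpt n} (hx0 : x0 ∈ U) :
    SPD D (fun x i => f i x) (dHv f x0) x0 := by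
  intro ε hε
  have h := fun i => (hf i).spd hn D hU hx0 ε hε
  choose δ hδ h using h
  have hne : (Finset.univ : Finset (Fin n)).Nonempty := ⟨⟨0, by omega⟩, Finset.mem_univ _⟩
  refine ⟨Finset.univ.inf' hne δ, (Finset.lt_inf'_iff _).2 fun i _ => hδ i, fun x y hx hy => ?_⟩
  rw [pi_norm_le_iff_of_nonneg (mul_nonneg hε.le (D.nonneg _ _))]
  intro i
  rw [Finset.lt_inf'_iff] at hx hy
  exact h i x y (hx i (Finset.mem_univ _)) (hy i (Finset.mem_univ _))

lemma continuousOn_dHL {U : Set (Hpt n)} {f : Hpt n → ℝ} (hf : IsC1H U f) :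
    ContinuousOn (fun x => dHL f x) U := by
  unfold dHL
  exact continuousOn_finsetSum _ fun j _ => (hf.contGrad j).smul continuousOn_const

lemma dHv_eq_sum (f : Fin n → Hpt n → ℝ) (x : Hpt n) :
    dHv f x = ∑ i, (ContinuousLinearMap.single ℝ (fun _ : Fin n => ℝ) i).comp (dHL (f i) x) := by
  refine ContinuousLinearMap.ext fun u => funext fun j => ?_
  simp [dHv, Pi.single_apply]

lemma continuousOn_dHv {U : Set (Hpt n)} {f : Fin n → Hpt n → ℝ} (hf : ∀ i, IsC1H U (f i)) :
    ContinuousOn (fun x => dHv f x) U := by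
  simp only [dHv_eq_sum]
  exact continuousOn_finsetSum _ fun i _ => continuousOn_const.clm_comp (continuousOn_dHL (hf i))

lemma dHv_bz (f : Fin n → Hpt n → ℝ) (x : Hpt n) (j : Fin (2*n)) (i : Fin n) :
    dHv f x (bz j) i = gradH (f i) x j := dHL_bz _ _ _

lemma dHv_surjective_iff {f : Fin n → Hpt n → ℝ} {x : Hpt n} :
    Function.Surjective (dHv f x) ↔ LinearIndependent ℝ (fun i => gradH (f i) x) := by
  have e : (dHv f x : Hz n → (Fin n → ℝ)) = fun u => (Matrix.of fun i => gradH (f i) x).mulVec (cz u) := by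
    ext u i
    show dHL (f i) x u = _
    rw [dHL_apply]; rfl
  have hcz : Function.Surjective (cz : Hz n → (Fin (2*n) → ℝ)) := by
    intro c
    refine ⟨∑ j, c j • bz j, ?_⟩
    ext k
    rw [← czL_apply, map_sum]
    simp [czL_apply, cz_bz]
  have h1 : Function.Surjective (dHv f x) ↔ Function.Surjective (Matrix.of fun i => gradH (f i) x).mulVec := by
    rw [e]
    constructor
    · intro h y
      obtain ⟨u, hu⟩ := h y
      exact ⟨cz u, hu⟩
    · intro h; exact h.comp hcz
  rw [h1]
  set A := (Matrix.of fun i => gradH (f i) x) with hA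
  constructor
  · intro h
    rw [Fintype.linearIndependent_iff]
    intro c hc
    obtain ⟨v, hv⟩ := h c
    have h3 : c ⬝ᵥ A.mulVec v = 0 := by
      rw [Matrix.dotProduct_mulVec]
      have : Matrix.vecMul c A = 0 := by
        rw [← hc]; ext j
        simp [Matrix.vecMul, dotProduct, hA, Finset.sum_apply]
      rw [this, zero_dotProduct]
    rw [hv] at h3
    have := dotProduct_self_eq_zero.1 h3
    intro i; rw [this]; rfl
  · intro h
    have h3 : A.rank = Fintype.card (Fin n) := LinearIndependent.rank_matrix (M := A) h
    have h4 : A.mulVecLin.range = ⊤ := by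
      apply Submodule.eq_top_of_finrank_eq
      rw [← Matrix.rank, h3]; simp
    exact LinearMap.range_eq_top.1 h4
end

section
/-- Isotropic injective linear map inside the kernel, from Pansu differentiability. -/
theorem exists_isotropic (hn : 1 ≤ n) (D : HomDist n) {k : ℕ} {M : Set (Hpt n)} (hM : IsC1HDim k M)
    {p : Hpt n} (hp : p ∈ M) {F : Hpt n → (Fin n → ℝ)} {L : Hz n →L[ℝ] (Fin n → ℝ)}
    (hF : SPD D F L p) {U : Set (Hpt n)} (hU : U ∈ 𝓝 p) (hz : ∀ q ∈ M ∩ U, F q = 0) :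
    ∃ l : (Fin k → ℝ) →ₗ[ℝ] Hz n, Function.Injective l ∧ (∀ a b, om (l a) (l b) = 0) ∧
      ∀ b, L (l b) = 0 := by
  obtain ⟨U1, hU1, hpU1, V, hV, f, Df, hinj, hmaps, hD, -, hSU⟩ := hM p hp
  have hpf : p ∈ f '' V := by rw [← hSU]; exact ⟨hp, hpU1⟩
  obtain ⟨a0, ha0, rfl⟩ := hpf
  obtain ⟨⟨hom, htl⟩, hDinj⟩ := hD a0 ha0
  set P := Df a0 with hP
  have hpt : ∀ b, Tendsto (fun l : ℝ => hdil l⁻¹ (hmul (hinv (f a0)) (f (a0 + l • b)))) (𝓝[>] 0)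
      (𝓝 (P b)) := fun b =>
    (tendstoLocallyUniformlyOn_univ.2 htl).tendsto_at (mem_univ b)
  have hhom : ∀ μ : ℝ, 0 < μ → ∀ b, P (μ • b) = hdil μ (P b) := by
    intro μ hμ b
    have h1 : Tendsto (fun l : ℝ => μ * l) (𝓝[>] 0) (𝓝[>] 0) := by
      refine tendsto_nhdsWithin_iff.2 ⟨?_, ?_⟩
      · have : Tendsto (fun l : ℝ => μ * l) (𝓝 0) (𝓝 (μ * 0)) := (continuous_const.mul continuous_id).tendsto 0
        rw [mul_zero] at this
        exact this.mono_left nhdsWithin_le_nhds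
      · filter_upwards [self_mem_nhdsWithin] with l hl
        exact mul_pos hμ hl
    have h2 := ((continuous_hdil μ).tendsto _).comp ((hpt b).comp h1)
    refine tendsto_nhds_unique (hpt (μ • b)) (h2.congr' ?_)
    filter_upwards [self_mem_nhdsWithin] with l hl
    have hl' : (0:ℝ) < l := hl
    simp only [Function.comp]
    rw [hdil_hdil, smul_smul, mul_comm l μ]
    congr 1
    field_simp
  have htz : ∀ b, (P b).2.2 = 0 := by
    intro b
    have h1 : P ((2:ℝ) • b) = hmul (P b) (P b) := by rw [two_smul]; exact hom b b
    rw [hhom 2 two_pos b] at h1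
    have h2 := congrArg (fun q : Hpt n => q.2.2) h1
    simp only [hmul_t, om_self] at h2
    simp only [hdil] at h2
    linarith
  have hadd : ∀ a b, hor (P (a + b)) = hor (P a) + hor (P b) := by
    intro a b; rw [hom, hor_hmul]
  have h0 : hor (P 0) = 0 := by have := hadd 0 0; simpa using this
  have hneg : ∀ a, hor (P (-a)) = - hor (P a) := by
    intro a; have := hadd a (-a); rw [add_neg_cancel, h0] at this
    exact (neg_eq_of_add_eq_zero_right this.symm).symm
  have hsm : ∀ (c : ℝ) (a), hor (P (c • a)) = c • hor (P a) := by
    intro c a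
    have hpos : ∀ c : ℝ, 0 < c → hor (P (c • a)) = c • hor (P a) := by
      intro c hc; rw [hhom c hc]; rfl
    rcases lt_trichotomy c 0 with h | h | h
    · have h1 := hpos (-c) (by linarith)
      rw [neg_smul, hneg, neg_smul] at h1
      exact neg_injective h1
    · subst h; simp [h0]
    · exact hpos c h
  refine ⟨{ toFun := fun b => hor (P b), map_add' := hadd, map_smul' := hsm }, ?_, ?_, ?_⟩
  · intro a b hab
    exact hDinj (hpt_ext hab (by rw [htz, htz]))
  · intro a b
    have h1 := congrArg (fun q : Hpt n => q.2.2) (hom a b)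
    simp only [hmul_t, htz] at h1
    show om (hor (P a)) (hor (P b)) = 0
    linarith
  · intro b
    show L (hor (P b)) = 0
    have hdt : Tendsto (fun l : ℝ => D.d 0 (hdil l⁻¹ (hmul (hinv (f a0)) (f (a0 + l • b))))) (𝓝[>] 0)
        (𝓝 (D.d 0 (P b))) := by
      have hc : Continuous fun q => D.d 0 q := (D.continuous_d hn).comp (continuous_const.prodMk continuous_id)
      exact (hc.tendsto _).comp (hpt b)
    have hLt : Tendsto (fun l : ℝ => ‖L (hor (hdil l⁻¹ (hmul (hinv (f a0)) (f (a0 + l • b)))))‖) (𝓝[>] 0)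
        (𝓝 ‖L (hor (P b))‖) := by
      have hc : Continuous fun q : Hpt n => ‖L (hor q)‖ := (L.continuous.comp continuous_hor).norm
      exact (hc.tendsto _).comp (hpt b)
    have hl0 : Tendsto (fun l : ℝ => l) (𝓝[>] 0) (𝓝 0) := tendsto_id.mono_left nhdsWithin_le_nhds
    have hdd : ∀ l : ℝ, 0 < l → D.d (f a0) (f (a0 + l • b)) =
        l * D.d 0 (hdil l⁻¹ (hmul (hinv (f a0)) (f (a0 + l • b)))) := by
      intro l hl
      rw [D.d_dil (inv_pos.2 hl), D.eq_zero_inv]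
      field_simp
    have hd0 : Tendsto (fun l : ℝ => D.d (f a0) (f (a0 + l • b))) (𝓝[>] 0) (𝓝 0) := by
      have := hl0.mul hdt
      rw [zero_mul] at this
      refine this.congr' ?_
      filter_upwards [self_mem_nhdsWithin] with l hl
      exact (hdd l hl).symm
    have hV' : ∀ᶠ l : ℝ in 𝓝[>] 0, a0 + l • b ∈ V := by
      have : Tendsto (fun l : ℝ => a0 + l • b) (𝓝 0) (𝓝 (a0 + (0:ℝ) • b)) := by
        exact (Continuous.tendsto (by fun_prop) 0)
      rw [zero_smul, add_zero] at this
      exact (this.mono_left nhdsWithin_le_nhds) (hV.mem_nhds ha0)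
    have hU' : ∀ᶠ l : ℝ in 𝓝[>] 0, f (a0 + l • b) ∈ U := by
      obtain ⟨ε, hε, hεU⟩ := (D.nhds_basis hn (f a0)).mem_iff.1 hU
      filter_upwards [hd0.eventually (gt_mem_nhds hε)] with l hl
      exact hεU hl
    have key : ∀ ε : ℝ, 0 < ε → ‖L (hor (P b))‖ ≤ ε * D.d 0 (P b) := by
      intro ε hε
      obtain ⟨δ, hδ, H⟩ := hF ε hε
      refine le_of_tendsto_of_tendsto hLt (hdt.const_mul ε) ?_
      filter_upwards [self_mem_nhdsWithin, hV', hU', hd0.eventually (gt_mem_nhds hδ)] with l hl h1 h2 h3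
      have hl' : (0:ℝ) < l := hl
      have hmem : f (a0 + l • b) ∈ M := by
        have : f (a0 + l • b) ∈ M ∩ U1 := by rw [hSU]; exact ⟨_, h1, rfl⟩
        exact this.1
      have h4 := H (f a0) (f (a0 + l • b)) (by rw [D.self]; exact hδ) h3
      rw [hz _ ⟨hmem, h2⟩, hz _ ⟨hp, mem_of_mem_nhds hU⟩, hdd l hl'] at h4
      have h5 : hor (hdil l⁻¹ (hmul (hinv (f a0)) (f (a0 + l • b)))) =
          l⁻¹ • hor (hmul (hinv (f a0)) (f (a0 + l • b))) := rfl
      rw [h5, map_smul, norm_smul, Real.norm_of_nonneg (inv_nonneg.2 hl'.le)]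
      simp only [sub_zero, zero_sub, norm_neg] at h4
      rw [inv_mul_le_iff₀ hl']
      calc _ ≤ _ := h4
        _ = _ := by ring
    have := ge_of_tendsto (f := fun ε : ℝ => ε * D.d 0 (P b)) (x := 𝓝[>] 0) (a := 0 * D.d 0 (P b)) (b := ‖L (hor (P b))‖)
      (hl0.mul_const _) (by filter_upwards [self_mem_nhdsWithin] with ε hε using key ε hε)
    rw [zero_mul] at this
    exact norm_le_zero_iff.1 this

/-- `J`. -/
def Jz (u : Hz n) : Hz n := (u.2, -u.1)

lemma om_Jz_self {u : Hz n} (h : om (Jz u) u = 0) : u = 0 := by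
  have h1 : (∑ j, (u.2 j * u.2 j)) + ∑ j, (u.1 j * u.1 j) = 0 := by
    have : om (Jz u) u = (∑ j, (u.2 j * u.2 j)) + ∑ j, (u.1 j * u.1 j) := by
      simp [om, Jz, Finset.sum_neg_distrib]
    rw [← this, h]
  have e1 : 0 ≤ ∑ j, (u.2 j * u.2 j) := Finset.sum_nonneg fun j _ => mul_self_nonneg _
  have e2 : 0 ≤ ∑ j, (u.1 j * u.1 j) := Finset.sum_nonneg fun j _ => mul_self_nonneg _
  have f1 : ∑ j, (u.2 j * u.2 j) = 0 := by linarith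
  have f2 : ∑ j, (u.1 j * u.1 j) = 0 := by linarith
  rw [Finset.sum_eq_zero_iff_of_nonneg fun j _ => mul_self_nonneg _] at f1 f2
  ext j
  · simpa using f2 j (Finset.mem_univ _)
  · simpa using f1 j (Finset.mem_univ _)

lemma om_Jz_Jz (u v : Hz n) : om (Jz u) (Jz v) = om u v := by
  simp only [om, Jz, Pi.neg_apply, mul_neg, Finset.sum_neg_distrib]
  rw [sub_neg_eq_add]
  have h1 : ∑ j, u.2 j * v.1 j = ∑ j, v.1 j * u.2 j := Finset.sum_congr rfl fun j _ => mul_comm _ _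
  have h2 : ∑ j, v.2 j * u.1 j = ∑ j, u.1 j * v.2 j := Finset.sum_congr rfl fun j _ => mul_comm _ _
  rw [h1, h2]; ring

/-- `om` as bilinear map. -/
def omB : Hz n →ₗ[ℝ] Hz n →ₗ[ℝ] ℝ :=
  LinearMap.mk₂ ℝ om om_add_left (fun c u v => om_smul_left c u v) om_add_right (fun c u v => om_smul_right c u v)

def JzL : Hz n →ₗ[ℝ] Hz n where
  toFun := Jz
  map_add' u v := by simp only [Jz]; ext <;> simp [add_comm]
  map_smul' c u := by simp only [Jz]; ext <;> simp

theorem exists_frame (l : (Fin n → ℝ) →ₗ[ℝ] Hz n) (hl : Function.Injective l)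
    (hiso : ∀ a b, om (l a) (l b) = 0) :
    ∃ E : Hz n ≃L[ℝ] Hz n, (∀ x y, om (E x) (E y) = om x y) ∧ ∀ b, E (0, b) = l b := by
  let Gl : (Fin n → ℝ) →ₗ[ℝ] (Fin n → ℝ) :=
    LinearMap.pi fun i => (omB.flip (l (Pi.single i 1))) ∘ₗ JzL ∘ₗ l
  have hGl : ∀ c b, om (Jz (l c)) (l b) = ∑ i, Gl c i * b i := by
    intro c b
    have hb : b = ∑ i, b i • (Pi.single i (1:ℝ) : Fin n → ℝ) := by
      ext j; simp [Finset.sum_apply, Pi.single_apply]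
    have h1 : om (Jz (l c)) (l b) = omB (Jz (l c)) (l b) := rfl
    rw [h1]
    conv_lhs => rw [hb]
    rw [map_sum, map_sum]
    refine Finset.sum_congr rfl fun i _ => ?_
    rw [map_smul, map_smul, smul_eq_mul, mul_comm]; rfl
  have hGi : Function.Injective Gl := by
    rw [← LinearMap.ker_eq_bot, LinearMap.ker_eq_bot']
    intro c hc
    have := hGl c c
    rw [hc] at this
    simp only [Pi.zero_apply, zero_mul, Finset.sum_const_zero] at this
    exact hl (by rw [om_Jz_self this, map_zero])
  let Ge := LinearEquiv.ofInjectiveEndo Gl hGi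
  have hGe : ∀ a, Gl (Ge.symm a) = a := fun a => Ge.apply_symm_apply a
  let Vm : (Fin n → ℝ) →ₗ[ℝ] Hz n := JzL ∘ₗ l ∘ₗ Ge.symm.toLinearMap
  have hVl : ∀ a b, om (Vm a) (l b) = ∑ i, a i * b i := by
    intro a b
    have := hGl (Ge.symm a) b
    rw [hGe] at this; exact this
  have hVV : ∀ a b, om (Vm a) (Vm b) = 0 := by
    intro a b
    show om (Jz _) (Jz _) = 0
    rw [om_Jz_Jz]; exact hiso _ _
  let E0 : Hz n →ₗ[ℝ] Hz n := Vm ∘ₗ LinearMap.fst ℝ _ _ + l ∘ₗ LinearMap.snd ℝ _ _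
  have hE0 : ∀ x, E0 x = Vm x.1 + l x.2 := fun x => rfl
  have hs : ∀ x y, om (E0 x) (E0 y) = om x y := by
    intro x y
    rw [hE0, hE0, om_add_left, om_add_right, om_add_right, hVV, hiso, hVl, om_swap (l x.2), hVl]
    simp only [om]; ring
  have hEi : Function.Injective E0 := by
    rw [← LinearMap.ker_eq_bot, LinearMap.ker_eq_bot']
    intro x hx
    have h1 := hs (Jz x) x
    rw [hx] at h1
    have h2 : om (E0 (Jz x)) 0 = 0 := by simp [om]
    rw [h2] at h1
    exact om_Jz_self h1.symm
  refine ⟨(LinearEquiv.ofInjectiveEndo E0 hEi).toContinuousLinearEquiv, hs, fun b => ?_⟩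
  show E0 (0, b) = l b
  rw [hE0]; simp
end

section
abbrev Ww (n : ℕ) : Type := (Fin n → ℝ) × ℝ

def dt (a b : Fin n → ℝ) : ℝ := ∑ i, a i * b i

lemma dt_add_left (a b c : Fin n → ℝ) : dt (a + b) c = dt a c + dt b c := by
  simp [dt, add_mul, Finset.sum_add_distrib]
lemma dt_add_right (a b c : Fin n → ℝ) : dt a (b + c) = dt a b + dt a c := by
  simp [dt, mul_add, Finset.sum_add_distrib]
lemma dt_smul_left (l : ℝ) (a b : Fin n → ℝ) : dt (l • a) b = l * dt a b := by
  simp [dt, Finset.mul_sum, mul_assoc]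
lemma dt_smul_right (l : ℝ) (a b : Fin n → ℝ) : dt a (l • b) = l * dt a b := by
  simp [dt, Finset.mul_sum, mul_left_comm]
lemma dt_sub_left (a b c : Fin n → ℝ) : dt (a - b) c = dt a c - dt b c := by
  simp [dt, sub_mul, Finset.sum_sub_distrib]
lemma dt_sub_right (a b c : Fin n → ℝ) : dt a (b - c) = dt a b - dt a c := by
  simp [dt, mul_sub, Finset.sum_sub_distrib]
lemma om_pair (a b a' b' : Fin n → ℝ) : om (a, b) (a', b') = dt a b' - dt a' b := rfl
lemma continuous_dt : Continuous (fun x : (Fin n → ℝ) × (Fin n → ℝ) => dt x.1 x.2) := by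
  unfold dt; fun_prop
lemma contDiff_dt {k : WithTop ℕ∞} : ContDiff ℝ k (fun x : (Fin n → ℝ) × (Fin n → ℝ) => dt x.1 x.2) := by
  unfold dt; fun_prop
lemma abs_dt_le (a b : Fin n → ℝ) : |dt a b| ≤ n * (‖a‖ * ‖b‖) := by
  calc |dt a b| ≤ ∑ i, |a i * b i| := Finset.abs_sum_le_sum_abs _ _
    _ ≤ ∑ _i : Fin n, ‖a‖ * ‖b‖ := by
        refine Finset.sum_le_sum fun i _ => ?_
        rw [abs_mul]
        exact mul_le_mul (norm_le_pi_norm a i) (norm_le_pi_norm b i) (abs_nonneg _) (norm_nonneg _)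
    _ = _ := by simp

/-- Coordinates adapted to the splitting. -/
def Th (E : Hz n ≃L[ℝ] Hz n) (w : Ww n) (a : Fin n → ℝ) : Hpt n :=
  emb (E (a, w.1)) (w.2 - dt a w.1 / 2)
def ac (E : Hz n ≃L[ℝ] Hz n) (x : Hpt n) : Fin n → ℝ := (E.symm (hor x)).1
def wc (E : Hz n ≃L[ℝ] Hz n) (x : Hpt n) : Ww n :=
  ((E.symm (hor x)).2, x.2.2 + dt (E.symm (hor x)).1 (E.symm (hor x)).2 / 2)

variable (E : Hz n ≃L[ℝ] Hz n)

@[simp] lemma hor_emb' (u : Hz n) (t : ℝ) : hor (emb u t) = u := rfl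
@[simp] lemma emb_t' (u : Hz n) (t : ℝ) : (emb u t).2.2 = t := rfl
@[simp] lemma hor_Th (w : Ww n) (a : Fin n → ℝ) : hor (Th E w a) = E (a, w.1) := rfl
@[simp] lemma Th_t (w : Ww n) (a : Fin n → ℝ) : (Th E w a).2.2 = w.2 - dt a w.1 / 2 := rfl
@[simp] lemma ac_Th (w : Ww n) (a : Fin n → ℝ) : ac E (Th E w a) = a := by simp [ac]
@[simp] lemma wc_Th (w : Ww n) (a : Fin n → ℝ) : wc E (Th E w a) = w := by
  ext <;> simp [wc]
@[simp] lemma Th_wc_ac (x : Hpt n) : Th E (wc E x) (ac E x) = x := by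
  apply hpt_ext
  · simp [wc, ac]
  · simp [wc, ac]

lemma continuous_Th : Continuous (fun x : Ww n × (Fin n → ℝ) => Th E x.1 x.2) := by
  unfold Th
  exact continuous_emb.comp (((E.continuous.comp (by fun_prop))).prodMk
    ((by fun_prop : Continuous fun x : Ww n × (Fin n → ℝ) => x.1.2).sub ((continuous_dt.comp (by fun_prop : Continuous fun x : Ww n × (Fin n → ℝ) => (x.2, x.1.1))).div_const 2)))
lemma contDiff_hor {k : WithTop ℕ∞} : ContDiff ℝ k (hor : Hpt n → Hz n) := by unfold hor; fun_prop
lemma contDiff_ac {k : WithTop ℕ∞} : ContDiff ℝ k (ac E) := by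
  unfold ac
  exact contDiff_fst.comp (E.symm.contDiff.comp contDiff_hor)
lemma contDiff_wc {k : WithTop ℕ∞} : ContDiff ℝ k (wc E) := by
  unfold wc
  have h : ContDiff ℝ k fun x : Hpt n => E.symm (hor x) := E.symm.contDiff.comp contDiff_hor
  refine (contDiff_snd.comp h).prodMk (ContDiff.add (by fun_prop) (ContDiff.div_const ?_ 2))
  exact contDiff_dt.comp h
lemma continuous_ac : Continuous (ac E) := (contDiff_ac (k := 0) E).continuous
lemma continuous_wc : Continuous (wc E) := (contDiff_wc (k := 0) E).continuous

variable {E}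

lemma Th_inv_mul (hE : ∀ x y, om (E x) (E y) = om x y) (w0 w : Ww n) (a0 a : Fin n → ℝ) :
    hmul (hinv (Th E w0 a0)) (Th E w a) =
      Th E (w.1 - w0.1, w.2 - w0.2 - dt a0 (w.1 - w0.1)) (a - a0) := by
  apply hpt_ext
  · rw [hor_hmul]
    have : hor (hinv (Th E w0 a0)) = - hor (Th E w0 a0) := rfl
    rw [this, hor_Th, hor_Th, hor_Th, neg_add_eq_sub, ← map_sub]; rfl
  · rw [hmul_t]
    have h1 : hor (hinv (Th E w0 a0)) = - hor (Th E w0 a0) := rfl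
    have h2 : (hinv (Th E w0 a0)).2.2 = - (Th E w0 a0).2.2 := rfl
    rw [h1, h2, om_neg_left, hor_Th, hor_Th, hE, om_pair, Th_t, Th_t, Th_t]
    simp only [dt_sub_left, dt_sub_right]
    ring

lemma Th_inv_mul_same (hE : ∀ x y, om (E x) (E y) = om x y) (w : Ww n) (a0 a : Fin n → ℝ) :
    hmul (hinv (Th E w a0)) (Th E w a) = emb (E (a - a0, 0)) 0 := by
  rw [Th_inv_mul hE]
  apply hpt_ext
  · simp
  · simp [dt]

lemma hdil_Th (l : ℝ) (w : Ww n) (a : Fin n → ℝ) :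
    hdil l (Th E w a) = Th E (l • w.1, l ^ 2 * w.2) (l • a) := by
  apply hpt_ext
  · have : hor (hdil l (Th E w a)) = l • hor (Th E w a) := rfl
    rw [this, hor_Th, hor_Th, ← map_smul]; rfl
  · have : (hdil l (Th E w a)).2.2 = l ^ 2 * (Th E w a).2.2 := rfl
    rw [this, Th_t, Th_t]
    simp only [dt_smul_left, dt_smul_right]; ring

/-- lower constants -/
lemma Th_lower (hn : 1 ≤ n) (D : HomDist n) (E : Hz n ≃L[ℝ] Hz n) : ∃ C : ℝ, 0 < C ∧ ∀ (w : Ww n) (a : Fin n → ℝ),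
    ‖w.1‖ ≤ C * D.d 0 (Th E w a) ∧ ‖a‖ ≤ C * D.d 0 (Th E w a) ∧ |w.2| ≤ C * D.d 0 (Th E w a) ^ 2 := by
  obtain ⟨c, hc, H⟩ := D.exists_lower hn
  set K := ‖(E.symm : Hz n →L[ℝ] Hz n)‖ with hK
  have hK0 : 0 ≤ K := norm_nonneg _
  set C1 := K / c with hC1
  have hC10 : 0 ≤ C1 := by positivity
  refine ⟨C1 + (1 / c ^ 2 + n * C1 ^ 2) + 1, by positivity, fun w a => ?_⟩
  set d := D.d 0 (Th E w a) with hd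
  have hd0 : 0 ≤ d := D.nonneg _ _
  have hg : gN (Th E w a) ≤ d / c := by rw [le_div_iff₀ hc, mul_comm]; exact H _
  have hu : ‖(a, w.1)‖ ≤ C1 * d := by
    have h1 : E.symm (hor (Th E w a)) = (a, w.1) := by simp
    have h2 := (E.symm : Hz n →L[ℝ] Hz n).le_opNorm (hor (Th E w a))
    have h3 : (E.symm : Hz n →L[ℝ] Hz n) (hor (Th E w a)) = (a, w.1) := h1
    rw [h3] at h2
    calc _ ≤ _ := h2
      _ ≤ K * (d / c) := mul_le_mul_of_nonneg_left ((hor_le_gN _).trans hg) hK0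
      _ = _ := by rw [hC1]; ring
  have ha : ‖a‖ ≤ C1 * d := (le_max_left _ _).trans hu
  have hb : ‖w.1‖ ≤ C1 * d := (le_max_right _ _).trans hu
  have hle : C1 * d ≤ (C1 + (1 / c ^ 2 + n * C1 ^ 2) + 1) * d := by
    apply mul_le_mul_of_nonneg_right _ hd0
    have : 0 ≤ 1 / c ^ 2 + n * C1 ^ 2 := by positivity
    linarith
  refine ⟨hb.trans hle, ha.trans hle, ?_⟩
  have ht := t_le_gN (Th E w a)
  rw [Th_t] at ht
  have h5 : |w.2| ≤ |w.2 - dt a w.1 / 2| + |dt a w.1| / 2 := by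
    have := abs_add_le (w.2 - dt a w.1 / 2) (dt a w.1 / 2)
    rw [sub_add_cancel, abs_div, abs_two] at this; exact this
  have h6 : |dt a w.1| ≤ n * (C1 * d) ^ 2 := by
    refine (abs_dt_le _ _).trans ?_
    rw [sq]; gcongr
  have h7 : gN (Th E w a) ^ 2 ≤ (d / c) ^ 2 := by
    have := gN_nonneg (Th E w a); gcongr
  have h8 : |w.2| ≤ (1 / c ^ 2 + n * C1 ^ 2) * d ^ 2 := by
    have e1 : (d / c) ^ 2 = 1 / c ^ 2 * d ^ 2 := by field_simp
    have e2 : 0 ≤ (n:ℝ) * (C1 * d) ^ 2 := by positivity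
    calc |w.2| ≤ (d / c) ^ 2 + n * (C1 * d) ^ 2 := by linarith
      _ = _ := by rw [e1]; ring
  refine h8.trans ?_
  apply mul_le_mul_of_nonneg_right _ (by positivity)
  linarith

lemma Th_upper (hn : 1 ≤ n) (D : HomDist n) (hE : ∀ x y, om (E x) (E y) = om x y) :
    ∃ C : ℝ, 0 < C ∧ ∀ (w : Ww n) (a a' : Fin n → ℝ), D.d (Th E w a) (Th E w a') ≤ C * ‖a' - a‖ := by
  obtain ⟨c, hc, H⟩ := D.exists_upper hn
  set K := ‖(E : Hz n →L[ℝ] Hz n)‖ with hK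
  have hK0 : 0 ≤ K := norm_nonneg _
  refine ⟨c * (K + 1), by positivity, fun w a a' => ?_⟩
  rw [D.eq_zero_inv, Th_inv_mul_same hE]
  refine (H _).trans ?_
  rw [gN_emb_zero, mul_assoc]
  refine mul_le_mul_of_nonneg_left ?_ hc.le
  have h2 := (E : Hz n →L[ℝ] Hz n).le_opNorm (a' - a, 0)
  have h3 : ‖((a' - a, 0) : Hz n)‖ = ‖a' - a‖ := by simp [Prod.norm_def]
  rw [h3] at h2
  calc _ ≤ _ := h2
    _ ≤ _ := by rw [add_mul]; linarith [norm_nonneg (a' - a)]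

/-! shear and dilation of volume -/
def shw (w0 : Ww n) (a0 : Fin n → ℝ) (w : Ww n) : Ww n := (w.1 - w0.1, w.2 - w0.2 - dt a0 (w.1 - w0.1))
def shwi (w0 : Ww n) (a0 : Fin n → ℝ) (w : Ww n) : Ww n := (w.1 + w0.1, w.2 + w0.2 + dt a0 w.1)
lemma shwi_shw (w0 : Ww n) (a0 : Fin n → ℝ) (w : Ww n) : shwi w0 a0 (shw w0 a0 w) = w := by
  refine Prod.ext (by simp [shw, shwi]) ?_
  simp only [shw, shwi]; ring
lemma continuous_shw (w0 : Ww n) (a0 : Fin n → ℝ) : Continuous (shw w0 a0) := by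
  unfold shw dt; fun_prop
lemma continuous_shwi (w0 : Ww n) (a0 : Fin n → ℝ) : Continuous (shwi w0 a0) := by
  unfold shwi dt; fun_prop
lemma measurePreserving_shw (w0 : Ww n) (a0 : Fin n → ℝ) : MeasurePreserving (shw w0 a0) volume volume := by
  have := MeasurePreserving.skew_product (μa := (volume : Measure (Fin n → ℝ))) (μc := (volume : Measure ℝ)) (μd := (volume : Measure ℝ))
    (f := fun b : Fin n → ℝ => b - w0.1) (measurePreserving_sub_right _ w0.1)
    (g := fun b s => s - w0.2 - dt a0 (b - w0.1))
    (by
      have : Continuous (Function.uncurry fun (b : Fin n → ℝ) (s : ℝ) => s - w0.2 - dt a0 (b - w0.1)) := by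
        unfold dt Function.uncurry; fun_prop
      exact this.measurable)
    (by
      refine Eventually.of_forall fun b => ?_
      have h := (measurePreserving_sub_right (volume : Measure ℝ) (w0.2 + dt a0 (b - w0.1))).map_eq
      convert h using 2
      ext s; ring)
  exact this

def wdil (r : ℝ) (w : Ww n) : Ww n := (r • w.1, r ^ 2 * w.2)
lemma continuous_wdil (r : ℝ) : Continuous (wdil r : Ww n → Ww n) := by unfold wdil; fun_prop

lemma map_wdil {r : ℝ} (hr : 0 < r) :
    Measure.map (wdil r : Ww n → Ww n) volume = ENNReal.ofReal ((r ^ (n + 2))⁻¹) • volume := by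
  have h1 : Measure.map (fun b : Fin n → ℝ => r • b) volume = ENNReal.ofReal ((r ^ n)⁻¹) • volume := by
    rw [Measure.map_addHaar_smul _ hr.ne']
    simp only [Module.finrank_fin_fun]
    rw [abs_of_pos (by positivity)]
  have h2 : Measure.map (fun s : ℝ => r ^ 2 * s) volume = ENNReal.ofReal ((r ^ 2)⁻¹) • volume := by
    have := Measure.map_addHaar_smul (volume : Measure ℝ) (r := r ^ 2) (by positivity)
    simp only [Module.finrank_self, pow_one] at this
    rw [abs_of_pos (by positivity)] at this
    exact this
  have h3 : (wdil r : Ww n → Ww n) = Prod.map (fun b : Fin n → ℝ => r • b) (fun s : ℝ => r ^ 2 * s) := rfl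
  rw [h3, Measure.volume_eq_prod, ← Measure.map_prod_map _ _ (by fun_prop) (by fun_prop), h1, h2]
  rw [Measure.prod_smul_left, Measure.prod_smul_right, smul_smul, ← ENNReal.ofReal_mul (by positivity)]
  congr 2
  rw [pow_add, mul_inv]

lemma vol_wdil {r : ℝ} (hr : 0 < r) {s : Set (Ww n)} (hs : MeasurableSet s) :
    volume s = ENNReal.ofReal (r ^ (n + 2)) * volume (wdil r ⁻¹' s) := by
  have h := congrArg (fun μ : Measure (Ww n) => μ s) (map_wdil (n := n) hr)
  simp only [Measure.smul_apply, smul_eq_mul] at h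
  rw [Measure.map_apply (continuous_wdil r).measurable hs] at h
  rw [h, ← mul_assoc, ← ENNReal.ofReal_mul (by positivity), mul_inv_cancel₀ (by positivity)]
  simp
end

section
abbrev Am (n : ℕ) : Type := (Fin n → ℝ) →L[ℝ] (Fin n → ℝ)

/-- shadow volume of the unit ball centred at `z` on the vertical plane of slope `A`. -/
def shadow (D : HomDist n) (E : Hz n ≃L[ℝ] Hz n) (A : Am n) (z : Hpt n) (ρ : ℝ) : Set (Ww n) :=
  {w | D.d z (Th E w (A w.1)) < ρ}

def GG (D : HomDist n) (E : Hz n ≃L[ℝ] Hz n) (A : Am n) : ℝ≥0∞ :=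
  ⨆ (z : Hpt n) (_ : D.d 0 z < 1), volume (shadow D E A z 1)

variable {E : Hz n ≃L[ℝ] Hz n}

lemma continuous_ThA (A : Am n) : Continuous fun w : Ww n => Th E w (A w.1) :=
  (continuous_Th E).comp (continuous_id.prodMk (A.continuous.comp continuous_fst))

lemma isOpen_shadow (hn : 1 ≤ n) (D : HomDist n) (A : Am n) (z : Hpt n) (ρ : ℝ) :
    IsOpen (shadow D E A z ρ) :=
  isOpen_lt ((D.continuous_d hn).comp (continuous_const.prodMk (continuous_ThA A))) continuous_const

lemma shadow_dil (D : HomDist n) (A : Am n) (z : Hpt n) {r : ℝ} (hr : 0 < r) (ρ : ℝ) :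
    wdil r ⁻¹' (shadow D E A (hdil r z) (r * ρ)) = shadow D E A z ρ := by
  ext w
  show D.d (hdil r z) (Th E (wdil r w) (A (r • w.1))) < r * ρ ↔ D.d z (Th E w (A w.1)) < ρ
  have h : Th E (wdil r w) (A (r • w.1)) = hdil r (Th E w (A w.1)) := by
    rw [hdil_Th, map_smul]; rfl
  rw [h, D.homog r hr]
  exact mul_lt_mul_iff_right₀ hr

lemma vol_shadow_le (hn : 1 ≤ n) (D : HomDist n) (A : Am n) {z : Hpt n} {r : ℝ} (hr : 0 < r)
    (hz : D.d 0 z < r) :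
    volume (shadow D E A z r) ≤ ENNReal.ofReal (r ^ (n + 2)) * GG D E A := by
  rw [vol_wdil hr (isOpen_shadow hn D A z r).measurableSet]
  have hzz : z = hdil r (hdil r⁻¹ z) := by
    rw [hdil_hdil, mul_inv_cancel₀ hr.ne']; simp [hdil]
  have h1 : wdil r ⁻¹' (shadow D E A z r) = shadow D E A (hdil r⁻¹ z) 1 := by
    have := shadow_dil (E := E) D A (hdil r⁻¹ z) hr 1
    rw [← hzz, mul_one] at this; exact this
  rw [h1]
  refine mul_le_mul' le_rfl ?_
  refine le_iSup₂ (f := fun (z : Hpt n) (_ : D.d 0 z < 1) => volume (shadow D E A z 1)) (hdil r⁻¹ z) ?_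
  rw [D.d_dil (inv_pos.2 hr), inv_mul_lt_iff₀ hr, mul_one]; exact hz

/-- Comparison of `GG`. -/
lemma GG_le (hn : 1 ≤ n) (D : HomDist n) (hE : ∀ x y, om (E x) (E y) = om x y) :
    ∃ C : ℝ, 0 < C ∧ ∀ A A' : Am n, GG D E A' ≤ ENNReal.ofReal ((1 + C * ‖A' - A‖) ^ (n + 2)) * GG D E A := by
  obtain ⟨C1, hC1, H1⟩ := Th_lower hn D E
  obtain ⟨C2, hC2, H2⟩ := Th_upper hn D hE
  refine ⟨C2 * (2 * C1), by positivity, fun A A' => ?_⟩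
  refine iSup₂_le fun z hz => ?_
  refine le_trans (measure_mono ?_) (vol_shadow_le hn D A (r := 1 + C2 * (2 * C1) * ‖A' - A‖) (by positivity) (z := z) ?_)
  · intro w hw
    have hw' : D.d z (Th E w (A' w.1)) < 1 := hw
    show D.d z (Th E w (A w.1)) < _
    have h0 : D.d 0 (Th E w (A' w.1)) ≤ 2 := by
      have := D.triangle 0 z (Th E w (A' w.1)); linarith
    have hb : ‖w.1‖ ≤ 2 * C1 := by
      refine (H1 w (A' w.1)).1.trans ?_
      nlinarith
    have h3 := H2 w (A' w.1) (A w.1)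
    have h4 : ‖A w.1 - A' w.1‖ ≤ ‖A' - A‖ * (2 * C1) := by
      rw [norm_sub_rev]
      have := (A' - A).le_opNorm w.1
      exact this.trans (by gcongr)
    have h5 := D.triangle z (Th E w (A' w.1)) (Th E w (A w.1))
    have h6 : C2 * ‖A w.1 - A' w.1‖ ≤ C2 * (‖A' - A‖ * (2 * C1)) := by gcongr
    nlinarith
  · have : 0 ≤ C2 * (2 * C1) * ‖A' - A‖ := by positivity
    linarith

lemma GG_pos (hn : 1 ≤ n) (D : HomDist n) (A : Am n) : 0 < GG D E A := by
  refine lt_of_lt_of_le ?_ (le_iSup₂ (f := fun (z : Hpt n) (_ : D.d 0 z < 1) => volume (shadow D E A z 1)) 0 (by rw [D.self]; norm_num))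
  refine (isOpen_shadow hn D A 0 1).measure_pos volume ⟨0, ?_⟩
  show D.d 0 (Th E 0 (A 0)) < 1
  have : Th E (0 : Ww n) (A 0) = 0 := by
    apply hpt_ext
    · simp
    · simp [dt]
  rw [this, D.self]; norm_num

lemma GG_lt_top (hn : 1 ≤ n) (D : HomDist n) (A : Am n) : GG D E A < ⊤ := by
  obtain ⟨C1, hC1, H1⟩ := Th_lower hn D E
  have hfin : volume (Metric.closedBall (0 : Ww n) (2 * C1 + 4 * C1)) < ⊤ := measure_closedBall_lt_top
  refine lt_of_le_of_lt (iSup₂_le fun z hz => measure_mono ?_) hfin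
  intro w hw
  have hw' : D.d z (Th E w (A w.1)) < 1 := hw
  have h0 : D.d 0 (Th E w (A w.1)) ≤ 2 := by
    have := D.triangle 0 z (Th E w (A w.1)); linarith
  have hd := D.nonneg 0 (Th E w (A w.1))
  obtain ⟨h1, -, h3⟩ := H1 w (A w.1)
  rw [mem_closedBall_zero_iff, Prod.norm_def]
  refine max_le ?_ ?_
  · nlinarith
  · rw [Real.norm_eq_abs]
    have : D.d 0 (Th E w (A w.1)) ^ 2 ≤ 4 := by nlinarith
    nlinarith

/-- real version -/
def gr (D : HomDist n) (E : Hz n ≃L[ℝ] Hz n) (A : Am n) : ℝ := (GG D E A).toReal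

lemma gr_pos (hn : 1 ≤ n) (D : HomDist n) (A : Am n) : 0 < gr D E A :=
  ENNReal.toReal_pos (GG_pos hn D A).ne' (GG_lt_top hn D A).ne

lemma ofReal_gr (hn : 1 ≤ n) (D : HomDist n) (A : Am n) : ENNReal.ofReal (gr D E A) = GG D E A :=
  ENNReal.ofReal_toReal (GG_lt_top hn D A).ne

lemma continuous_gr (hn : 1 ≤ n) (D : HomDist n) (hE : ∀ x y, om (E x) (E y) = om x y) : Continuous (gr D E) := by
  obtain ⟨C, hC, H⟩ := GG_le hn D hE
  have H' : ∀ A A' : Am n, gr D E A' ≤ (1 + C * ‖A' - A‖) ^ (n + 2) * gr D E A := by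
    intro A A'
    have := ENNReal.toReal_mono (by exact ENNReal.mul_ne_top ENNReal.ofReal_ne_top (GG_lt_top hn D A).ne) (H A A')
    rw [ENNReal.toReal_mul, ENNReal.toReal_ofReal (by positivity)] at this
    exact this
  rw [continuous_iff_continuousAt]
  intro A
  have hc : Continuous fun A' : Am n => (1 + C * ‖A' - A‖) ^ (n + 2) := by fun_prop
  have h1 : Tendsto (fun A' : Am n => (1 + C * ‖A' - A‖) ^ (n + 2)) (𝓝 A) (𝓝 1) := by
    have := hc.tendsto A
    simpa using this
  refine tendsto_of_tendsto_of_tendsto_of_le_of_le (g := fun A' => gr D E A / (1 + C * ‖A' - A‖) ^ (n + 2)) (h := fun A' => (1 + C * ‖A' - A‖) ^ (n + 2) * gr D E A) ?_ ?_ ?_ ?_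
  · have h2 := (tendsto_const_nhds (x := gr D E A)).div h1 one_ne_zero
    rw [div_one] at h2
    exact h2
  · simpa using h1.mul_const (gr D E A)
  · intro A'
    have hp : 0 < (1 + C * ‖A' - A‖) ^ (n + 2) := by positivity
    show gr D E A / (1 + C * ‖A' - A‖) ^ (n + 2) ≤ gr D E A'
    rw [div_le_iff₀ hp, mul_comm, norm_sub_rev]
    exact H' A' A
  · intro A'; exact H' A A'
end

section
variable {E : Hz n ≃L[ℝ] Hz n}

/-- Intrinsic graph data. -/
structure IGraph (D : HomDist n) (E : Hz n ≃L[ℝ] Hz n) (B : Set (Ww n)) (φ : Ww n → Fin n → ℝ)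
    (A : Ww n → Am n) : Prop where
  opn : IsOpen B
  bdd : volume B < ⊤
  cphi : ContinuousOn φ B
  cA : ContinuousOn A B
  bA : ∃ M : ℝ, ∀ w ∈ B, ‖A w‖ ≤ M
  diff : ∀ w0 ∈ B, ∀ ε > 0, ∃ δ > 0, ∀ w ∈ B, D.d (Th E w0 (φ w0)) (Th E w (φ w)) < δ →
    ‖φ w - φ w0 - A w0 (w.1 - w0.1)‖ ≤ ε * D.d (Th E w0 (φ w0)) (Th E w (φ w))

def dens (D : HomDist n) (E : Hz n ≃L[ℝ] Hz n) (A : Ww n → Am n) (w : Ww n) : ℝ :=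
  2 ^ (n + 2) / gr D E (A w)

def grm (D : HomDist n) (E : Hz n ≃L[ℝ] Hz n) (B : Set (Ww n)) (φ : Ww n → Fin n → ℝ)
    (A : Ww n → Am n) : Measure (Hpt n) :=
  Measure.map (fun w => Th E w (φ w)) ((volume.restrict B).withDensity fun w => ENNReal.ofReal (dens D E A w))

variable {D : HomDist n} {B : Set (Ww n)} {φ : Ww n → Fin n → ℝ} {A : Ww n → Am n}

lemma dens_pos (hn : 1 ≤ n) (w : Ww n) : 0 < dens D E A w := by
  have := gr_pos (E := E) hn D (A w); unfold dens; positivity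

lemma IGraph.cPhi (h : IGraph D E B φ A) : ContinuousOn (fun w => Th E w (φ w)) B :=
  (continuous_Th E).comp_continuousOn (continuousOn_id.prodMk h.cphi)

lemma IGraph.cdens (hn : 1 ≤ n) (hE : ∀ x y, om (E x) (E y) = om x y) (h : IGraph D E B φ A) :
    ContinuousOn (dens D E A) B := by
  unfold dens
  exact continuousOn_const.div ((continuous_gr hn D hE).comp_continuousOn h.cA)
    fun w _ => (gr_pos hn D (A w)).ne'

lemma IGraph.aem (h : IGraph D E B φ A) : AEMeasurable (fun w => Th E w (φ w))
    ((volume.restrict B).withDensity fun w => ENNReal.ofReal (dens D E A w)) :=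
  (h.cPhi.aemeasurable h.opn.measurableSet).mono_ac (withDensity_absolutelyContinuous _ _)

lemma IGraph.grm_apply (h : IGraph D E B φ A) {T : Set (Hpt n)} (hT : MeasurableSet T) :
    grm D E B φ A T = ∫⁻ w in {w ∈ B | Th E w (φ w) ∈ T}, ENNReal.ofReal (dens D E A w) := by
  rw [grm, Measure.map_apply_of_aemeasurable h.aem hT, withDensity_apply',
    Measure.restrict_restrict' h.opn.measurableSet]
  congr 2
  ext w; exact and_comm

lemma IGraph.injOn : InjOn (fun w => Th E w (φ w)) B := by
  intro w _ w' _ hww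
  have := congrArg (wc E) hww
  simpa using this

lemma IGraph.meas (h : IGraph D E B φ A) : MeasurableSet ((fun w => Th E w (φ w)) '' B) :=
  h.opn.measurableSet.image_of_continuousOn_injOn h.cPhi IGraph.injOn

lemma exists_dens_bound (hn : 1 ≤ n) (D : HomDist n) (hE : ∀ x y, om (E x) (E y) = om x y) (M : ℝ) :
    ∃ K : ℝ, ∀ A : Am n, ‖A‖ ≤ M → 2 ^ (n + 2) / gr D E A ≤ K := by
  have hc : Continuous fun A : Am n => 2 ^ (n + 2) / gr D E A :=
    continuous_const.div (continuous_gr hn D hE) fun A => (gr_pos hn D A).ne'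
  obtain ⟨K, hK⟩ := (isCompact_closedBall (0 : Am n) M).bddAbove_image hc.continuousOn
  exact ⟨K, fun A hA => hK ⟨A, by simpa using hA, rfl⟩⟩

lemma IGraph.finite (hn : 1 ≤ n) (hE : ∀ x y, om (E x) (E y) = om x y) (h : IGraph D E B φ A) :
    IsFiniteMeasure (grm D E B φ A) := by
  refine ⟨?_⟩
  rw [h.grm_apply MeasurableSet.univ]
  obtain ⟨M, hM⟩ := h.bA
  obtain ⟨K, hK⟩ := exists_dens_bound (E := E) hn D hE M
  have hB : {w ∈ B | Th E w (φ w) ∈ univ} = B := by ext; simp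
  rw [hB]
  calc ∫⁻ w in B, ENNReal.ofReal (dens D E A w) ≤ ∫⁻ _w in B, ENNReal.ofReal K :=
        setLIntegral_mono' h.opn.measurableSet fun w hw => ENNReal.ofReal_le_ofReal (hK _ (hM w hw))
    _ = ENNReal.ofReal K * volume B := setLIntegral_const _ _
    _ < ⊤ := ENNReal.mul_lt_top ENNReal.ofReal_lt_top h.bdd

lemma exists_eta (k : ℕ) {κ : ℝ} (hκ : 1 < κ) : ∃ η : ℝ, 0 < η ∧ (1 + η) ^ k ≤ κ := by
  have hc : Tendsto (fun η : ℝ => (1 + η) ^ k) (𝓝[>] 0) (𝓝 1) := by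
    have : Continuous fun η : ℝ => (1 + η) ^ k := by fun_prop
    have h2 := this.tendsto 0
    simp only [add_zero, one_pow] at h2
    exact h2.mono_left nhdsWithin_le_nhds
  obtain ⟨η, h1, h2⟩ := ((hc.eventually (ge_mem_nhds hκ)).and self_mem_nhdsWithin).exists
  exact ⟨η, h2, h1⟩

theorem area_formula (hn : 1 ≤ n) (hE : ∀ x y, om (E x) (E y) = om x y) (h : IGraph D E B φ A) :
    (sphMeasure D ((n:ℝ) + 2)).restrict ((fun w => Th E w (φ w)) '' B) = grm D E B φ A := by
  have hfin := h.finite hn hE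
  obtain ⟨C1, hC1, L1⟩ := Th_lower hn D E
  obtain ⟨C2, hC2, L2⟩ := Th_upper hn D hE
  have hpow : ∀ r : ℝ, r ^ ((n:ℝ) + 2) = r ^ (n + 2) := by
    intro r
    have : ((n:ℝ) + 2) = ((n + 2 : ℕ) : ℝ) := by push_cast; ring
    rw [this, Real.rpow_natCast]
  have hballo : ∀ y r, IsOpen {q | D.d y q < r} := fun y r =>
    isOpen_lt ((D.continuous_d hn).comp (continuous_const.prodMk continuous_id)) continuous_const
  -- translated distance
  have htr : ∀ w0 w a, D.d (Th E w0 (φ w0)) (Th E w a) = D.d 0 (Th E (shw w0 (φ w0) w) (a - φ w0)) := by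
    intro w0 w a
    rw [D.eq_zero_inv, Th_inv_mul hE]; rfl
  refine sphMeasure_restrict_eq hn D _ _ _ h.meas ?_ ?_ ?_
  · rw [h.grm_apply h.meas.compl]
    have : {w ∈ B | Th E w (φ w) ∈ ((fun w => Th E w (φ w)) '' B)ᶜ} = ∅ := by
      ext w
      simp only [mem_empty_iff_false, iff_false]
      rintro ⟨hw, hw'⟩
      exact hw' ⟨w, hw, rfl⟩
    rw [this]; simp
  · rintro x ⟨w0, hw0, rfl⟩ κ hκ
    obtain ⟨η, hη, hηκ⟩ := exists_eta (n + 3) hκ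
    set x := Th E w0 (φ w0) with hx
    obtain ⟨δ1, hδ1, hd1⟩ := h.diff w0 hw0 (η / (2 * C2)) (by positivity)
    -- density near w0
    have hρ0 := dens_pos (E := E) (D := D) (A := A) hn w0
    have hev : ∀ᶠ w in 𝓝 w0, dens D E A w ≤ (1 + η) * dens D E A w0 := by
      have := (h.cdens hn hE).continuousAt (h.opn.mem_nhds hw0)
      exact this.eventually (ge_mem_nhds (by nlinarith))
    have hev2 : ∀ᶠ q in 𝓝 x, dens D E A (wc E q) ≤ (1 + η) * dens D E A w0 := by
      have := (continuous_wc E).tendsto x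
      rw [hx, wc_Th] at this
      exact this.eventually hev
    obtain ⟨δ2, hδ2, hd2⟩ := (D.nhds_basis hn x).eventually_iff.1 hev2
    refine ⟨min δ1 δ2 / 2, by positivity, fun r hr hrδ y hy => ?_⟩
    have hr1 : 2 * r < δ1 := by have := min_le_left δ1 δ2; linarith
    have hr2 : 2 * r < δ2 := by have := min_le_right δ1 δ2; linarith
    rw [h.grm_apply (hballo y r).measurableSet]
    set Z := {w ∈ B | Th E w (φ w) ∈ {q | D.d y q < r}} with hZ
    have hZd : ∀ w ∈ Z, w ∈ B ∧ D.d y (Th E w (φ w)) < r := fun w hw => hw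
    have hZ2 : ∀ w ∈ Z, D.d x (Th E w (φ w)) < 2 * r := by
      intro w hw
      have h1 := D.triangle x y (Th E w (φ w))
      have h2 := (hZd w hw).2
      rw [D.symm x y] at h1; linarith
    have hZm : MeasurableSet Z := (h.cPhi.isOpen_inter_preimage h.opn (hballo y r)).measurableSet
    have hsub : Z ⊆ shw w0 (φ w0) ⁻¹' shadow D E (A w0) (hmul (hinv x) y) (r * (1 + η)) := by
      intro w hw
      show D.d (hmul (hinv x) y) (Th E (shw w0 (φ w0) w) (A w0 (shw w0 (φ w0) w).1)) < _
      have h1 := hd1 w (hZd w hw).1 ((hZ2 w hw).trans hr1)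
      have h2 := L2 (shw w0 (φ w0) w) (φ w - φ w0) (A w0 (shw w0 (φ w0) w).1)
      have h3 := D.triangle (hmul (hinv x) y) (Th E (shw w0 (φ w0) w) (φ w - φ w0)) (Th E (shw w0 (φ w0) w) (A w0 (shw w0 (φ w0) w).1))
      have h4 : D.d (hmul (hinv x) y) (Th E (shw w0 (φ w0) w) (φ w - φ w0)) = D.d y (Th E w (φ w)) := by
        have : Th E (shw w0 (φ w0) w) (φ w - φ w0) = hmul (hinv x) (Th E w (φ w)) := by
          rw [hx, Th_inv_mul hE]; rfl
        rw [this, D.leftInv]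
      rw [norm_sub_rev] at h2
      have h5 : ‖φ w - φ w0 - A w0 (shw w0 (φ w0) w).1‖ ≤ η / (2 * C2) * (2 * r) :=
        h1.trans (mul_le_mul_of_nonneg_left (hZ2 w hw).le (by positivity))
      have h6 : C2 * ‖φ w - φ w0 - A w0 (shw w0 (φ w0) w).1‖ ≤ η * r := by
        calc _ ≤ C2 * (η / (2 * C2) * (2 * r)) := mul_le_mul_of_nonneg_left h5 hC2.le
          _ = η * r := by field_simp
      have h7 := (hZd w hw).2
      rw [h4] at h3
      nlinarith
    have hvol : volume Z ≤ ENNReal.ofReal ((r * (1 + η)) ^ (n + 2)) * GG D E (A w0) := by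
      refine (measure_mono hsub).trans ?_
      rw [(measurePreserving_shw w0 (φ w0)).measure_preimage (isOpen_shadow hn D _ _ _).measurableSet.nullMeasurableSet]
      refine vol_shadow_le hn D _ (by positivity) ?_
      rw [← D.eq_zero_inv, D.symm]
      nlinarith
    calc ∫⁻ w in Z, ENNReal.ofReal (dens D E A w) ≤ ∫⁻ _w in Z, ENNReal.ofReal ((1 + η) * dens D E A w0) := by
          refine setLIntegral_mono' hZm fun w hw => ENNReal.ofReal_le_ofReal ?_
          have := hd2 (show Th E w (φ w) ∈ {q | D.d x q < δ2} from (hZ2 w hw).trans hr2)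
          rwa [wc_Th] at this
      _ = ENNReal.ofReal ((1 + η) * dens D E A w0) * volume Z := setLIntegral_const _ _
      _ ≤ ENNReal.ofReal ((1 + η) * dens D E A w0) * (ENNReal.ofReal ((r * (1 + η)) ^ (n + 2)) * GG D E (A w0)) := by gcongr
      _ = ENNReal.ofReal ((1 + η) * dens D E A w0 * ((r * (1 + η)) ^ (n + 2) * gr D E (A w0))) := by
          rw [← ofReal_gr hn D, ← ENNReal.ofReal_mul (by positivity), ← ENNReal.ofReal_mul (by positivity)]
      _ ≤ _ := by
          apply ENNReal.ofReal_le_ofReal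
          have hg := gr_pos (E := E) hn D (A w0)
          have : (1 + η) * dens D E A w0 * ((r * (1 + η)) ^ (n + 2) * gr D E (A w0)) = (1 + η) ^ (n + 3) * (2 * r) ^ (n + 2) := by
            unfold dens; rw [mul_pow, mul_pow, pow_succ (1 + η) (n + 2)]; field_simp
          rw [this, hpow]
          gcongr
  · rintro x ⟨w0, hw0, rfl⟩ κ hκ δ hδ
    obtain ⟨η, hη, hηκ⟩ := exists_eta (n + 4) hκ
    set x := Th E w0 (φ w0) with hx
    set ε := min (η / (4 * C2)) (1 / (2 * C2)) with hε
    have hε0 : 0 < ε := by positivity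
    have hε1 : C2 * ε ≤ η / 4 := by
      calc C2 * ε ≤ C2 * (η / (4 * C2)) := mul_le_mul_of_nonneg_left (min_le_left _ _) hC2.le
        _ = _ := by field_simp
    have hε2 : C2 * ε ≤ 1 / 2 := by
      calc C2 * ε ≤ C2 * (1 / (2 * C2)) := mul_le_mul_of_nonneg_left (min_le_right _ _) hC2.le
        _ = _ := by field_simp
    obtain ⟨δ1, hδ1, hd1⟩ := h.diff w0 hw0 ε hε0
    have hρ0 := dens_pos (E := E) (D := D) (A := A) hn w0
    have hg := gr_pos (E := E) hn D (A w0)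
    -- choose z
    obtain ⟨z, hz, hzG⟩ : ∃ z, D.d 0 z < 1 ∧ GG D E (A w0) ≤ ENNReal.ofReal (1 + η) * volume (shadow D E (A w0) z 1) := by
      by_contra hcon
      push Not at hcon
      have h1 : ENNReal.ofReal (1 + η) * GG D E (A w0) ≤ GG D E (A w0) := by
        conv_lhs => rw [GG]
        rw [ENNReal.mul_iSup]
        refine iSup_le fun z => ?_
        rw [ENNReal.mul_iSup]
        exact iSup_le fun hz => (hcon z hz).le
      rw [← ofReal_gr hn D, ← ENNReal.ofReal_mul (by positivity), ENNReal.ofReal_le_ofReal_iff hg.le] at h1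
      nlinarith
    -- neighborhood
    have hev : ∀ᶠ w in 𝓝 w0, w ∈ B ∧ D.d x (Th E w (φ w)) < δ1 ∧ dens D E A w0 ≤ (1 + η) * dens D E A w := by
      refine Filter.Eventually.and (p := fun w => w ∈ B) (h.opn.mem_nhds hw0) (Filter.Eventually.and ?_ ?_)
      · have hc : ContinuousAt (fun w => D.d x (Th E w (φ w))) w0 :=
          ((D.continuous_d hn).continuousAt).comp (f := fun w => (x, Th E w (φ w)))
            (continuousAt_const.prodMk (h.cPhi.continuousAt (h.opn.mem_nhds hw0)))
        exact hc.eventually (gt_mem_nhds (by show D.d x (Th E w0 (φ w0)) < δ1; rw [← hx, D.self]; exact hδ1))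
      · have hc := ((h.cdens hn hE).continuousAt (h.opn.mem_nhds hw0)).const_mul (1 + η)
        exact hc.eventually (le_mem_nhds (by nlinarith))
    have hev2 : ∀ᶠ w' in 𝓝 (0 : Ww n), shwi w0 (φ w0) w' ∈ B ∧ D.d x (Th E (shwi w0 (φ w0) w') (φ (shwi w0 (φ w0) w'))) < δ1 ∧ dens D E A w0 ≤ (1 + η) * dens D E A (shwi w0 (φ w0) w') := by
      have hc := (continuous_shwi w0 (φ w0)).tendsto 0
      have h0 : shwi w0 (φ w0) 0 = w0 := by simp [shwi, dt]
      rw [h0] at hc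
      exact hc.eventually hev
    obtain ⟨ξ, hξ, hξ2⟩ := Metric.eventually_nhds_iff.1 hev2
    obtain ⟨r, hr, hrδ, hrξ, hr1⟩ : ∃ r : ℝ, 0 < r ∧ r * (1 + η) < δ ∧ 4 * C1 * r < ξ ∧ r < 1 := by
      refine ⟨min (min (δ / (2 * (1 + η))) (ξ / (8 * C1))) (1 / 2), by positivity, ?_, ?_, ?_⟩
      · have : min (min (δ / (2 * (1 + η))) (ξ / (8 * C1))) (1 / 2) ≤ δ / (2 * (1 + η)) := (min_le_left _ _).trans (min_le_left _ _)
        calc _ ≤ δ / (2 * (1 + η)) * (1 + η) := by gcongr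
          _ = δ / 2 := by field_simp
          _ < δ := by linarith
      · have : min (min (δ / (2 * (1 + η))) (ξ / (8 * C1))) (1 / 2) ≤ ξ / (8 * C1) := (min_le_left _ _).trans (min_le_right _ _)
        calc _ ≤ 4 * C1 * (ξ / (8 * C1)) := by gcongr
          _ = ξ / 2 := by field_simp; norm_num
          _ < ξ := by linarith
      · exact lt_of_le_of_lt (min_le_right _ _) (by norm_num)
    refine ⟨r * (1 + η), by positivity, hrδ, hmul x (hdil r z), ?_, ?_⟩
    · rw [D.symm]
      show D.d x (hmul x (hdil r z)) < _
      rw [D.d_mul_right, D.d_dil hr]; nlinarith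
    rw [h.grm_apply (hballo _ _).measurableSet]
    set y := hmul x (hdil r z) with hy
    set Zr := shw w0 (φ w0) ⁻¹' shadow D E (A w0) (hdil r z) r with hZr
    have hZm : MeasurableSet Zr := (continuous_shw _ _).measurable (isOpen_shadow hn D _ _ _).measurableSet
    have hZ : ∀ w ∈ Zr, w ∈ B ∧ D.d y (Th E w (φ w)) < r * (1 + η) ∧ dens D E A w0 ≤ (1 + η) * dens D E A w := by
      intro w hw
      set w' := shw w0 (φ w0) w with hw'
      have e1 : D.d (hdil r z) (Th E w' (A w0 w'.1)) < r := hw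
      have e2 : D.d 0 (Th E w' (A w0 w'.1)) ≤ 2 * r := by
        have := D.triangle 0 (hdil r z) (Th E w' (A w0 w'.1))
        rw [D.d_dil hr] at this; nlinarith
      obtain ⟨f1, -, f3⟩ := L1 w' (A w0 w'.1)
      have hd0 := D.nonneg 0 (Th E w' (A w0 w'.1))
      have hn1 : dist w' 0 < ξ := by
        rw [dist_zero_right, Prod.norm_def]
        refine max_lt ?_ ?_
        · nlinarith
        · rw [Real.norm_eq_abs]
          have : D.d 0 (Th E w' (A w0 w'.1)) ^ 2 ≤ 4 * r := by nlinarith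
          nlinarith
      have hh := hξ2 hn1
      rw [hw', shwi_shw] at hh
      obtain ⟨g1, g2, g3⟩ := hh
      refine ⟨g1, ?_, g3⟩
      have k1 := hd1 w g1 g2
      set dd := D.d x (Th E w (φ w)) with hdd
      have k2 := L2 w' (A w0 w'.1) (φ w - φ w0)
      have k3 : ‖φ w - φ w0 - A w0 w'.1‖ ≤ ε * dd := k1
      have k4 : dd = D.d 0 (Th E w' (φ w - φ w0)) := htr w0 w (φ w)
      have k5 := D.triangle 0 (Th E w' (A w0 w'.1)) (Th E w' (φ w - φ w0))
      have hdd0 : 0 ≤ dd := D.nonneg _ _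
      have k6 : C2 * ‖φ w - φ w0 - A w0 w'.1‖ ≤ C2 * ε * dd := by
        rw [mul_assoc]; exact mul_le_mul_of_nonneg_left k3 hC2.le
      have k7 : C2 * ε * dd ≤ 1 / 2 * dd := mul_le_mul_of_nonneg_right hε2 hdd0
      have k8 : dd ≤ 4 * r := by linarith
      have k9 : C2 * ε * dd ≤ η * r := by
        calc C2 * ε * dd ≤ η / 4 * (4 * r) := mul_le_mul hε1 k8 hdd0 (by positivity)
          _ = η * r := by ring
      have m1 : D.d y (Th E w (φ w)) = D.d (hdil r z) (Th E w' (φ w - φ w0)) := by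
        have : Th E w (φ w) = hmul x (Th E w' (φ w - φ w0)) := by
          have q1 : Th E w' (φ w - φ w0) = hmul (hinv x) (Th E w (φ w)) := by
            rw [hx, Th_inv_mul hE]; rfl
          rw [q1, hmul_hinv_cancel]
        rw [this, hy, D.leftInv]
      have m2 := D.triangle (hdil r z) (Th E w' (A w0 w'.1)) (Th E w' (φ w - φ w0))
      rw [m1]; linarith
    have hsub : Zr ⊆ {w ∈ B | Th E w (φ w) ∈ {q | D.d y q < r * (1 + η)}} := fun w hw =>
      ⟨(hZ w hw).1, (hZ w hw).2.1⟩
    have hvZ : ENNReal.ofReal (r ^ (n + 2)) * GG D E (A w0) ≤ ENNReal.ofReal (1 + η) * volume Zr := by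
      rw [hZr, (measurePreserving_shw w0 (φ w0)).measure_preimage (isOpen_shadow hn D _ _ _).measurableSet.nullMeasurableSet]
      rw [vol_wdil hr (isOpen_shadow hn D _ _ _).measurableSet]
      have := shadow_dil (E := E) D (A w0) z hr 1
      rw [mul_one] at this
      rw [this]
      calc _ ≤ ENNReal.ofReal (r ^ (n + 2)) * (ENNReal.ofReal (1 + η) * volume (shadow D E (A w0) z 1)) := by gcongr
        _ = _ := by ring
    calc ENNReal.ofReal ((2 * (r * (1 + η))) ^ ((n:ℝ) + 2))
        = ENNReal.ofReal ((1 + η) ^ (n + 2) * dens D E A w0) * (ENNReal.ofReal (r ^ (n + 2)) * GG D E (A w0)) := by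
          rw [← ofReal_gr hn D, ← ENNReal.ofReal_mul (by positivity), ← ENNReal.ofReal_mul (by positivity), hpow]
          congr 1
          unfold dens; rw [mul_pow, mul_pow]; field_simp
      _ ≤ ENNReal.ofReal ((1 + η) ^ (n + 2) * dens D E A w0) * (ENNReal.ofReal (1 + η) * volume Zr) := by gcongr
      _ = ENNReal.ofReal ((1 + η) ^ (n + 3)) * ∫⁻ _w in Zr, ENNReal.ofReal (dens D E A w0) := by
          rw [setLIntegral_const, ← mul_assoc, ← ENNReal.ofReal_mul (by positivity), ← mul_assoc, ← ENNReal.ofReal_mul (by positivity)]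
          congr 2; ring
      _ ≤ ENNReal.ofReal ((1 + η) ^ (n + 3)) * ∫⁻ w in Zr, ENNReal.ofReal (1 + η) * ENNReal.ofReal (dens D E A w) := by
          refine mul_le_mul' le_rfl (setLIntegral_mono' hZm fun w hw => ?_)
          rw [← ENNReal.ofReal_mul (by positivity)]
          exact ENNReal.ofReal_le_ofReal (hZ w hw).2.2
      _ = ENNReal.ofReal ((1 + η) ^ (n + 4)) * ∫⁻ w in Zr, ENNReal.ofReal (dens D E A w) := by
          rw [lintegral_const_mul' _ _ ENNReal.ofReal_ne_top, ← mul_assoc, ← ENNReal.ofReal_mul (by positivity)]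
          congr 2
      _ ≤ ENNReal.ofReal κ * ∫⁻ w in {w ∈ B | Th E w (φ w) ∈ {q | D.d y q < r * (1 + η)}}, ENNReal.ofReal (dens D E A w) :=
          mul_le_mul' (ENNReal.ofReal_le_ofReal hηκ) (lintegral_mono_set hsub)

/-- Consequences. -/
theorem area_integral (hn : 1 ≤ n) (hE : ∀ x y, om (E x) (E y) = om x y) (h : IGraph D E B φ A)
    (F : Hpt n → ℝ) (hF : ContinuousOn F ((fun w => Th E w (φ w)) '' B)) :
    ∫ x in (fun w => Th E w (φ w)) '' B, F x ∂(sphMeasure D ((n:ℝ) + 2)) =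
      ∫ w in B, dens D E A w * F (Th E w (φ w)) := by
  have hae : AEStronglyMeasurable F (grm D E B φ A) := by
    rw [← area_formula hn hE h]
    exact hF.aestronglyMeasurable h.meas
  rw [area_formula hn hE h]
  rw [grm] at hae ⊢
  rw [integral_map h.aem hae]
  have hm : AEMeasurable (fun w => (dens D E A w).toNNReal) (volume.restrict B) :=
    ((h.cdens hn hE).aemeasurable h.opn.measurableSet).real_toNNReal
  have := integral_withDensity_eq_integral_smul₀ hm (fun w => F (Th E w (φ w)))
  refine this.trans (setIntegral_congr_fun h.opn.measurableSet fun w _ => ?_)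
  show (dens D E A w).toNNReal • F (Th E w (φ w)) = dens D E A w * F (Th E w (φ w))
  rw [NNReal.smul_def, Real.coe_toNNReal _ (dens_pos hn w).le, smul_eq_mul]

theorem area_finite (hn : 1 ≤ n) (hE : ∀ x y, om (E x) (E y) = om x y) (h : IGraph D E B φ A) :
    sphMeasure D ((n:ℝ) + 2) ((fun w => Th E w (φ w)) '' B) < ⊤ := by
  have h1 := h.finite hn hE
  rw [← Measure.restrict_apply_univ, area_formula hn hE h]
  exact measure_lt_top _ _
end

section
lemma measurePreserving_hmul_hinv (x : Hpt n) :
    MeasurePreserving (fun y : Hpt n => hmul (hinv y) x) volume volume := by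
  have h2 : ∀ a : Fin n → ℝ, MeasurePreserving (fun q : (Fin n → ℝ) × ℝ =>
      ((x.2.1 - q.1, x.2.2 - q.2 + (∑ j, -a j * x.2.1 j) / 2 - (∑ j, x.1 j * -q.1 j) / 2) : (Fin n → ℝ) × ℝ))
      volume volume := by
    intro a
    refine MeasurePreserving.skew_product (μa := (volume : Measure (Fin n → ℝ)))
      (μc := (volume : Measure ℝ)) (μd := (volume : Measure ℝ))
      (f := fun b : Fin n → ℝ => x.2.1 - b) (Measure.measurePreserving_sub_left _ x.2.1)
      (g := fun b s => x.2.2 - s + (∑ j, -a j * x.2.1 j) / 2 - (∑ j, x.1 j * -b j) / 2) ?_ ?_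
    · have : Continuous (Function.uncurry fun (b : Fin n → ℝ) (s : ℝ) =>
          x.2.2 - s + (∑ j, -a j * x.2.1 j) / 2 - (∑ j, x.1 j * -b j) / 2) := by
        unfold Function.uncurry; fun_prop
      exact this.measurable
    · refine Eventually.of_forall fun b => ?_
      have h := (Measure.measurePreserving_sub_left (volume : Measure ℝ)
        (x.2.2 + (∑ j, -a j * x.2.1 j) / 2 - (∑ j, x.1 j * -b j) / 2)).map_eq
      convert h using 2
      ext s; ring
  have := MeasurePreserving.skew_product (μa := (volume : Measure (Fin n → ℝ)))
      (μc := (volume : Measure ((Fin n → ℝ) × ℝ))) (μd := (volume : Measure ((Fin n → ℝ) × ℝ)))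
      (f := fun b : Fin n → ℝ => x.1 - b) (Measure.measurePreserving_sub_left _ x.1)
      (g := fun a q => (x.2.1 - q.1, x.2.2 - q.2 + (∑ j, -a j * x.2.1 j) / 2 - (∑ j, x.1 j * -q.1 j) / 2))
      (by
        have : Continuous (Function.uncurry fun (a : Fin n → ℝ) (q : (Fin n → ℝ) × ℝ) =>
          ((x.2.1 - q.1, x.2.2 - q.2 + (∑ j, -a j * x.2.1 j) / 2 - (∑ j, x.1 j * -q.1 j) / 2) : (Fin n → ℝ) × ℝ)) := by
          unfold Function.uncurry; fun_prop
        exact this.measurable)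
      (Eventually.of_forall fun a => (h2 a).map_eq)
  have e1 : (fun y : Hpt n => hmul (hinv y) x) = fun p : (Fin n → ℝ) × (Fin n → ℝ) × ℝ => (x.1 - p.1,
      ((x.2.1 - p.2.1, x.2.2 - p.2.2 + (∑ j, -p.1 j * x.2.1 j) / 2 - (∑ j, x.1 j * -p.2.1 j) / 2) : (Fin n → ℝ) × ℝ)) := by
    funext q
    unfold hmul hinv
    refine Prod.ext ?_ (Prod.ext ?_ ?_)
    · simp [sub_eq_add_neg, add_comm]
    · simp [sub_eq_add_neg, add_comm]
    · simp [sub_eq_add_neg, add_comm]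
  rw [e1]
  exact this

lemma avg_le {ρ g : Hpt n → ℝ} {V : Set (Hpt n)} (hρ0 : ∀ y, 0 ≤ ρ y) (hρV : ∀ y ∉ V, ρ y = 0)
    (hρi : Integrable ρ) (hρ1 : ∫ y, ρ y = 1) {C : ℝ} (hg : ∀ y ∈ V, |g y| ≤ C) :
    |∫ y, ρ y * g y| ≤ C := by
  have h1 := norm_integral_le_of_norm_le (f := fun y => ρ y * g y) (g := fun y => ρ y * C) (μ := volume)
    (hρi.mul_const C) (Eventually.of_forall fun y => by
      by_cases hy : y ∈ V
      · rw [norm_mul, Real.norm_eq_abs, Real.norm_eq_abs, abs_of_nonneg (hρ0 y)]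
        exact mul_le_mul_of_nonneg_left (hg y hy) (hρ0 y)
      · simp [hρV y hy])
  rwa [integral_mul_const, hρ1, one_mul] at h1

lemma molli_contDiff {ρ f0 : Hpt n → ℝ} (hρ : ContDiff ℝ 1 ρ) (hρc : HasCompactSupport ρ)
    (hf0 : LocallyIntegrable f0) :
    ContDiff ℝ 1 (fun x => ∫ z, f0 z * ρ (hmul x (hinv z))) := by
  have hcd : ContDiff ℝ 1 (fun x : Hpt n × Hpt n => hmul x.1 x.2) := by
    unfold hmul; fun_prop
  rw [contDiff_iff_contDiffAt]
  intro x0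
  have hs : IsOpen (Metric.ball x0 1) := Metric.isOpen_ball
  set k : Set (Hpt n) := (fun q : Hpt n × Hpt n => hmul (hinv q.1) q.2) '' (Metric.closedBall x0 1 ×ˢ tsupport ρ) with hk
  have hkc : IsCompact k := by
    refine ((isCompact_closedBall x0 1).prod hρc).image ?_
    exact continuous_hmul.comp ((continuous_hinv.comp continuous_fst).prodMk continuous_snd)
  have key := contDiffOn_convolution_right_with_param_comp (𝕜 := ℝ) (n := 1) (ContinuousLinearMap.mul ℝ ℝ)
    (s := Metric.ball x0 1) (v := fun _ : Hpt n => (0 : Hpt n)) contDiffOn_const (f := f0)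
    (g := fun x u => ρ (hmul x u)) (μ := (volume : Measure (Hpt n))) (k := k) hs hkc (by
      intro x u hx hu
      by_contra hne
      refine hu ⟨(x, hmul x u), ⟨Metric.ball_subset_closedBall hx, subset_tsupport _ hne⟩, ?_⟩
      show hmul (hinv x) (hmul x u) = u
      rw [← hmul_assoc, hinv_hmul, zero_hmul]) hf0 (by
      exact (hρ.comp hcd).contDiffOn)
  have : ContDiffAt ℝ 1 _ x0 := key.contDiffAt (hs.mem_nhds (Metric.mem_ball_self one_pos))
  convert this using 1
  funext x
  simp only [convolution_def, ContinuousLinearMap.mul_apply']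
  congr 1; ext z
  congr 3
  unfold hinv
  rw [zero_sub]; rfl

theorem molli {U : Set (Hpt n)} (hU : IsOpen U) {f : Hpt n → ℝ} (hf : IsC1H U f) {Box : Set (Hpt n)}
    (hB : IsCompact Box) (hBU : Box ⊆ U) {e : ℝ} (he : 0 < e) :
    ∃ F : Hpt n → ℝ, ContDiff ℝ 1 F ∧ ∀ x ∈ Box, |F x - f x| ≤ e ∧ ∀ j, |gradH F x j - gradH f x j| ≤ e := by
  obtain ⟨K, hK, hBK, hKU⟩ := exists_compact_between hB hU hBU
  set f0 : Hpt n → ℝ := K.indicator f with hf0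
  have hfK : ContinuousOn f K := hf.contOn.mono hKU
  have hKm : MeasurableSet K := hK.measurableSet
  have hf0i : Integrable f0 := by
    rw [hf0, integrable_indicator_iff hKm]
    exact hfK.integrableOn_compact hK
  -- uniformity
  have hev : ∀ᶠ q : Hpt n × Hpt n in 𝓝 ((0, 0) : Hpt n × Hpt n), ∀ x ∈ Box,
      (hmul (hmul (hinv q.1) x) q.2 ∈ interior K ∧ |f (hmul (hmul (hinv q.1) x) q.2) - f x| ≤ e ∧
        ∀ j, |gradH f (hmul (hmul (hinv q.1) x) q.2) j - gradH f x j| ≤ e) := by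
    refine hB.eventually_forall_of_forall_eventually (P := fun (q : Hpt n × Hpt n) x =>
      (hmul (hmul (hinv q.1) x) q.2 ∈ interior K ∧ |f (hmul (hmul (hinv q.1) x) q.2) - f x| ≤ e ∧
        ∀ j, |gradH f (hmul (hmul (hinv q.1) x) q.2) j - gradH f x j| ≤ e)) ?_
    intro x0 hx0
    have hc : Continuous (fun z : (Hpt n × Hpt n) × Hpt n => hmul (hmul (hinv z.1.1) z.2) z.1.2) :=
      continuous_hmul.comp ((continuous_hmul.comp ((continuous_hinv.comp (continuous_fst.comp continuous_fst)).prodMk continuous_snd)).prodMk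
        (continuous_snd.comp continuous_fst))
    have h0 : hmul (hmul (hinv (0 : Hpt n)) x0) 0 = x0 := by
      have : hinv (0 : Hpt n) = 0 := by unfold hinv; simp
      rw [this, zero_hmul, hmul_zero]
    have ht : Tendsto (fun z : (Hpt n × Hpt n) × Hpt n => hmul (hmul (hinv z.1.1) z.2) z.1.2) (𝓝 ((0, 0), x0)) (𝓝 x0) := by
      have := hc.tendsto ((0, 0), x0)
      simpa only [h0] using this
    have ht2 : Tendsto (fun z : (Hpt n × Hpt n) × Hpt n => z.2) (𝓝 ((0, 0), x0)) (𝓝 x0) :=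
      continuous_snd.tendsto ((0, 0), x0)
    have hclose : ∀ g : Hpt n → ℝ, ContinuousOn g U →
        ∀ᶠ z : (Hpt n × Hpt n) × Hpt n in 𝓝 ((0, 0), x0), |g (hmul (hmul (hinv z.1.1) z.2) z.1.2) - g z.2| ≤ e := by
      intro g hg
      have hgc := hg.continuousAt (hU.mem_nhds (hBU hx0))
      have h1 := hgc.tendsto.comp ht
      have h2 := hgc.tendsto.comp ht2
      have h3 := (h1.sub h2).abs
      simp only [sub_self, abs_zero] at h3
      exact h3.eventually (ge_mem_nhds he)
    refine Filter.Eventually.and (ht.eventually (isOpen_interior.mem_nhds (hBK hx0))) ((hclose f hf.contOn).and ?_)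
    rw [eventually_all]
    exact fun j => hclose _ (hf.contGrad j)
  rw [Metric.eventually_nhds_iff] at hev
  obtain ⟨δ, hδ, hev⟩ := hev
  let b : ContDiffBump (0 : Hpt n) := ⟨δ / 2, δ, by positivity, by linarith⟩
  set ρ : Hpt n → ℝ := b.normed volume with hρ
  have hρs : ContDiff ℝ 1 ρ := b.contDiff_normed
  have hρc : HasCompactSupport ρ := b.hasCompactSupport_normed
  have hρ0 : ∀ y, 0 ≤ ρ y := b.nonneg_normed
  have hρ1 : ∫ y, ρ y = 1 := b.integral_normed
  have hρi : Integrable ρ := hρs.continuous.integrable_of_hasCompactSupport hρc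
  have hρV : ∀ y ∉ Metric.ball (0 : Hpt n) δ, ρ y = 0 := by
    intro y hy
    by_contra hne
    exact hy (by have := b.support_normed_eq (μ := volume); rw [← this]; exact hne)
  set F : Hpt n → ℝ := fun x => ∫ z, f0 z * ρ (hmul x (hinv z)) with hF
  have hFcd : ContDiff ℝ 1 F := molli_contDiff hρs hρc hf0i.locallyIntegrable
  have hTe : ∀ x : Hpt n, MeasurableEmbedding (fun y : Hpt n => hmul (hinv y) x) := by
    intro x
    refine Continuous.measurableEmbedding (continuous_hmul.comp (continuous_hinv.prodMk continuous_const)) ?_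
    intro y y' hyy
    have h1 : ∀ y, hmul x (hinv (hmul (hinv y) x)) = y := by
      intro y; rw [hinv_hmul_rev, ← hmul_assoc, hmul_hinv, zero_hmul, hinv_hinv]
    have h2 := congrArg (fun z => hmul x (hinv z)) hyy
    simpa only [h1] using h2
  have hFx : ∀ x, F x = ∫ y, ρ y * f0 (hmul (hinv y) x) := by
    intro x
    rw [hF]
    simp only
    rw [← (measurePreserving_hmul_hinv x).integral_comp (hTe x)]
    congr 1; ext y
    rw [hinv_hmul_rev, ← hmul_assoc, hmul_hinv, zero_hmul, hinv_hinv, mul_comm]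
  -- integrability
  obtain ⟨C, hC⟩ : ∃ C, ∀ z, ‖f0 z‖ ≤ C := by
    obtain ⟨C, hC⟩ := hK.exists_bound_of_continuousOn hfK
    refine ⟨max C 0, fun z => ?_⟩
    by_cases hz : z ∈ K
    · rw [hf0, indicator_of_mem hz]; exact (hC z hz).trans (le_max_left _ _)
    · rw [hf0, indicator_of_notMem hz]; simp
  have hinteg : ∀ x, Integrable (fun y => ρ y * f0 (hmul (hinv y) x)) := by
    intro x
    have := hρi.bdd_mul (f := fun y => f0 (hmul (hinv y) x)) (c := C) ?_ (Eventually.of_forall fun y => hC _)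
    · simpa only [mul_comm] using this
    · exact hf0i.aestronglyMeasurable.comp_quasiMeasurePreserving (measurePreserving_hmul_hinv x).quasiMeasurePreserving
  have hKf : ∀ z ∈ interior K, f0 z = f z := fun z hz => by rw [hf0, indicator_of_mem (interior_subset hz)]
  refine ⟨F, hFcd, fun x hx => ⟨?_, fun j => ?_⟩⟩
  · have h1 : F x - f x = ∫ y, ρ y * (f0 (hmul (hinv y) x) - f x) := by
      simp only [mul_sub]
      rw [integral_sub (hinteg x) (hρi.mul_const _), integral_mul_const, hρ1, one_mul, hFx]
    rw [h1]
    refine avg_le hρ0 hρV hρi hρ1 fun y hy => ?_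
    have h2 := hev (y := (y, 0)) (by rw [Prod.dist_eq]; simpa using hy) x hx
    simp only [hmul_zero] at h2
    rw [hKf _ h2.1]; exact h2.2.1
  · have hemb : Tendsto (fun s : ℝ => (emb (s • bz j) 0 : Hpt n)) (𝓝 0) (𝓝 0) := by
      have : Continuous (fun s : ℝ => (emb (s • bz j) 0 : Hpt n)) := by unfold emb; fun_prop
      have := this.tendsto 0
      simp only [zero_smul] at this
      exact this
    have hsm := hemb.eventually (Metric.ball_mem_nhds (0 : Hpt n) hδ)
    obtain ⟨s0, hs0, hsm⟩ := Metric.eventually_nhds_iff.1 hsm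
    -- mean value
    have hmv : ∀ y ∈ Metric.ball (0 : Hpt n) δ, ∀ s : ℝ, |s| < s0 →
        |f0 (hmul (hinv y) (hmul x (emb (s • bz j) 0))) - f0 (hmul (hinv y) x) - s * gradH f x j| ≤ e * |s| := by
      intro y hy s hs
      have hP : ∀ σ : ℝ, |σ| < s0 → _ := fun σ hσ => hev (y := (y, emb (σ • bz j) 0)) (by
        rw [Prod.dist_eq]
        refine max_lt (by simpa using hy) ?_
        exact hsm (by simpa using hσ)) x hx
      set g : ℝ → ℝ := fun σ => f (hmul (hmul (hinv y) x) (emb (σ • bz j) 0)) - σ * gradH f x j with hg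
      have hd : ∀ σ ∈ Metric.ball (0:ℝ) s0, HasDerivWithinAt g (gradH f (hmul (hmul (hinv y) x) (emb (σ • bz j) 0)) j - gradH f x j) (Metric.ball (0:ℝ) s0) σ := by
        intro σ hσ
        have h1 := hasDerivAt_frame (f := f) (p := hmul (hinv y) x) (j := j) σ
          (hf.ldiff _ (hKU (interior_subset (hP σ (by simpa using hσ)).1)) j)
        have h2 := h1.sub ((hasDerivAt_id σ).mul_const (gradH f x j))
        simp only [one_mul] at h2
        exact h2.hasDerivWithinAt
      have := (convex_ball (0:ℝ) s0).norm_image_sub_le_of_norm_hasDerivWithin_le (C := e) (x := 0) (y := s) hd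
        (fun σ hσ => (hP σ (by simpa using hσ)).2.2 j) (by simpa using hs0) (by simpa using hs)
      have e0 : (emb ((0:ℝ) • bz j) 0 : Hpt n) = 0 := by rw [zero_smul]; rfl
      have hz0 := (hP 0 (by simpa using hs0)).1
      simp only [e0, hmul_zero] at hz0
      rw [← hmul_assoc, hKf _ (hP s hs).1, hKf _ hz0]
      simp only [hg, e0, hmul_zero, zero_mul, sub_zero, Real.norm_eq_abs] at this
      convert this using 2; ring
    have hdiff : ∀ s : ℝ, |s| < s0 → |F (hmul x (emb (s • bz j) 0)) - F x - s * gradH f x j| ≤ e * |s| := by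
      intro s hs
      have h1 : F (hmul x (emb (s • bz j) 0)) - F x - s * gradH f x j =
          ∫ y, ρ y * (f0 (hmul (hinv y) (hmul x (emb (s • bz j) 0))) - f0 (hmul (hinv y) x) - s * gradH f x j) := by
        simp only [mul_sub]
        rw [integral_sub (f := fun y => ρ y * f0 (hmul (hinv y) (hmul x (emb (s • bz j) 0))) - ρ y * f0 (hmul (hinv y) x)) ((hinteg _).sub (hinteg x)) (hρi.mul_const _), integral_sub (hinteg _) (hinteg x), integral_mul_const, hρ1, one_mul, hFx, hFx]
      rw [h1]
      exact avg_le hρ0 hρV hρi hρ1 fun y hy => hmv y hy s hs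
    have hFl : HasDerivAt (fun s : ℝ => F (x + s • frameVec (hIdx j) x)) (gradH F x j) 0 := by
      have := ((hFcd.differentiable one_ne_zero).differentiableAt (x := x)).lineDifferentiableAt (v := frameVec (hIdx j) x)
      exact this.hasLineDerivAt
    have hsl := hFl.tendsto_slope_zero
    have hsl2 := (hsl.sub_const (gradH f x j)).abs
    refine le_of_tendsto hsl2 ?_
    have hev2 : ∀ᶠ s : ℝ in 𝓝[≠] 0, |s| < s0 :=
      nhdsWithin_le_nhds (by
        have : Metric.ball (0:ℝ) s0 ∈ 𝓝 (0:ℝ) := Metric.ball_mem_nhds _ hs0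
        filter_upwards [this] with s hs
        simpa using hs)
    filter_upwards [hev2, self_mem_nhdsWithin] with s hs hs1
    have hs1 : s ≠ 0 := hs1
    have := hdiff s hs
    rw [frame_line] at this
    simp only [zero_add, zero_smul, add_zero, smul_eq_mul]
    have e1 : s⁻¹ * (F (x + s • frameVec (hIdx j) x) - F x) - gradH f x j
        = s⁻¹ * (F (x + s • frameVec (hIdx j) x) - F x - s * gradH f x j) := by
      field_simp
    rw [e1, abs_mul, abs_inv]
    calc _ ≤ |s|⁻¹ * (e * |s|) := by gcongr
      _ = e := by have := abs_ne_zero.2 hs1; field_simp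
end

section
lemma continuous_frameVec (j : Fin (2*n)) : Continuous (fun x : Hpt n => frameVec (hIdx j) x) := by
  have : (fun x : Hpt n => frameVec (hIdx j) x) = fun x => hmul x (emb ((1:ℝ) • bz j) 0) - x := by
    funext x; rw [frame_line]; simp
  rw [this]
  exact (continuous_hmul.comp (continuous_id.prodMk continuous_const)).sub continuous_id

lemma gradH_eq_fderiv {f : Hpt n → ℝ} {x : Hpt n} (hf : DifferentiableAt ℝ f x) (j : Fin (2*n)) :
    gradH f x j = fderiv ℝ f x (frameVec (hIdx j) x) := hf.lineDeriv_eq_fderiv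

lemma isC1H_of_contDiffOn {f : Hpt n → ℝ} {V : Set (Hpt n)} (hV : IsOpen V) (hf : ContDiffOn ℝ 1 f V) :
    IsC1H V f := by
  have hd : ∀ p ∈ V, DifferentiableAt ℝ f p := fun p hp =>
    (hf.contDiffAt (hV.mem_nhds hp)).differentiableAt one_ne_zero
  refine ⟨hf.continuousOn, fun p hp j => (hd p hp).lineDifferentiableAt, fun j => ?_⟩
  have h1 : ContinuousOn (fun p => fderiv ℝ f p (frameVec (hIdx j) p)) V :=
    (hf.continuousOn_fderiv_of_isOpen hV le_rfl).clm_apply (continuous_frameVec j).continuousOn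
  exact h1.congr fun p hp => gradH_eq_fderiv (hd p hp) j

def beta (k : ℕ) (g : ℝ) : ℝ := Real.smoothTransition (((k:ℝ) + 1) * (k + 2) * (g - 1 / ((k:ℝ) + 2)))

lemma beta_zero {k : ℕ} {g : ℝ} (h : g ≤ 1 / ((k:ℝ) + 2)) : beta k g = 0 :=
  Real.smoothTransition.zero_of_nonpos
    (mul_nonpos_of_nonneg_of_nonpos (by positivity) (by linarith))

lemma beta_one {k : ℕ} {g : ℝ} (h : 1 / ((k:ℝ) + 1) ≤ g) : beta k g = 1 := by
  refine Real.smoothTransition.one_of_one_le ?_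
  have h1 : ((k:ℝ) + 1) * (k + 2) * (1 / ((k:ℝ) + 1) - 1 / ((k:ℝ) + 2)) = 1 := by field_simp; ring
  exact h1.symm.le.trans (mul_le_mul_of_nonneg_left (by linarith) (by positivity))

def psi (k : ℕ) (g : ℝ) : ℝ := if k = 0 then beta 0 g else beta k g - beta (k - 1) g

lemma contDiff_beta (k : ℕ) : ContDiff ℝ 1 (beta k) := by
  unfold beta
  exact Real.smoothTransition.contDiff.comp (by fun_prop)

lemma contDiff_psi (k : ℕ) : ContDiff ℝ 1 (psi k) := by
  unfold psi
  by_cases h : k = 0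
  · simp only [h, if_true]; exact contDiff_beta 0
  · simp only [h, if_false]; exact (contDiff_beta k).sub (contDiff_beta _)

lemma sum_psi (N : ℕ) (g : ℝ) : ∑ k ∈ Finset.range (N + 1), psi k g = beta N g := by
  induction N with
  | zero => simp [psi]
  | succ N ih => rw [Finset.sum_range_succ, ih]; simp [psi]

lemma abs_psi_le (k : ℕ) (g : ℝ) : |psi k g| ≤ 1 := by
  have h0 : ∀ k, 0 ≤ beta k g := fun k => Real.smoothTransition.nonneg _
  have h1 : ∀ k, beta k g ≤ 1 := fun k => Real.smoothTransition.le_one _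
  unfold psi
  split_ifs
  · rw [abs_of_nonneg (h0 0)]; exact h1 0
  · rw [abs_le]; constructor <;> linarith [h0 k, h1 k, h0 (k - 1), h1 (k - 1)]

lemma psi_zero_low {k : ℕ} {g : ℝ} (h : g ≤ 1 / ((k:ℝ) + 2)) : psi k g = 0 := by
  unfold psi
  split_ifs with hk
  · subst hk; exact beta_zero h
  · obtain ⟨m, rfl⟩ := Nat.exists_eq_succ_of_ne_zero hk
    rw [beta_zero h, Nat.succ_sub_one, beta_zero, sub_zero]
    refine h.trans ?_
    push_cast
    gcongr; linarith

lemma psi_zero_high {k N : ℕ} {g : ℝ} (hk : N < k) (h : 1 / ((N:ℝ) + 1) ≤ g) : psi k g = 0 := by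
  obtain ⟨m, rfl⟩ := Nat.exists_eq_succ_of_ne_zero (by omega : k ≠ 0)
  unfold psi
  rw [if_neg (by omega), Nat.succ_sub_one, beta_one, beta_one, sub_self]
  · refine le_trans ?_ h
    have : (N:ℝ) ≤ m := by exact_mod_cast Nat.lt_succ_iff.1 hk
    gcongr
  · refine le_trans ?_ h
    have : (N:ℝ) ≤ (m.succ : ℕ) := by exact_mod_cast hk.le
    gcongr

theorem glue {U : Set (Hpt n)} (hU : IsOpen U) {f : Hpt n → ℝ} (hf : IsC1H U f) {Box : Set (Hpt n)}
    (hB : IsCompact Box) (hBU : Box ⊆ U) {G : Hpt n → ℝ} (hG : ContDiff ℝ 1 G) {η : ℝ} (hη : 0 < η) :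
    ∃ F : Hpt n → ℝ, ContDiffOn ℝ 1 F {x | 0 < G x} ∧ ∀ x ∈ Box, 0 < G x →
      |F x - f x| ≤ η * G x ∧ ∀ j, |gradH F x j - gradH f x j| ≤ η := by
  have hψ : ∀ k, ContDiff ℝ 1 (fun x : Hpt n => psi k (G x)) := fun k => (contDiff_psi k).comp hG
  have hM : ∀ k : ℕ, ∃ M : ℝ, 0 ≤ M ∧ ∀ x ∈ Box, ∀ j, |gradH (fun x : Hpt n => psi k (G x)) x j| ≤ M := by
    intro k
    have h1 : ∀ j, ∃ M, ∀ x ∈ Box, ‖gradH (fun x : Hpt n => psi k (G x)) x j‖ ≤ M := fun j =>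
      hB.exists_bound_of_continuousOn
        (((isC1H_of_contDiffOn isOpen_univ (hψ k).contDiffOn).contGrad j).mono (subset_univ _))
    choose M hM using h1
    refine ⟨∑ j, |M j|, Finset.sum_nonneg fun j _ => abs_nonneg _, fun x hx j => ?_⟩
    exact (hM j x hx).trans ((le_abs_self _).trans
      (Finset.single_le_sum (f := fun j => |M j|) (fun j _ => abs_nonneg _) (Finset.mem_univ j)))
  choose M hM0 hM using hM
  set e : ℕ → ℝ := fun k => (1/2) ^ (k + 2) * η / ((k + 2) * (1 + M k)) with he
  have he0 : ∀ k, 0 < e k := fun k => by have := hM0 k; positivity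
  have hmol := fun k => molli hU hf hB hBU (he0 k)
  choose F hFc hF using hmol
  set Fη : Hpt n → ℝ := fun x => ∑ᶠ k, psi k (G x) * F k x with hFη
  have hloc : ∀ (N : ℕ) (x : Hpt n), 1 / ((N:ℝ) + 1) < G x →
      Fη x = ∑ k ∈ Finset.range (N + 1), psi k (G x) * F k x := by
    intro N x hx
    refine finsum_eq_sum_of_support_subset _ fun k hk => ?_
    by_contra hk2
    refine hk ?_
    simp only [Finset.coe_range, mem_Iio, not_lt] at hk2
    show psi k (G x) * F k x = 0
    rw [psi_zero_high (by omega) hx.le, zero_mul]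
  have hopen : ∀ N : ℕ, IsOpen {x | 1 / ((N:ℝ) + 1) < G x} := fun N => isOpen_lt continuous_const hG.continuous
  have hex : ∀ x, 0 < G x → ∃ N : ℕ, 1 / ((N:ℝ) + 1) < G x := fun x hx => exists_nat_one_div_lt hx
  have hevq : ∀ (N : ℕ) (x : Hpt n), 1 / ((N:ℝ) + 1) < G x →
      Fη =ᶠ[𝓝 x] fun x => ∑ k ∈ Finset.range (N + 1), psi k (G x) * F k x := by
    intro N x hx
    filter_upwards [(hopen N).mem_nhds hx] with y hy
    exact hloc N y hy
  have hterm : ∀ k, ContDiff ℝ 1 (fun x => psi k (G x) * F k x) := fun k => (hψ k).mul (hFc k)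
  have hgeo : ∀ N : ℕ, ∑ k ∈ Finset.range (N + 1), (1/2 : ℝ) ^ (k + 2) * η ≤ η := by
    intro N
    rw [← Finset.sum_mul]
    have h1 : ∑ k ∈ Finset.range (N + 1), (1/2 : ℝ) ^ (k + 2) ≤ 1 := by
      have h2 : ∀ N : ℕ, ∑ k ∈ Finset.range N, (1/2 : ℝ) ^ (k + 2) = 1/2 - (1/2) ^ (N + 1) := by
        intro N
        induction N with
        | zero => norm_num
        | succ N ih => rw [Finset.sum_range_succ, ih]; ring
      rw [h2]
      have : (0:ℝ) ≤ (1/2) ^ (N + 1 + 1) := by positivity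
      linarith
    nlinarith
  refine ⟨Fη, ?_, ?_⟩
  · intro x hx
    obtain ⟨N, hN⟩ := hex x hx
    refine ContDiffAt.contDiffWithinAt (ContDiffAt.congr_of_eventuallyEq ?_ (hevq N x hN))
    exact (ContDiff.sum fun k _ => hterm k).contDiffAt
  · intro x hx hGx
    obtain ⟨N, hN⟩ := hex x hGx
    have hs1 : ∑ k ∈ Finset.range (N + 1), psi k (G x) = 1 := by rw [sum_psi, beta_one hN.le]
    constructor
    · have h1 : Fη x - f x = ∑ k ∈ Finset.range (N + 1), psi k (G x) * (F k x - f x) := by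
        rw [hloc N x hN]
        simp only [mul_sub, Finset.sum_sub_distrib, ← Finset.sum_mul, hs1, one_mul]
      rw [h1]
      refine (Finset.abs_sum_le_sum_abs _ _).trans ?_
      calc _ ≤ ∑ k ∈ Finset.range (N + 1), (1/2 : ℝ) ^ (k + 2) * η * G x := by
            refine Finset.sum_le_sum fun k _ => ?_
            by_cases hk : G x ≤ 1 / ((k:ℝ) + 2)
            · rw [psi_zero_low hk, zero_mul, abs_zero]; positivity
            · push Not at hk
              rw [abs_mul]
              have h2 : e k ≤ (1/2 : ℝ) ^ (k + 2) * η * (1 / ((k:ℝ) + 2)) := by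
                rw [he]
                have hk0 := hM0 k
                simp only
                rw [mul_one_div]
                gcongr
                nlinarith
              calc _ ≤ 1 * e k := mul_le_mul (abs_psi_le _ _) (hF k x hx).1 (abs_nonneg _) zero_le_one
                _ ≤ (1/2 : ℝ) ^ (k + 2) * η * (1 / ((k:ℝ) + 2)) := by rw [one_mul]; exact h2
                _ ≤ _ := by gcongr
        _ ≤ η * G x := by rw [← Finset.sum_mul]; exact mul_le_mul_of_nonneg_right (hgeo N) hGx.le
    · intro j
      have hdψ : ∀ k, DifferentiableAt ℝ (fun x : Hpt n => psi k (G x)) x := fun k => (hψ k).differentiable one_ne_zero x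
      have hdF : ∀ k, DifferentiableAt ℝ (F k) x := fun k => (hFc k).differentiable one_ne_zero x
      have hg : gradH Fη x j = ∑ k ∈ Finset.range (N + 1), (psi k (G x) * gradH (F k) x j + F k x * gradH (fun x : Hpt n => psi k (G x)) x j) := by
        have hd : DifferentiableAt ℝ (fun x => ∑ k ∈ Finset.range (N + 1), psi k (G x) * F k x) x :=
          (ContDiff.sum fun k _ => hterm k).differentiable one_ne_zero x
        rw [gradH_eq_fderiv (hd.congr_of_eventuallyEq (hevq N x hN)), (hevq N x hN).fderiv_eq,
          fderiv_fun_sum (A := fun k x => psi k (G x) * F k x) fun k _ => (hdψ k).mul (hdF k)]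
        rw [_root_.sum_apply]
        refine Finset.sum_congr rfl fun k _ => ?_
        rw [fderiv_fun_mul (hdψ k) (hdF k), gradH_eq_fderiv (hdF k), gradH_eq_fderiv (hdψ k)]
        simp
      have hz : ∑ k ∈ Finset.range (N + 1), gradH (fun x : Hpt n => psi k (G x)) x j = 0 := by
        have h1 : (fun x => ∑ k ∈ Finset.range (N + 1), psi k (G x)) =ᶠ[𝓝 x] fun _ => (1:ℝ) := by
          filter_upwards [(hopen N).mem_nhds hN] with y hy
          have hy : 1 / ((N:ℝ) + 1) < G y := hy
          rw [sum_psi, beta_one hy.le]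
        have h2 := h1.fderiv_eq (𝕜 := ℝ)
        rw [fderiv_fun_sum fun k _ => hdψ k, fderiv_fun_const] at h2
        have h3 := congrArg (fun L => L (frameVec (hIdx j) x)) h2
        simp only [_root_.sum_apply, Pi.zero_apply, _root_.zero_apply] at h3
        rw [← h3]
        exact Finset.sum_congr rfl fun k _ => gradH_eq_fderiv (hdψ k) j
      have h1 : gradH Fη x j - gradH f x j = ∑ k ∈ Finset.range (N + 1),
          (psi k (G x) * (gradH (F k) x j - gradH f x j) + (F k x - f x) * gradH (fun x : Hpt n => psi k (G x)) x j) := by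
        rw [hg]
        simp only [mul_sub, sub_mul, Finset.sum_add_distrib, Finset.sum_sub_distrib, ← Finset.sum_mul, ← Finset.mul_sum, hs1, hz]
        ring
      rw [h1]
      refine (Finset.abs_sum_le_sum_abs _ _).trans (le_trans (Finset.sum_le_sum fun k _ => ?_) (hgeo N))
      have hk0 := hM0 k
      calc _ ≤ 1 * e k + e k * M k := by
            refine (abs_add_le _ _).trans ?_
            rw [abs_mul, abs_mul]
            exact add_le_add (mul_le_mul (abs_psi_le _ _) ((hF k x hx).2 j) (abs_nonneg _) zero_le_one)
              (mul_le_mul (hF k x hx).1 (hM k x hx j) (abs_nonneg _) (he0 k).le)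
        _ = (1/2 : ℝ) ^ (k + 2) * η / (k + 2) := by rw [he]; simp only; field_simp
        _ ≤ _ := by
          refine div_le_self (by positivity) ?_
          have : (0:ℝ) ≤ k := by positivity
          linarith
end

section
lemma simpleWedge_mul {m : ℕ} (M : Matrix (Fin m) (Fin m) ℝ) (y v : Fin m → (Fin (2*n+1) → ℝ))
    (h : ∀ i, y i = ∑ j, M i j • v j) : simpleWedge y = M.det • simpleWedge v := by
  funext s
  simp only [simpleWedge, Pi.smul_apply, smul_eq_mul]
  rw [← Matrix.det_mul]
  congr 1
  ext i j
  simp [Matrix.mul_apply, h i, Finset.sum_apply]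

/-- The Gram determinant. -/
def gram {m : ℕ} (y : Fin m → (Fin (2*n+1) → ℝ)) : ℝ := Matrix.det (Matrix.of fun i j => dotC (y i) (y j))

def tau {m : ℕ} (y : Fin m → (Fin (2*n+1) → ℝ)) : MVec n m := (Real.sqrt (gram y))⁻¹ • simpleWedge y

lemma gram_pos {m : ℕ} {y : Fin m → (Fin (2*n+1) → ℝ)} (hy : LinearIndependent ℝ y) : 0 < gram y := by
  have h1 : (Matrix.of fun i j => dotC (y i) (y j)) = (Matrix.of y) * (Matrix.of y).conjTranspose := by
    ext i j; simp [Matrix.mul_apply, dotC]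
  unfold gram
  rw [h1]
  refine (Matrix.PosDef.mul_conjTranspose_self (Matrix.of y) ?_).det_pos
  exact Matrix.vecMul_injective_iff.2 hy

lemma dotC_comm (a b : Fin (2*n+1) → ℝ) : dotC a b = dotC b a := by
  simp [dotC, mul_comm]
lemma dotC_sum_left {m : ℕ} (c : Fin m → ℝ) (v : Fin m → (Fin (2*n+1) → ℝ)) (b : Fin (2*n+1) → ℝ) :
    dotC (∑ j, c j • v j) b = ∑ j, c j * dotC (v j) b := by
  simp only [dotC, Finset.sum_apply, Pi.smul_apply, smul_eq_mul, Finset.sum_mul, Finset.mul_sum]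
  rw [Finset.sum_comm]
  simp [mul_assoc]

lemma li_of_orthonormal {m : ℕ} {v : Fin m → (Fin (2*n+1) → ℝ)}
    (hv : ∀ i j, dotC (v i) (v j) = if i = j then 1 else 0) : LinearIndependent ℝ v := by
  rw [Fintype.linearIndependent_iff]
  intro g hg i
  have := dotC_sum_left g v (v i)
  rw [hg] at this
  simp [hv] at this
  rw [← this]; simp [dotC]

lemma mem_span_of_orth {k m : ℕ} (hkm : k + m = 2*n+1) {g : Fin k → (Fin (2*n+1) → ℝ)}
    {y : Fin m → (Fin (2*n+1) → ℝ)} (hg : LinearIndependent ℝ g) (hy : LinearIndependent ℝ y)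
    (hyg : ∀ i l, dotC (y i) (g l) = 0) {x : Fin (2*n+1) → ℝ} (hx : ∀ l, dotC x (g l) = 0) :
    x ∈ Submodule.span ℝ (Set.range y) := by
  set G := (Matrix.of g).mulVecLin with hG
  have hker : ∀ z, z ∈ LinearMap.ker G ↔ ∀ l, dotC z (g l) = 0 := by
    intro z
    rw [LinearMap.mem_ker, hG, Matrix.mulVecLin_apply, funext_iff]
    refine forall_congr' fun l => ?_
    simp [Matrix.mulVec, dotProduct, dotC, mul_comm]
  have hle : Submodule.span ℝ (Set.range y) ≤ LinearMap.ker G := by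
    rw [Submodule.span_le]
    rintro _ ⟨i, rfl⟩
    exact (hker _).2 (hyg i)
  have h1 := LinearMap.finrank_range_add_finrank_ker G
  have h2 : Module.finrank ℝ (LinearMap.range G) = k := by
    have := LinearIndependent.rank_matrix (M := Matrix.of g) hg
    simpa [Matrix.rank] using this
  have h3 : Module.finrank ℝ (Submodule.span ℝ (Set.range y)) = m := by
    simpa using finrank_span_eq_card hy
  have h4 : Submodule.span ℝ (Set.range y) = LinearMap.ker G := by
    apply Submodule.eq_of_le_of_finrank_eq hle
    simp at h1
    omega
  rw [h4]; exact (hker _).2 hx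

lemma orient_pm {k m : ℕ} (hkm : k + m = 2*n+1) {g : Fin k → (Fin (2*n+1) → ℝ)}
    {y v : Fin m → (Fin (2*n+1) → ℝ)} (hg : LinearIndependent ℝ g) (hy : LinearIndependent ℝ y)
    (hyg : ∀ i l, dotC (y i) (g l) = 0) (hvg : ∀ i l, dotC (v i) (g l) = 0)
    (hv : ∀ i j, dotC (v i) (v j) = if i = j then 1 else 0) :
    tau y = simpleWedge v ∨ tau y = - simpleWedge v := by
  have hvl := li_of_orthonormal hv
  have h1 : ∀ i, ∃ c : Fin m → ℝ, ∑ j, c j • v j = y i := fun i =>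
    (Submodule.mem_span_range_iff_exists_fun ℝ).1 (mem_span_of_orth hkm hg hvl hvg (hyg i))
  choose M hM using h1
  have h2 := simpleWedge_mul (Matrix.of M) y v (fun i => (hM i).symm)
  have h3 : gram y = (Matrix.of M).det ^ 2 := by
    have : (Matrix.of fun i j => dotC (y i) (y j)) = (Matrix.of M) * (Matrix.of M).transpose := by
      ext i j
      rw [Matrix.of_apply, ← hM i, ← hM j, dotC_sum_left]
      simp only [Matrix.mul_apply, Matrix.transpose_apply, Matrix.of_apply]
      refine Finset.sum_congr rfl fun l _ => ?_
      rw [dotC_comm, dotC_sum_left]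
      simp [hv]
    unfold gram
    rw [this, Matrix.det_mul, Matrix.det_transpose, sq]
  have h4 := gram_pos hy
  have h5 : (Matrix.of M).det ≠ 0 := by
    intro h; rw [h3, h] at h4; simp at h4
  unfold tau
  rw [h2, h3, Real.sqrt_sq_eq_abs, smul_smul]
  rcases lt_or_gt_of_ne h5 with h | h
  · right
    rw [abs_of_neg h, inv_neg, neg_mul, inv_mul_cancel₀ h5, neg_one_smul]
  · left
    rw [abs_of_pos h, inv_mul_cancel₀ h5, one_smul]

lemma exists_orthonormal {k m : ℕ} (hkm : k + m = 2*n+1) {g : Fin k → (Fin (2*n+1) → ℝ)}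
    (hg : LinearIndependent ℝ g) : ∃ v : Fin m → (Fin (2*n+1) → ℝ),
    (∀ i j, dotC (v i) (v j) = if i = j then 1 else 0) ∧ ∀ i l, dotC (v i) (g l) = 0 := by
  set G := (Matrix.of g).mulVecLin ∘ₗ (WithLp.linearEquiv 2 ℝ (Fin (2*n+1) → ℝ)).toLinearMap with hG
  have h1 := LinearMap.finrank_range_add_finrank_ker G
  have h2 : Module.finrank ℝ (LinearMap.range G) = k := by
    have := LinearIndependent.rank_matrix (M := Matrix.of g) hg
    rw [hG, LinearEquiv.range_comp]
    simpa [Matrix.rank] using this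
  have h3 : Module.finrank ℝ (LinearMap.ker G) = m := by
    have : Module.finrank ℝ (WithLp 2 (Fin (2*n+1) → ℝ)) = 2*n+1 := by
      rw [(WithLp.linearEquiv 2 ℝ (Fin (2*n+1) → ℝ)).finrank_eq]; simp
    omega
  let b : OrthonormalBasis (Fin m) ℝ (LinearMap.ker G : Submodule ℝ (EuclideanSpace ℝ (Fin (2*n+1)))) :=
    (stdOrthonormalBasis ℝ _).reindex (finCongr h3)
  refine ⟨fun i j => (b i : EuclideanSpace ℝ (Fin (2*n+1))) j, fun i j => ?_, fun i l => ?_⟩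
  · have := b.orthonormal
    rw [orthonormal_iff_ite] at this
    rw [← this i j, Submodule.coe_inner, PiLp.inner_apply]
    unfold dotC
    refine Finset.sum_congr rfl fun l _ => ?_
    rw [mul_comm]; rfl
  · have h := (b i).2
    rw [LinearMap.mem_ker] at h
    have h' := congrFun h l
    simp only [hG, LinearMap.comp_apply, Matrix.mulVecLin_apply, Matrix.mulVec, dotProduct] at h'
    simp only [dotC]
    refine Eq.trans ?_ h'
    refine Finset.sum_congr rfl fun j _ => ?_
    rw [mul_comm]; rfl

lemma orient_exists {k m : ℕ} (hkm : k + m = 2*n+1) (hm : 0 < m) {g : Fin k → (Fin (2*n+1) → ℝ)}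
    {y : Fin m → (Fin (2*n+1) → ℝ)} (hg : LinearIndependent ℝ g) (hy : LinearIndependent ℝ y)
    (hyg : ∀ i l, dotC (y i) (g l) = 0) {s : ℝ} (hs : s = 1 ∨ s = -1) :
    ∃ v : Fin m → (Fin (2*n+1) → ℝ),
    (∀ i j, dotC (v i) (v j) = if i = j then 1 else 0) ∧ (∀ i l, dotC (v i) (g l) = 0) ∧
    s • tau y = simpleWedge v := by
  obtain ⟨v, hv, hvg⟩ := exists_orthonormal hkm hg
  have key : ∀ c : ℝ, c = 1 ∨ c = -1 → ∃ v' : Fin m → (Fin (2*n+1) → ℝ),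
    (∀ i j, dotC (v' i) (v' j) = if i = j then 1 else 0) ∧ (∀ i l, dotC (v' i) (g l) = 0) ∧
    c • simpleWedge v = simpleWedge v' := by
    intro c hc
    let i0 : Fin m := ⟨0, hm⟩
    let e : Fin m → ℝ := fun i => if i = i0 then c else 1
    have he : ∀ i, e i * e i = 1 := by
      intro i; simp only [e]; rcases hc with rfl | rfl <;> split_ifs <;> norm_num
    have hdot : ∀ (a : ℝ) (x z : Fin (2*n+1) → ℝ), dotC (a • x) z = a * dotC x z := by
      intro a x z; simp [dotC, Finset.mul_sum, mul_assoc]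
    refine ⟨fun i => e i • v i, fun i j => ?_, fun i l => ?_, ?_⟩
    · rw [hdot, dotC_comm, hdot, hv]
      by_cases h : i = j
      · subst h; simp [he]
      · simp [h, Ne.symm h]
    · rw [hdot, hvg, mul_zero]
    · rw [simpleWedge_mul (Matrix.diagonal e) (fun i => e i • v i) v, Matrix.det_diagonal]
      · simp [e]
      · intro i; simp [Matrix.diagonal_apply]
  rcases orient_pm hkm hg hy hyg hvg hv with h | h
  · obtain ⟨v', h1, h2, h3⟩ := key s hs
    exact ⟨v', h1, h2, by rw [h, h3]⟩
  · obtain ⟨v', h1, h2, h3⟩ := key (-s) (by rcases hs with rfl | rfl <;> simp)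
    exact ⟨v', h1, h2, by rw [h, ← h3]; simp⟩

lemma tau_ne_zero {m : ℕ} {y : Fin m → (Fin (2*n+1) → ℝ)} (hy : LinearIndependent ℝ y) : tau y ≠ 0 := by
  have hsq : (Real.sqrt (gram y))⁻¹ ≠ 0 := inv_ne_zero (Real.sqrt_pos.2 (gram_pos hy)).ne'
  unfold tau
  refine smul_ne_zero hsq ?_
  obtain ⟨κ, a, ha, hspan, hli⟩ := exists_linearIndependent' ℝ (Matrix.of y).col
  have htop : Submodule.span ℝ (Set.range (Matrix.of y).col) = ⊤ := by
    have h1 := LinearIndependent.rank_matrix (M := Matrix.of y) hy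
    rw [Matrix.rank_eq_finrank_span_cols] at h1
    apply Submodule.eq_top_of_finrank_eq
    simpa using h1
  rw [htop] at hspan
  have := Finite.of_injective a ha
  have := Fintype.ofFinite κ
  have hcard : Fintype.card κ = m := by
    have := finrank_span_eq_card hli
    rw [hspan] at this
    simpa using this.symm
  let b : κ ↪ Fin (2*n+1) := ⟨a, ha⟩
  let s : IdxSet n m := ⟨Finset.univ.map b, by simp [hcard]⟩
  have hmem : ∀ i : Fin m, ∃ c : κ, a c = idxTuple s i := by
    intro i
    have h0 : idxTuple s i ∈ Finset.univ.map b := ((s.1.orderIsoOfFin s.2) i).2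
    obtain ⟨c, -, hc⟩ := Finset.mem_map.1 h0
    exact ⟨c, hc⟩
  choose σ hσ using hmem
  have hσi : Function.Injective σ := by
    intro i j hij
    have : idxTuple s i = idxTuple s j := by rw [← hσ, ← hσ, hij]
    exact (s.1.orderIsoOfFin s.2).injective (Subtype.ext this)
  have hli2 := hli.comp σ hσi
  intro h0
  have h1 := congrFun h0 s
  simp only [simpleWedge, Pi.zero_apply] at h1
  have h2 : LinearIndependent ℝ (Matrix.of fun i j => y i (idxTuple s j)).col := by
    have heq : (Matrix.of fun i j => y i (idxTuple s j)).col = ((Matrix.of y).col ∘ a) ∘ σ := by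
      funext j i
      show y i (idxTuple s j) = y i (a (σ j))
      rw [hσ]
    rw [heq]; exact hli2
  rw [Matrix.linearIndependent_cols_iff_isUnit, Matrix.isUnit_iff_isUnit_det, h1] at h2
  simp at h2

/-! ### tangent frames of graphs -/

lemma finrank_Ww (n : ℕ) : Module.finrank ℝ (Ww n) = 2*n+1-n := by
  simp; omega

def wbasis (n : ℕ) : Module.Basis (Fin (2*n+1-n)) ℝ (Ww n) := Module.finBasisOfFinrankEq ℝ (Ww n) (finrank_Ww n)

def yv (E : Hz n ≃L[ℝ] Hz n) (A : (Fin n → ℝ) →L[ℝ] (Fin n → ℝ)) (i : Fin (2*n+1-n)) : Fin (2*n+1) → ℝ :=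
  toEc (emb (E (A (wbasis n i).1, (wbasis n i).1)) (wbasis n i).2)

lemma toEc_injective : Function.Injective (toEc (n := n)) := by
  intro p q h
  refine Prod.ext ?_ (Prod.ext ?_ ?_)
  · funext i
    have := congrFun h ⟨i, by omega⟩
    simpa [toEc] using this
  · funext i
    have := congrFun h ⟨n + i, by omega⟩
    simpa [toEc, show n + (i:ℕ) < 2 * n by omega] using this
  · have := congrFun h ⟨2*n, by omega⟩
    simpa [toEc, show ¬ 2*n < n by omega] using this

def toEcL : Hpt n →ₗ[ℝ] (Fin (2*n+1) → ℝ) where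
  toFun := toEc
  map_add' p q := by funext j; simp only [toEc, Pi.add_apply]; split_ifs <;> simp
  map_smul' c p := by funext j; simp only [toEc, Pi.smul_apply]; split_ifs <;> simp

lemma continuous_toEc : Continuous (toEc (n := n)) := (toEcL (n := n)).continuous_of_finiteDimensional

def ywL (E : Hz n ≃L[ℝ] Hz n) (A : (Fin n → ℝ) →L[ℝ] (Fin n → ℝ)) : Ww n →ₗ[ℝ] (Fin (2*n+1) → ℝ) where
  toFun w := toEc (emb (E (A w.1, w.1)) w.2)
  map_add' w w' := by
    have : emb (E (A (w + w').1, (w + w').1)) (w + w').2 = emb (E (A w.1, w.1)) w.2 + emb (E (A w'.1, w'.1)) w'.2 := by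
      have h : E (A (w + w').1, (w + w').1) = E (A w.1, w.1) + E (A w'.1, w'.1) := by
        rw [← map_add]; simp
      rw [h]; rfl
    rw [this]; exact map_add (toEcL (n := n)) _ _
  map_smul' c w := by
    have : emb (E (A (c • w).1, (c • w).1)) (c • w).2 = c • emb (E (A w.1, w.1)) w.2 := by
      have h : E (A (c • w).1, (c • w).1) = c • E (A w.1, w.1) := by
        rw [← map_smul]; simp
      rw [h]; rfl
    rw [this]; exact map_smul (toEcL (n := n)) _ _

lemma yv_li (E : Hz n ≃L[ℝ] Hz n) (A : (Fin n → ℝ) →L[ℝ] (Fin n → ℝ)) : LinearIndependent ℝ (yv E A) := by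
  have hinj : Function.Injective (ywL E A) := by
    intro w w' h
    have h1 : emb (E (A w.1, w.1)) w.2 = emb (E (A w'.1, w'.1)) w'.2 := toEc_injective h
    have h2 : E (A w.1, w.1) = E (A w'.1, w'.1) := congrArg hor h1
    have h3 := congrArg Prod.snd (E.injective h2)
    exact Prod.ext h3 (congrArg (fun p : Hpt n => p.2.2) h1)
  have := (wbasis n).linearIndependent.map' (ywL E A) (LinearMap.ker_eq_bot.2 hinj)
  exact this

lemma continuous_yv (E : Hz n ≃L[ℝ] Hz n) (i : Fin (2*n+1-n)) :
    Continuous (fun A : (Fin n → ℝ) →L[ℝ] (Fin n → ℝ) => yv E A i) := by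
  unfold yv
  refine continuous_toEc.comp (continuous_emb.comp (((E.continuous.comp ?_)).prodMk continuous_const))
  fun_prop

lemma continuous_tau_yv (E : Hz n ≃L[ℝ] Hz n) :
    Continuous (fun A : (Fin n → ℝ) →L[ℝ] (Fin n → ℝ) => tau (yv E A)) := by
  have hc : ∀ i j, Continuous (fun A : (Fin n → ℝ) →L[ℝ] (Fin n → ℝ) => yv E A i j) := fun i j =>
    (continuous_apply j).comp (continuous_yv E i)
  unfold tau
  refine Continuous.smul (Continuous.inv₀ (Real.continuous_sqrt.comp ?_) fun A => ?_) ?_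
  · unfold gram
    refine Continuous.matrix_det (continuous_matrix fun i j => ?_)
    simp only [Matrix.of_apply, dotC]
    exact continuous_finsetSum _ fun l _ => (hc i l).mul (hc j l)
  · exact (Real.sqrt_pos.2 (gram_pos (yv_li E A))).ne'
  · unfold simpleWedge
    refine continuous_pi fun s => Continuous.matrix_det (continuous_matrix fun i j => ?_)
    exact hc i _

lemma dotC_toEc_gradF (f : Hpt n → ℝ) (x q : Hpt n) : dotC (toEc q) (gradF f x) = dHL f x (hor q) := by
  rw [dHL_apply]
  unfold dotC
  rw [Fin.sum_univ_castSucc]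
  have h0 : gradF f x (Fin.last (2*n)) = 0 := by simp [gradF]
  rw [h0, mul_zero, add_zero]
  refine Finset.sum_congr rfl fun j _ => ?_
  rw [mul_comm]
  have h1 : gradF f x j.castSucc = gradH f x j := by simp [gradF]
  rw [h1]
  congr 1
  simp only [toEc, cz, hor, Fin.val_castSucc]
  split_ifs <;> first | rfl | omega

lemma gradF_li {f : Fin n → Hpt n → ℝ} {x : Hpt n} (h : LinearIndependent ℝ (fun i => gradH (f i) x)) :
    LinearIndependent ℝ (fun i => gradF (f i) x) := by
  let P : (Fin (2*n+1) → ℝ) →ₗ[ℝ] (Fin (2*n) → ℝ) := LinearMap.funLeft ℝ ℝ (Fin.castSucc)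
  refine LinearIndependent.of_comp P ?_
  convert h using 1
  funext i j
  simp [P, gradF, LinearMap.funLeft]
end

section
/-! ### linear changes of the defining functions -/

def linc (M : Am n) (f : Fin n → Hpt n → ℝ) : Fin n → Hpt n → ℝ := fun i x => M (fun j => f j x) i

lemma linc_eq (M : Am n) (f : Fin n → Hpt n → ℝ) (i : Fin n) :
    linc M f i = fun x => ∑ j, M (Pi.single j 1) i * f j x := by
  funext x
  unfold linc
  conv_lhs => rw [pi_eq_sum_univ' (fun j => f j x)]
  rw [map_sum, Finset.sum_apply]
  refine Finset.sum_congr rfl fun j _ => ?_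
  rw [map_smul, Pi.smul_apply, smul_eq_mul, mul_comm]

lemma linc_gradH {U : Set (Hpt n)} {f : Fin n → Hpt n → ℝ} (hf : ∀ i, IsC1H U (f i)) (M : Am n)
    {x : Hpt n} (hx : x ∈ U) (i : Fin n) (k : Fin (2*n)) :
    HasLineDerivAt ℝ (linc M f i) (∑ j, M (Pi.single j 1) i * gradH (f j) x k) x (frameVec (hIdx k) x) := by
  rw [linc_eq]
  unfold HasLineDerivAt
  refine HasDerivAt.fun_sum fun j _ => ?_
  exact ((hf j).ldiff x hx k).hasLineDerivAt.const_mul _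

lemma linc_C1H {U : Set (Hpt n)} {f : Fin n → Hpt n → ℝ} (hf : ∀ i, IsC1H U (f i)) (M : Am n) (i : Fin n) :
    IsC1H U (linc M f i) := by
  refine ⟨?_, fun x hx k => (linc_gradH hf M hx i k).lineDifferentiableAt, fun k => ?_⟩
  · rw [linc_eq]
    exact continuousOn_finsetSum _ fun j _ => continuousOn_const.mul (hf j).contOn
  · have h : ContinuousOn (fun x => ∑ j, M (Pi.single j 1) i * gradH (f j) x k) U :=
      continuousOn_finsetSum _ fun j _ => continuousOn_const.mul ((hf j).contGrad k)
    exact h.congr fun x hx => (linc_gradH hf M hx i k).lineDeriv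

lemma linc_dHv {U : Set (Hpt n)} {f : Fin n → Hpt n → ℝ} (hf : ∀ i, IsC1H U (f i)) (M : Am n)
    {x : Hpt n} (hx : x ∈ U) : dHv (linc M f) x = M.comp (dHv f x) := by
  refine ContinuousLinearMap.ext fun u => funext fun i => ?_
  have h0 : M (dHv f x u) i = ∑ j, M (Pi.single j 1) i * dHL (f j) x u := by
    have := congrFun (linc_eq M (fun j (_ : Hpt n) => dHL (f j) x u) i) 0
    exact this
  rw [ContinuousLinearMap.comp_apply, h0]
  show dHL (linc M f i) x u = _
  simp only [dHL_apply]
  have h1 : ∀ k, gradH (linc M f i) x k = ∑ j, M (Pi.single j 1) i * gradH (f j) x k :=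
    fun k => (linc_gradH hf M hx i k).lineDeriv
  simp only [h1, Finset.sum_mul, Finset.mul_sum]
  rw [Finset.sum_comm]
  simp [mul_assoc]

/-! ### graphs over cylinders -/

def cyl (E : Hz n ≃L[ℝ] Hz n) (W : Set (Ww n)) (a0 : Fin n → ℝ) (r : ℝ) : Set (Hpt n) :=
  {x | wc E x ∈ W ∧ ac E x ∈ Metric.ball a0 r}

lemma isOpen_cyl (E : Hz n ≃L[ℝ] Hz n) {W : Set (Ww n)} (hW : IsOpen W) (a0 : Fin n → ℝ) (r : ℝ) :
    IsOpen (cyl E W a0 r) :=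
  (hW.preimage (continuous_wc E)).inter (Metric.isOpen_ball.preimage (continuous_ac E))

lemma Th_mem_cyl {E : Hz n ≃L[ℝ] Hz n} {W : Set (Ww n)} {a0 : Fin n → ℝ} {r : ℝ} {w : Ww n} {a : Fin n → ℝ}
    (hw : w ∈ W) (ha : a ∈ Metric.ball a0 r) : Th E w a ∈ cyl E W a0 r := by
  refine ⟨?_, ?_⟩
  · rw [wc_Th]; exact hw
  · rw [ac_Th]; exact ha

structure Good (E : Hz n ≃L[ℝ] Hz n) (W : Set (Ww n)) (a0 : Fin n → ℝ) (r : ℝ) (f : Fin n → Hpt n → ℝ) : Prop where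
  opn : IsOpen W
  c1 : ∀ i, IsC1H (cyl E W a0 r) (f i)
  near : ∀ x ∈ cyl E W a0 r, ‖(dHv f x).comp (E : Hz n →L[ℝ] Hz n) - ContinuousLinearMap.fst ℝ _ _‖ ≤ 1 / 2

def VL (E : Hz n ≃L[ℝ] Hz n) : (Fin n → ℝ) →L[ℝ] Hz n := (E : Hz n →L[ℝ] Hz n).comp (ContinuousLinearMap.inl ℝ _ _)
def KL (E : Hz n ≃L[ℝ] Hz n) : (Fin n → ℝ) →L[ℝ] Hz n := (E : Hz n →L[ℝ] Hz n).comp (ContinuousLinearMap.inr ℝ _ _)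

/-- intrinsic differential of the implicit graph -/
def Aof (E : Hz n ≃L[ℝ] Hz n) (L : Hz n →L[ℝ] (Fin n → ℝ)) : Am n :=
  -((Ring.inverse (L.comp (VL E) : Am n)) * (L.comp (KL E)))

variable {E : Hz n ≃L[ℝ] Hz n} {W : Set (Ww n)} {a0 : Fin n → ℝ} {r : ℝ} {f : Fin n → Hpt n → ℝ}
  {D : HomDist n} {φ : Ww n → Fin n → ℝ}

lemma VL_apply (a : Fin n → ℝ) : VL E a = E (a, 0) := rfl
lemma KL_apply (a : Fin n → ℝ) : KL E a = E (0, a) := rfl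

lemma near_V {L : Hz n →L[ℝ] (Fin n → ℝ)} {c : ℝ}
    (h : ‖L.comp (E : Hz n →L[ℝ] Hz n) - ContinuousLinearMap.fst ℝ _ _‖ ≤ c) (v : Fin n → ℝ) :
    ‖L (VL E v) - v‖ ≤ c * ‖v‖ := by
  have := (L.comp (E : Hz n →L[ℝ] Hz n) - ContinuousLinearMap.fst ℝ _ _).le_of_opNorm_le h (v, 0)
  simpa [VL_apply, Prod.norm_def] using this

lemma near_K {L : Hz n →L[ℝ] (Fin n → ℝ)} {c : ℝ}
    (h : ‖L.comp (E : Hz n →L[ℝ] Hz n) - ContinuousLinearMap.fst ℝ _ _‖ ≤ c) (v : Fin n → ℝ) :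
    ‖L (KL E v)‖ ≤ c * ‖v‖ := by
  have := (L.comp (E : Hz n →L[ℝ] Hz n) - ContinuousLinearMap.fst ℝ _ _).le_of_opNorm_le h (0, v)
  simpa [KL_apply, Prod.norm_def] using this

lemma near_lower {L : Hz n →L[ℝ] (Fin n → ℝ)}
    (h : ‖L.comp (E : Hz n →L[ℝ] Hz n) - ContinuousLinearMap.fst ℝ _ _‖ ≤ 1 / 2) (v : Fin n → ℝ) :
    ‖v‖ ≤ 2 * ‖L (VL E v)‖ := by
  have h1 := near_V h v
  have h2 : ‖v‖ ≤ ‖L (VL E v)‖ + ‖L (VL E v) - v‖ := by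
    calc ‖v‖ = ‖L (VL E v) - (L (VL E v) - v)‖ := by simp
      _ ≤ _ := norm_sub_le _ _
  linarith

lemma near_unit {L : Hz n →L[ℝ] (Fin n → ℝ)}
    (h : ‖L.comp (E : Hz n →L[ℝ] Hz n) - ContinuousLinearMap.fst ℝ _ _‖ ≤ 1 / 2) :
    IsUnit (L.comp (VL E) : Am n) := by
  have h1 : ‖(1 : Am n) - L.comp (VL E)‖ < 1 := by
    refine lt_of_le_of_lt (ContinuousLinearMap.opNorm_le_bound _ (by norm_num : (0:ℝ) ≤ 1 / 2) fun v => ?_) (by norm_num)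
    rw [← norm_neg]
    have := near_V h v
    simpa using this
  have := (Units.oneSub _ h1).isUnit
  simpa using this

lemma Aof_spec {L : Hz n →L[ℝ] (Fin n → ℝ)}
    (h : ‖L.comp (E : Hz n →L[ℝ] Hz n) - ContinuousLinearMap.fst ℝ _ _‖ ≤ 1 / 2) (b : Fin n → ℝ) :
    L (VL E (Aof E L b)) = - L (KL E b) := by
  have hu := Ring.mul_inverse_cancel _ (near_unit h)
  have h1 : L (VL E ((Ring.inverse (L.comp (VL E) : Am n)) (L (KL E b)))) = L (KL E b) :=
    congrArg (fun T : Am n => T (L (KL E b))) hu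
  have h2 : Aof E L b = - (Ring.inverse (L.comp (VL E) : Am n)) (L (KL E b)) := rfl
  rw [h2, map_neg, map_neg, h1]

lemma Aof_ker {L : Hz n →L[ℝ] (Fin n → ℝ)}
    (h : ‖L.comp (E : Hz n →L[ℝ] Hz n) - ContinuousLinearMap.fst ℝ _ _‖ ≤ 1 / 2) (b : Fin n → ℝ) :
    L (E (Aof E L b, b)) = 0 := by
  have h1 : E (Aof E L b, b) = VL E (Aof E L b) + KL E b := by
    rw [VL_apply, KL_apply, ← map_add]; simp
  rw [h1, map_add, Aof_spec h]; simp

lemma Aof_norm {L : Hz n →L[ℝ] (Fin n → ℝ)}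
    (h : ‖L.comp (E : Hz n →L[ℝ] Hz n) - ContinuousLinearMap.fst ℝ _ _‖ ≤ 1 / 2) : ‖Aof E L‖ ≤ 1 := by
  refine ContinuousLinearMap.opNorm_le_bound _ zero_le_one fun b => ?_
  have h1 := near_lower h (Aof E L b)
  rw [Aof_spec h, norm_neg] at h1
  have h2 := near_K h b
  linarith

lemma Aof_continuousAt {L : Hz n →L[ℝ] (Fin n → ℝ)}
    (h : ‖L.comp (E : Hz n →L[ℝ] Hz n) - ContinuousLinearMap.fst ℝ _ _‖ ≤ 1 / 2) :
    ContinuousAt (Aof E) L := by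
  obtain ⟨u, hu⟩ := near_unit h
  unfold Aof
  have h1 : ContinuousAt (fun L : Hz n →L[ℝ] (Fin n → ℝ) => (L.comp (VL E) : Am n)) L := by fun_prop
  have h2 : ContinuousAt (fun L : Hz n →L[ℝ] (Fin n → ℝ) => (L.comp (KL E) : Am n)) L := by fun_prop
  have h3 := NormedRing.inverse_continuousAt u
  rw [hu] at h3
  exact ((ContinuousAt.comp (f := fun L : Hz n →L[ℝ] (Fin n → ℝ) => (L.comp (VL E) : Am n)) h3 h1).mul h2).neg

lemma near_surj {L : Hz n →L[ℝ] (Fin n → ℝ)}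
    (h : ‖L.comp (E : Hz n →L[ℝ] Hz n) - ContinuousLinearMap.fst ℝ _ _‖ ≤ 1 / 2) :
    Function.Surjective L := by
  have hu := Ring.mul_inverse_cancel _ (near_unit h)
  intro b
  have := congrArg (fun T : Am n => T b) hu
  exact ⟨_, this⟩

lemma near_ker {L : Hz n →L[ℝ] (Fin n → ℝ)}
    (h : ‖L.comp (E : Hz n →L[ℝ] Hz n) - ContinuousLinearMap.fst ℝ _ _‖ ≤ 1 / 2) {a b : Fin n → ℝ}
    (hab : L (E (a, b)) = 0) : a = Aof E L b := by
  have h1 := near_lower h (a - Aof E L b)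
  have h2 : VL E (a - Aof E L b) = E (a, b) - E (Aof E L b, b) := by
    rw [← map_sub, VL_apply]; simp
  rw [h2, map_sub, hab, Aof_ker h] at h1
  simp only [sub_self, norm_zero, mul_zero] at h1
  exact sub_eq_zero.1 (norm_le_zero_iff.1 h1)

lemma Good.line (hn : 1 ≤ n) (D : HomDist n) (hE : ∀ x y, om (E x) (E y) = om x y) (h : Good E W a0 r f)
    {w : Ww n} (hw : w ∈ W) {a a' : Fin n → ℝ} (ha : a ∈ Metric.ball a0 r) (ha' : a' ∈ Metric.ball a0 r) :
    ‖((fun i => f i (Th E w a')) - (fun i => f i (Th E w a))) - (a' - a)‖ ≤ 1 / 2 * ‖a' - a‖ := by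
  obtain ⟨C, hC, hup⟩ := Th_upper hn D hE
  have key : ∀ b ∈ Metric.ball a0 r, HasFDerivWithinAt (fun b => (fun i => f i (Th E w b)))
      ((dHv f (Th E w b)).comp (VL E)) (Metric.ball a0 r) b := by
    intro b hb
    have hs := spd_pi hn D (isOpen_cyl E h.opn a0 r) h.c1 (Th_mem_cyl hw hb)
    refine HasFDerivAt.hasFDerivWithinAt ?_
    rw [hasFDerivAt_iff_isLittleO, Asymptotics.isLittleO_iff]
    intro c hc
    obtain ⟨δ, hδ, hs⟩ := hs (c / C) (by positivity)
    have hev : ∀ᶠ b' in 𝓝 b, C * ‖b' - b‖ < δ := by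
      have : Tendsto (fun b' => C * ‖b' - b‖) (𝓝 b) (𝓝 (C * ‖b - b‖)) := by
        apply Continuous.tendsto; fun_prop
      exact this.eventually (gt_mem_nhds (by simpa using hδ))
    filter_upwards [hev] with b' hb'
    have h1 := hs (Th E w b) (Th E w b') (by rw [D.self]; exact hδ) ((hup w b b').trans_lt hb')
    rw [Th_inv_mul_same hE, hor_emb'] at h1
    refine h1.trans ?_
    calc c / C * D.d (Th E w b) (Th E w b') ≤ c / C * (C * ‖b' - b‖) :=
          mul_le_mul_of_nonneg_left (hup w b b') (by positivity)
      _ = c * ‖b' - b‖ := by field_simp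
  have := (convex_ball a0 r).norm_image_sub_le_of_norm_hasFDerivWithin_le' (φ := ContinuousLinearMap.id ℝ (Fin n → ℝ)) (C := 1 / 2) key (fun b hb => ?_) ha ha'
  · exact this
  · refine ContinuousLinearMap.opNorm_le_bound _ (by norm_num) fun v => ?_
    exact near_V (h.near _ (Th_mem_cyl hw hb)) v

lemma Good.lower (hn : 1 ≤ n) (D : HomDist n) (hE : ∀ x y, om (E x) (E y) = om x y) (h : Good E W a0 r f)
    {w : Ww n} (hw : w ∈ W) {a a' : Fin n → ℝ} (ha : a ∈ Metric.ball a0 r) (ha' : a' ∈ Metric.ball a0 r) :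
    ‖a' - a‖ ≤ 2 * ‖(fun i => f i (Th E w a')) - (fun i => f i (Th E w a))‖ := by
  have h1 := h.line hn D hE hw ha ha'
  set u := (fun i => f i (Th E w a')) - (fun i => f i (Th E w a))
  have h2 : ‖a' - a‖ ≤ ‖u‖ + ‖u - (a' - a)‖ := by
    calc ‖a' - a‖ = ‖u - (u - (a' - a))‖ := by simp
      _ ≤ _ := norm_sub_le _ _
  linarith

lemma Good.uniq (hn : 1 ≤ n) (D : HomDist n) (hE : ∀ x y, om (E x) (E y) = om x y) (h : Good E W a0 r f)
    {w : Ww n} (hw : w ∈ W) {a a' : Fin n → ℝ} (ha : a ∈ Metric.ball a0 r) (ha' : a' ∈ Metric.ball a0 r)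
    (h0 : ∀ i, f i (Th E w a) = 0) (h0' : ∀ i, f i (Th E w a') = 0) : a = a' := by
  have h1 := h.lower hn D hE hw ha' ha
  have : (fun i => f i (Th E w a)) - (fun i => f i (Th E w a')) = 0 := by
    funext i; simp [h0, h0']
  rw [this] at h1
  simp only [norm_zero, mul_zero] at h1
  exact sub_eq_zero.1 (norm_le_zero_iff.1 h1)

lemma Good.exists_zero (hn : 1 ≤ n) (D : HomDist n) (hE : ∀ x y, om (E x) (E y) = om x y) (h : Good E W a0 r f)
    {w : Ww n} (hw : w ∈ W) {a1 : Fin n → ℝ} {ε : ℝ} (hε : Metric.closedBall a1 ε ⊆ Metric.ball a0 r)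
    (hf : 2 * ‖fun i => f i (Th E w a1)‖ ≤ ε) :
    ∃ a ∈ Metric.closedBall a1 ε, ∀ i, f i (Th E w a) = 0 := by
  have hε0 : 0 ≤ ε := le_trans (by positivity) hf
  have hA : ApproximatesLinearOn (fun a => (fun i => f i (Th E w a)))
      ((ContinuousLinearEquiv.refl ℝ (Fin n → ℝ) : (Fin n → ℝ) ≃L[ℝ] (Fin n → ℝ)) : (Fin n → ℝ) →L[ℝ] (Fin n → ℝ)) (Metric.ball a0 r) (1 / 2) := by
    intro x hx y hy
    have := h.line hn D hE hw hy hx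
    simpa using this
  have := hA.surjOn_closedBall_of_nonlinearRightInverse
    ⟨id, 1, fun y => by simp, fun y => by simp⟩ hε0 hε
  obtain ⟨a, ha, ha0⟩ := this (show (0 : Fin n → ℝ) ∈ _ by
    rw [mem_closedBall_iff_norm', sub_zero]
    refine (show ‖fun i => f i (Th E w a1)‖ ≤ 1 / 2 * ε by linarith).trans (le_of_eq ?_)
    norm_num)
  exact ⟨a, ha, fun i => congrFun ha0 i⟩

lemma Good.cont (hn : 1 ≤ n) (D : HomDist n) (hE : ∀ x y, om (E x) (E y) = om x y) (h : Good E W a0 r f)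
    (hφ : ∀ w ∈ W, φ w ∈ Metric.ball a0 r) (hz : ∀ w ∈ W, ∀ i, f i (Th E w (φ w)) = 0) : ContinuousOn φ W := by
  intro w0 hw0
  have hc : ContinuousOn (fun w => (fun i => f i (Th E w (φ w0)))) W := by
    refine continuousOn_pi.2 fun i => (h.c1 i).contOn.comp
      ((continuous_Th E).comp (continuous_id.prodMk continuous_const)).continuousOn fun w hw => ?_
    exact Th_mem_cyl hw (hφ w0 hw0)
  have h1 : Tendsto (fun w => 2 * ‖(fun i => f i (Th E w (φ w0)))‖) (𝓝[W] w0) (𝓝 0) := by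
    have := ((hc w0 hw0).norm.const_mul 2)
    have h0 : (fun i => f i (Th E w0 (φ w0))) = 0 := funext fun i => hz w0 hw0 i
    rw [ContinuousWithinAt] at this
    simpa [h0] using this
  rw [ContinuousWithinAt, tendsto_iff_norm_sub_tendsto_zero]
  refine squeeze_zero' (Eventually.of_forall fun w => norm_nonneg _) ?_ h1
  filter_upwards [self_mem_nhdsWithin] with w hw
  have := h.lower hn D hE hw (hφ w0 hw0) (hφ w hw)
  have h0 : (fun i => f i (Th E w (φ w))) = 0 := funext fun i => hz w hw i
  rwa [h0, zero_sub, norm_neg] at this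

lemma Good.igraph (hn : 1 ≤ n) (D : HomDist n) (hE : ∀ x y, om (E x) (E y) = om x y) (h : Good E W a0 r f)
    (hφ : ∀ w ∈ W, φ w ∈ Metric.ball a0 r) (hz : ∀ w ∈ W, ∀ i, f i (Th E w (φ w)) = 0) (hvol : volume W < ⊤) :
    IGraph D E W φ (fun w => Aof E (dHv f (Th E w (φ w)))) := by
  have hm : ∀ w ∈ W, Th E w (φ w) ∈ cyl E W a0 r := fun w hw => Th_mem_cyl hw (hφ w hw)
  have hc := h.cont hn D hE hφ hz
  refine ⟨h.opn, hvol, hc, ?_, ⟨1, fun w hw => Aof_norm (h.near _ (hm w hw))⟩, ?_⟩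
  · have h1 : ContinuousOn (fun w => dHv f (Th E w (φ w))) W :=
      (continuousOn_dHv h.c1).comp ((continuous_Th E).comp_continuousOn (continuousOn_id.prodMk hc)) hm
    intro w hw
    exact ContinuousAt.comp_continuousWithinAt (f := fun w => dHv f (Th E w (φ w))) (Aof_continuousAt (h.near _ (hm w hw))) (h1 w hw)
  · intro w0 hw0 ε hε
    have hs := spd_pi hn D (isOpen_cyl E h.opn a0 r) h.c1 (hm w0 hw0)
    obtain ⟨δ, hδ, hs⟩ := hs (ε / 2) (by positivity)
    refine ⟨δ, hδ, fun w hw hd => ?_⟩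
    have h1 := hs (Th E w0 (φ w0)) (Th E w (φ w)) (by rw [D.self]; exact hδ) hd
    have h0 : (fun i => f i (Th E w (φ w))) = 0 := funext fun i => hz w hw i
    have h0' : (fun i => f i (Th E w0 (φ w0))) = 0 := funext fun i => hz w0 hw0 i
    simp only [h0, h0', sub_self, zero_sub, norm_neg] at h1
    rw [Th_inv_mul hE, hor_Th] at h1
    have hnear := h.near _ (hm w0 hw0)
    set L := dHv f (Th E w0 (φ w0)) with hL
    have h2 := near_lower hnear (φ w - φ w0 - Aof E L (w.1 - w0.1))
    have h3 : VL E (φ w - φ w0 - Aof E L (w.1 - w0.1)) =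
        E (φ w - φ w0, w.1 - w0.1) - E (Aof E L (w.1 - w0.1), w.1 - w0.1) := by
      rw [← map_sub, VL_apply]; simp
    rw [h3, map_sub L, Aof_ker hnear, sub_zero] at h2
    calc _ ≤ _ := h2
      _ ≤ 2 * (ε / 2 * D.d (Th E w0 (φ w0)) (Th E w (φ w))) := by
          exact mul_le_mul_of_nonneg_left h1 (by norm_num)
      _ = _ := by ring

lemma Good.zeros (hn : 1 ≤ n) (D : HomDist n) (hE : ∀ x y, om (E x) (E y) = om x y) (h : Good E W a0 r f)
    (hφ : ∀ w ∈ W, φ w ∈ Metric.ball a0 r) (hz : ∀ w ∈ W, ∀ i, f i (Th E w (φ w)) = 0) :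
    {x ∈ cyl E W a0 r | ∀ i, f i x = 0} = (fun w => Th E w (φ w)) '' W := by
  apply Subset.antisymm
  · rintro x ⟨⟨hw, ha⟩, hx⟩
    refine ⟨wc E x, hw, ?_⟩
    have : φ (wc E x) = ac E x := h.uniq hn D hE hw (hφ _ hw) ha (hz _ hw) (by simpa using hx)
    simp [this]
  · rintro _ ⟨w, hw, rfl⟩
    exact ⟨Th_mem_cyl hw (hφ w hw), hz w hw⟩

lemma Good.mono {W' : Set (Ww n)} (hW' : IsOpen W') (hWW : W' ⊆ W) (h : Good E W a0 r f) : Good E W' a0 r f := by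
  have hs : cyl E W' a0 r ⊆ cyl E W a0 r := fun x hx => ⟨hWW hx.1, hx.2⟩
  exact ⟨hW', fun i => ⟨(h.c1 i).contOn.mono hs, fun p hp => (h.c1 i).ldiff p (hs hp),
    fun j => ((h.c1 i).contGrad j).mono hs⟩, fun x hx => h.near x (hs hx)⟩

lemma Good.li (h : Good E W a0 r f) {x : Hpt n} (hx : x ∈ cyl E W a0 r) :
    LinearIndependent ℝ (fun i => gradH (f i) x) :=
  dHv_surjective_iff.1 (near_surj (h.near x hx))

lemma Good.orth (h : Good E W a0 r f) {x : Hpt n} (hx : x ∈ cyl E W a0 r) (i : Fin (2*n+1-n)) (l : Fin n) :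
    dotC (yv E (Aof E (dHv f x)) i) (gradF (f l) x) = 0 := by
  unfold yv
  rw [dotC_toEc_gradF, hor_emb']
  exact congrFun (Aof_ker (h.near x hx) (wbasis n i).1) l
end

section
structure Setup (O S : Set (Hpt n)) (p : Hpt n) (E : Hz n ≃L[ℝ] Hz n) (ρ r : ℝ) (F : Fin n → Hpt n → ℝ)
    (U0 : Set (Hpt n)) (φ : Ww n → Fin n → ℝ) : Prop where
  hE : ∀ x y, om (E x) (E y) = om x y
  ρpos : 0 < ρ
  rpos : 0 < r
  opn : IsOpen U0
  c1 : ∀ i, IsC1H U0 (F i)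
  box : ∀ w ∈ Metric.closedBall (wc E p) ρ, ∀ a ∈ Metric.closedBall (ac E p) r, Th E w a ∈ U0
  near : ∀ x ∈ U0, ‖(dHv F x).comp (E : Hz n →L[ℝ] Hz n) - ContinuousLinearMap.fst ℝ _ _‖ ≤ 1 / 4
  sub : U0 ⊆ O
  zero : ∀ x ∈ U0, x ∈ closure S → ∀ i, F i x = 0
  ball : ∀ w ∈ Metric.ball (wc E p) ρ, φ w ∈ Metric.closedBall (ac E p) (r / 4)
  phiz : ∀ w ∈ Metric.ball (wc E p) ρ, ∀ i, F i (Th E w (φ w)) = 0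

lemma IsC1H.mono' {U V : Set (Hpt n)} {f : Hpt n → ℝ} (h : IsC1H U f) (hs : V ⊆ U) : IsC1H V f :=
  ⟨h.contOn.mono hs, fun p hp => h.ldiff p (hs hp), fun j => (h.contGrad j).mono hs⟩

theorem exists_setup (hn : 1 ≤ n) (D : HomDist n) {O : Set (Hpt n)} (hO : IsOpen O) {S : Set (Hpt n)}
    (hS : IsC1HSubWithBdry D n O S) {p : Hpt n} (hp : p ∈ O ∩ bdry S) :
    ∃ E ρ r F U0 φ, Setup O S p E ρ r F U0 φ := by
  obtain ⟨-, -, -, hbd, hloc⟩ := hS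
  have hbd : IsC1HDim n (O ∩ bdry S) := by
    have e : 2*n+1-(n+1) = n := by omega
    unfold IsC1HSub at hbd
    rw [if_neg (by omega), e] at hbd
    exact hbd
  obtain ⟨U', hU', hpU', S', -, hS', hcl, -⟩ := hloc p hp
  have hS' : IsC1HCodim n S' := by
    unfold IsC1HSub at hS'
    rwa [if_pos le_rfl] at hS'
  have hpcl : p ∈ closure S := hp.2.1
  obtain ⟨U1, hU1, hpU1, F0, hF0, hli, hSF⟩ := hS' p (hcl ⟨hpU', hpcl⟩)
  have hz0 : ∀ x ∈ U' ∩ U1, x ∈ closure S → ∀ i, F0 i x = 0 := by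
    intro x hx hxc
    have : x ∈ S' ∩ U1 := ⟨hcl ⟨hx.1, hxc⟩, hx.2⟩
    rw [hSF] at this
    exact this.2
  have hspd := spd_pi hn D hU1 hF0 hpU1
  have hnh : U' ∩ U1 ∈ 𝓝 p := (hU'.inter hU1).mem_nhds ⟨hpU', hpU1⟩
  obtain ⟨l, hl, hiso, hLl⟩ := exists_isotropic hn D hbd hp hspd hnh
    (fun q hq => funext fun i => hz0 q hq.2 hq.1.2.1 i)
  obtain ⟨E, hE, hEl⟩ := exists_frame l hl hiso
  set L := dHv F0 p with hL
  have hLs : Function.Surjective L := dHv_surjective_iff.2 (hli p hpU1)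
  have hLK : ∀ b, L (E (0, b)) = 0 := fun b => by rw [hEl]; exact hLl b
  have hEsplit : ∀ a b, E (a, b) = E (a, 0) + E (0, b) := fun a b => by rw [← map_add]; simp
  have hsurj : Function.Surjective (L.comp (VL E) : Am n) := by
    intro v
    obtain ⟨u, hu⟩ := hLs v
    refine ⟨(E.symm u).1, ?_⟩
    rw [← hu]
    show L (E ((E.symm u).1, 0)) = _
    have h1 := hEsplit (E.symm u).1 (E.symm u).2
    have h2 : E ((E.symm u).1, (E.symm u).2) = u := E.apply_symm_apply u
    rw [h2] at h1
    conv_rhs => rw [h1, map_add, hLK, add_zero]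
  have hinj : Function.Injective (L.comp (VL E) : Am n) :=
    (LinearMap.injective_iff_surjective (f := (L.comp (VL E) : Am n).toLinearMap)).2 hsurj
  let e := LinearEquiv.ofBijective (L.comp (VL E) : Am n).toLinearMap ⟨hinj, hsurj⟩
  let M : Am n := LinearMap.toContinuousLinearMap e.symm.toLinearMap
  have hM : ∀ a, M (L (E (a, 0))) = a := fun a => e.symm_apply_apply a
  set F := linc M F0 with hF
  have hFc : ∀ i, IsC1H U1 (F i) := fun i => linc_C1H hF0 M i
  have hFp : (dHv F p).comp (E : Hz n →L[ℝ] Hz n) = ContinuousLinearMap.fst ℝ _ _ := by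
    refine ContinuousLinearMap.ext fun u => ?_
    rw [hF, linc_dHv hF0 M hpU1]
    show M (L (E u)) = u.1
    have h1 : E u = E (u.1, 0) + E (0, u.2) := hEsplit u.1 u.2
    rw [h1, map_add, hLK, add_zero, hM]
  have hFz : ∀ x ∈ U' ∩ U1, x ∈ closure S → ∀ i, F i x = 0 := by
    intro x hx hxc i
    have : (fun j => F0 j x) = 0 := funext fun j => hz0 x hx hxc j
    show M (fun j => F0 j x) i = 0
    rw [this]; simp
  -- neighbourhood
  have hev : ∀ᶠ x in 𝓝 p, ‖(dHv F x).comp (E : Hz n →L[ℝ] Hz n) - ContinuousLinearMap.fst ℝ _ _‖ < 1 / 4 := by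
    have hc : ContinuousAt (fun x => ‖(dHv F x).comp (E : Hz n →L[ℝ] Hz n) - ContinuousLinearMap.fst ℝ _ _‖) p :=
      ((((continuousOn_dHv hFc).continuousAt (hU1.mem_nhds hpU1)).clm_comp continuousAt_const).sub continuousAt_const).norm
    refine hc.eventually (gt_mem_nhds ?_)
    show ‖(dHv F p).comp (E : Hz n →L[ℝ] Hz n) - ContinuousLinearMap.fst ℝ _ _‖ < 1 / 4
    rw [hFp]; simp
  obtain ⟨U2, hU2, hU2o, hpU2⟩ := eventually_nhds_iff.1 hev
  set U0 := U2 ∩ ((U' ∩ U1) ∩ O) with hU0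
  have hU0o : IsOpen U0 := hU2o.inter ((hU'.inter hU1).inter hO)
  have hpU0 : p ∈ U0 := ⟨hpU2, ⟨hpU', hpU1⟩, hp.1⟩
  have hTh : (fun x : Ww n × (Fin n → ℝ) => Th E x.1 x.2) ⁻¹' U0 ∈ 𝓝 (wc E p, ac E p) := by
    refine (continuous_Th E).continuousAt.preimage_mem_nhds (hU0o.mem_nhds ?_)
    show Th E (wc E p) (ac E p) ∈ U0
    rw [Th_wc_ac]; exact hpU0
  obtain ⟨r, hr, hrU⟩ := Metric.nhds_basis_closedBall.mem_iff.1 hTh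
  have hboxr : ∀ w ∈ Metric.closedBall (wc E p) r, ∀ a ∈ Metric.closedBall (ac E p) r, Th E w a ∈ U0 := by
    intro w hw a ha
    have : (w, a) ∈ Metric.closedBall (wc E p, ac E p) r := by
      rw [← closedBall_prod_same]; exact ⟨hw, ha⟩
    exact hrU this
  have hFc0 : ∀ i, IsC1H U0 (F i) := fun i => (hFc i).mono' fun x hx => hx.2.1.2
  have hwp : wc E p ∈ Metric.ball (wc E p) r := Metric.mem_ball_self hr
  have hap : ac E p ∈ Metric.closedBall (ac E p) r := Metric.mem_closedBall_self hr.le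
  have hcF : ContinuousOn (fun w => 2 * ‖fun i => F i (Th E w (ac E p))‖) (Metric.ball (wc E p) r) := by
    refine continuousOn_const.mul (ContinuousOn.norm (continuousOn_pi.2 fun i => (hFc0 i).contOn.comp
      ((continuous_Th E).comp (continuous_id.prodMk continuous_const)).continuousOn fun w hw => ?_))
    exact hboxr w (Metric.ball_subset_closedBall hw) _ hap
  have hev2 : ∀ᶠ w in 𝓝 (wc E p), 2 * ‖fun i => F i (Th E w (ac E p))‖ < r / 4 := by
    refine (hcF.continuousAt (Metric.isOpen_ball.mem_nhds hwp)).eventually (gt_mem_nhds ?_)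
    have : (fun i => F i (Th E (wc E p) (ac E p))) = 0 := by
      funext i; rw [Th_wc_ac]; exact hFz p ⟨hpU', hpU1⟩ hpcl i
    show 2 * ‖fun i => F i (Th E (wc E p) (ac E p))‖ < r / 4
    rw [this]; simp; exact hr
  obtain ⟨ρ', hρ', hρ'r⟩ := Metric.eventually_nhds_iff_ball.1 hev2
  set ρ := min ρ' r with hρ
  have hρ0 : 0 < ρ := lt_min hρ' hr
  have hbox : ∀ w ∈ Metric.closedBall (wc E p) ρ, ∀ a ∈ Metric.closedBall (ac E p) r, Th E w a ∈ U0 :=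
    fun w hw a ha => hboxr w (Metric.closedBall_subset_closedBall (min_le_right _ _) hw) a ha
  have hnear : ∀ x ∈ U0, ‖(dHv F x).comp (E : Hz n →L[ℝ] Hz n) - ContinuousLinearMap.fst ℝ _ _‖ ≤ 1 / 4 :=
    fun x hx => (hU2 x hx.1).le
  have hcs : cyl E (Metric.ball (wc E p) ρ) (ac E p) r ⊆ U0 := by
    intro x hx
    have := hbox _ (Metric.ball_subset_closedBall hx.1) _ (Metric.ball_subset_closedBall hx.2)
    rwa [Th_wc_ac] at this
  have hG : Good E (Metric.ball (wc E p) ρ) (ac E p) r F :=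
    ⟨Metric.isOpen_ball, fun i => (hFc0 i).mono' hcs, fun x hx => (hnear x (hcs hx)).trans (by norm_num)⟩
  have hex : ∀ w ∈ Metric.ball (wc E p) ρ, ∃ a ∈ Metric.closedBall (ac E p) (r / 4), ∀ i, F i (Th E w a) = 0 := by
    intro w hw
    refine hG.exists_zero hn D hE hw (Metric.closedBall_subset_ball (by linarith)) ?_
    exact (hρ'r w (Metric.ball_subset_ball (min_le_left _ _) hw)).le
  choose! φ hφ1 hφ2 using hex
  exact ⟨E, ρ, r, F, U0, φ, hE, hρ0, hr, hU0o, hFc0, hbox, hnear, fun x hx => hx.2.2,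
    fun x hx hxc => hFz x hx.2.1 hxc, hφ1, hφ2⟩
end

section
variable {D : HomDist n} {O S : Set (Hpt n)} {p : Hpt n} {E : Hz n ≃L[ℝ] Hz n} {ρ r : ℝ}
  {F : Fin n → Hpt n → ℝ} {U0 : Set (Hpt n)} {φ : Ww n → Fin n → ℝ}

lemma good_near {f : Fin n → Hpt n → ℝ} {V : Set (Hpt n)} (hV : IsOpen V) (hf : ∀ i, IsC1H V (f i)) {q : Hpt n}
    (hq : q ∈ V) (hnear : ‖(dHv f q).comp (E : Hz n →L[ℝ] Hz n) - ContinuousLinearMap.fst ℝ _ _‖ < 1 / 2)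
    {N : Set (Hpt n)} (hN : N ∈ 𝓝 q) :
    ∃ ε > 0, Good E (Metric.ball (wc E q) ε) (ac E q) ε f ∧ cyl E (Metric.ball (wc E q) ε) (ac E q) ε ⊆ N ∧
      cyl E (Metric.ball (wc E q) ε) (ac E q) ε ⊆ V := by
  have hc : ContinuousAt (fun x => ‖(dHv f x).comp (E : Hz n →L[ℝ] Hz n) - ContinuousLinearMap.fst ℝ _ _‖) q :=
    ((((continuousOn_dHv hf).continuousAt (hV.mem_nhds hq)).clm_comp continuousAt_const).sub continuousAt_const).norm
  have hev := hc.eventually (gt_mem_nhds hnear)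
  have hall : N ∩ (V ∩ {x | ‖(dHv f x).comp (E : Hz n →L[ℝ] Hz n) - ContinuousLinearMap.fst ℝ _ _‖ < 1 / 2}) ∈ 𝓝 q :=
    inter_mem hN (inter_mem (hV.mem_nhds hq) hev)
  have hTh : (fun x : Ww n × (Fin n → ℝ) => Th E x.1 x.2) ⁻¹' (N ∩ (V ∩ {x | ‖(dHv f x).comp (E : Hz n →L[ℝ] Hz n) - ContinuousLinearMap.fst ℝ _ _‖ < 1 / 2})) ∈ 𝓝 (wc E q, ac E q) := by
    refine (continuous_Th E).continuousAt.preimage_mem_nhds ?_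
    show _ ∈ 𝓝 (Th E (wc E q) (ac E q))
    rw [Th_wc_ac]; exact hall
  obtain ⟨ε, hε, hεU⟩ := Metric.nhds_basis_ball.mem_iff.1 hTh
  have hsub : ∀ x ∈ cyl E (Metric.ball (wc E q) ε) (ac E q) ε, x ∈ N ∩ (V ∩ {x | ‖(dHv f x).comp (E : Hz n →L[ℝ] Hz n) - ContinuousLinearMap.fst ℝ _ _‖ < 1 / 2}) := by
    intro x hx
    have : (wc E x, ac E x) ∈ Metric.ball (wc E q, ac E q) ε := by
      rw [← ball_prod_same]; exact ⟨hx.1, hx.2⟩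
    have h2 := hεU this
    have h3 := Set.mem_preimage.1 h2
    simp only [Th_wc_ac] at h3
    exact h3
  refine ⟨ε, hε, ⟨Metric.isOpen_ball, fun i => (hf i).mono' fun x hx => (hsub x hx).2.1, fun x hx => ?_⟩,
    fun x hx => (hsub x hx).1, fun x hx => (hsub x hx).2.1⟩
  have : ‖(dHv f x).comp (E : Hz n →L[ℝ] Hz n) - ContinuousLinearMap.fst ℝ _ _‖ < 1 / 2 := (hsub x hx).2.2
  exact this.le

lemma Setup.cyl_sub (s : Setup O S p E ρ r F U0 φ) : cyl E (Metric.ball (wc E p) ρ) (ac E p) r ⊆ U0 := by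
  intro x hx
  have := s.box _ (Metric.ball_subset_closedBall hx.1) _ (Metric.ball_subset_closedBall hx.2)
  rwa [Th_wc_ac] at this

lemma Setup.good (s : Setup O S p E ρ r F U0 φ) : Good E (Metric.ball (wc E p) ρ) (ac E p) r F :=
  ⟨Metric.isOpen_ball, fun i => (s.c1 i).mono' s.cyl_sub, fun x hx => (s.near x (s.cyl_sub hx)).trans (by norm_num)⟩

lemma Setup.ball' (s : Setup O S p E ρ r F U0 φ) : ∀ w ∈ Metric.ball (wc E p) ρ, φ w ∈ Metric.ball (ac E p) r :=
  fun w hw => Metric.closedBall_subset_ball (by linarith [s.rpos]) (s.ball w hw)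

lemma Setup.mem_U0 (s : Setup O S p E ρ r F U0 φ) {w : Ww n} (hw : w ∈ Metric.ball (wc E p) ρ) : Th E w (φ w) ∈ U0 :=
  s.cyl_sub (Th_mem_cyl hw (s.ball' w hw))

lemma same_diff (hn : 1 ≤ n) (D : HomDist n) (s : Setup O S p E ρ r F U0 φ) {q : Hpt n} (hq : q ∈ U0)
    {V : Set (Hpt n)} (hV : IsOpen V) (hqV : q ∈ V) {g : Fin n → Hpt n → ℝ} (hg : ∀ i, IsC1H V (g i))
    (hli : LinearIndependent ℝ (fun i => gradH (g i) q)) (hSV : (O ∩ S) ∩ V = {x ∈ V | ∀ i, g i x = 0})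
    (hqS : q ∈ S) : ∃ M : Am n, Function.Injective M ∧ M.comp (dHv g q) = dHv F q := by
  have hqO := s.sub hq
  have hsurj : Function.Surjective (dHv g q) := dHv_surjective_iff.2 hli
  have hsurjF : Function.Surjective (dHv F q) := near_surj ((s.near q hq).trans (by norm_num))
  have hgq : (fun i => g i q) = 0 := by
    have : q ∈ (O ∩ S) ∩ V := ⟨⟨hqO, hqS⟩, hqV⟩
    rw [hSV] at this
    exact funext this.2
  have hker := SPD.ker_le hn (spd_pi hn D hV hg hqV) (spd_pi hn D s.opn s.c1 hq) hsurj hgq (by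
    filter_upwards [hV.mem_nhds hqV, s.opn.mem_nhds hq] with x hxV hxU hx
    have : x ∈ (O ∩ S) ∩ V := by rw [hSV]; exact ⟨hxV, fun i => congrFun hx i⟩
    exact funext fun i => s.zero x hxU (subset_closure this.1.2) i)
  obtain ⟨R, hR⟩ := exists_right_inverse (dHv g q) hsurj
  have hcomp : ∀ v, dHv F q (R (dHv g q v)) = dHv F q v := by
    intro v
    have := hker (R (dHv g q v) - v) (by rw [map_sub, hR, sub_self])
    rw [map_sub] at this
    exact sub_eq_zero.1 this
  refine ⟨(dHv F q).comp R, ?_, ContinuousLinearMap.ext hcomp⟩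
  refine (LinearMap.injective_iff_surjective (f := ((dHv F q).comp R : Am n).toLinearMap)).2 fun v => ?_
  obtain ⟨u, hu⟩ := hsurjF v
  exact ⟨dHv g q u, by rw [← hu]; exact hcomp u⟩

def Bset (S : Set (Hpt n)) (p : Hpt n) (E : Hz n ≃L[ℝ] Hz n) (ρ : ℝ) (φ : Ww n → Fin n → ℝ) : Set (Ww n) :=
  {w | w ∈ Metric.ball (wc E p) ρ ∧ Th E w (φ w) ∈ S}

lemma Setup.cphi (hn : 1 ≤ n) (D : HomDist n) (s : Setup O S p E ρ r F U0 φ) : ContinuousOn φ (Metric.ball (wc E p) ρ) :=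
  s.good.cont hn D s.hE s.ball' s.phiz

lemma Setup.isOpen_B (hn : 1 ≤ n) (D : HomDist n) (s : Setup O S p E ρ r F U0 φ) (hS : IsC1HCodim n (O ∩ S)) :
    IsOpen (Bset S p E ρ φ) := by
  rw [isOpen_iff_mem_nhds]
  rintro w0 ⟨hw0, hq⟩
  set q := Th E w0 (φ w0) with hqdef
  have hqU := s.mem_U0 hw0
  have hqO := s.sub hqU
  obtain ⟨V, hV, hqV, g, hg, hli, hSV⟩ := hS q ⟨hqO, hq⟩
  obtain ⟨M, hM, hMd⟩ := same_diff hn D s hqU hV hqV hg (hli q hqV) hSV hq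
  have hfd := linc_dHv hg M hqV
  rw [hMd] at hfd
  have hf := fun i => linc_C1H hg M i
  set f := linc M g with hfdef
  have hfz : ∀ x, (∀ i, f i x = 0) → ∀ i, g i x = 0 := by
    intro x hx i
    have h1 : M (fun j => g j x) = M 0 := by
      rw [map_zero]; exact funext hx
    exact congrFun (hM h1) i
  have hgz : ∀ x, (∀ i, g i x = 0) → ∀ i, f i x = 0 := by
    intro x hx i
    have h1 : (fun j => g j x) = 0 := funext hx
    show M (fun j => g j x) i = 0
    rw [h1, map_zero]; rfl
  have hnear : ‖(dHv f q).comp (E : Hz n →L[ℝ] Hz n) - ContinuousLinearMap.fst ℝ _ _‖ < 1 / 2 := by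
    rw [hfd]; exact (s.near q hqU).trans_lt (by norm_num)
  obtain ⟨ε, hε, hgood, hsN, hsV⟩ := good_near hV hf hqV hnear
    ((isOpen_cyl E Metric.isOpen_ball (ac E p) r).mem_nhds (Th_mem_cyl hw0 (s.ball' w0 hw0)))
  have hwq : wc E q = w0 := by simp [hqdef]
  have haq : ac E q = φ w0 := by simp [hqdef]
  rw [hwq, haq] at hgood hsN hsV
  have hcF : ContinuousOn (fun w => 2 * ‖fun i => f i (Th E w (φ w0))‖) (Metric.ball w0 ε) := by
    refine continuousOn_const.mul (ContinuousOn.norm (continuousOn_pi.2 fun i => (hgood.c1 i).contOn.comp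
      ((continuous_Th E).comp (continuous_id.prodMk continuous_const)).continuousOn fun w hw => ?_))
    exact Th_mem_cyl hw (Metric.mem_ball_self hε)
  have hev2 : ∀ᶠ w in 𝓝 w0, 2 * ‖fun i => f i (Th E w (φ w0))‖ < ε / 2 := by
    refine (hcF.continuousAt (Metric.isOpen_ball.mem_nhds (Metric.mem_ball_self hε))).eventually (gt_mem_nhds ?_)
    have hq' : q ∈ (O ∩ S) ∩ V := ⟨⟨hqO, hq⟩, hqV⟩
    rw [hSV] at hq'
    have : (fun i => f i (Th E w0 (φ w0))) = 0 := funext fun i => hgz q hq'.2 i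
    show 2 * ‖fun i => f i (Th E w0 (φ w0))‖ < ε / 2
    rw [this]; simp; exact hε
  filter_upwards [hev2, Metric.isOpen_ball.mem_nhds (Metric.mem_ball_self hε), Metric.isOpen_ball.mem_nhds hw0]
    with w hw1 hw2 hw3
  refine ⟨hw3, ?_⟩
  obtain ⟨a, ha, haz⟩ := hgood.exists_zero hn D s.hE hw2 (a1 := φ w0) (ε := ε / 2)
    (Metric.closedBall_subset_ball (by linarith)) hw1.le
  have hac := Th_mem_cyl (E := E) hw2 (Metric.closedBall_subset_ball (by linarith : ε / 2 < ε) ha)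
  have hmem : Th E w a ∈ (O ∩ S) ∩ V := by
    rw [hSV]; exact ⟨hsV hac, hfz _ haz⟩
  have hcy := hsN hac
  have ha' : a ∈ Metric.ball (ac E p) r := by have := hcy.2; rwa [ac_Th] at this
  have heq : a = φ w := s.good.uniq hn D s.hE hw3 ha' (s.ball' w hw3)
    (s.zero _ (s.cyl_sub hcy) (subset_closure hmem.1.2)) (s.phiz w hw3)
  rw [← heq]; exact hmem.1.2

/-- points of the closure of `S` in the cylinder lie on the graph -/
lemma Setup.mem_graph (hn : 1 ≤ n) (D : HomDist n) (s : Setup O S p E ρ r F U0 φ) {x : Hpt n}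
    (hx : x ∈ cyl E (Metric.ball (wc E p) ρ) (ac E p) r) (hxS : x ∈ closure S) : x = Th E (wc E x) (φ (wc E x)) := by
  have : φ (wc E x) = ac E x := s.good.uniq hn D s.hE hx.1 (s.ball' _ hx.1) hx.2 (s.phiz _ hx.1)
    (by simpa using s.zero x (s.cyl_sub hx) hxS)
  rw [this, Th_wc_ac]

lemma Setup.inter_S (hn : 1 ≤ n) (D : HomDist n) (s : Setup O S p E ρ r F U0 φ) :
    S ∩ cyl E (Metric.ball (wc E p) ρ) (ac E p) r = (fun w => Th E w (φ w)) '' Bset S p E ρ φ := by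
  apply Subset.antisymm
  · rintro x ⟨hxS, hx⟩
    have := s.mem_graph hn D hx (subset_closure hxS)
    refine ⟨wc E x, ⟨hx.1, ?_⟩, this.symm⟩
    rw [← this]; exact hxS
  · rintro _ ⟨w, ⟨hw, hwS⟩, rfl⟩
    exact ⟨hwS, Th_mem_cyl hw (s.ball' w hw)⟩
end

section
variable {D : HomDist n} {O S : Set (Hpt n)} {p : Hpt n} {E : Hz n ≃L[ℝ] Hz n} {ρ r : ℝ}
  {F : Fin n → Hpt n → ℝ} {U0 : Set (Hpt n)} {φ : Ww n → Fin n → ℝ}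

lemma Setup.tangent (hn : 1 ≤ n) (D : HomDist n) (s : Setup O S p E ρ r F U0 φ) {tS : Hpt n → MVec n (2*n+1-n)}
    (htS : IsHOrient n (2*n+1-n) (O ∩ S) tS) {w : Ww n} (hw : w ∈ Bset S p E ρ φ) :
    tau (yv E (Aof E (dHv F (Th E w (φ w))))) = tS (Th E w (φ w)) ∨
    tau (yv E (Aof E (dHv F (Th E w (φ w))))) = - tS (Th E w (φ w)) := by
  have hqU := s.mem_U0 hw.1
  set q := Th E w (φ w) with hqdef
  obtain ⟨V, g, hV, hqV, hg, hli, hSV, v, hv, hvg, htv⟩ := htS.2 q ⟨s.sub hqU, hw.2⟩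
  obtain ⟨M, hM, hMd⟩ := same_diff hn D s hqU hV hqV hg (hli q hqV) hSV hw.2
  rw [htv]
  refine orient_pm (by omega) (gradF_li (hli q hqV)) (yv_li E _) (fun i l => ?_) hvg hv
  unfold yv
  rw [dotC_toEc_gradF, hor_emb']
  have h1 := Aof_ker (b := (wbasis n i).1) ((s.near q hqU).trans (by norm_num : (1:ℝ)/4 ≤ 1/2))
  set z := E (Aof E (dHv F q) (wbasis n i).1, (wbasis n i).1)
  have h2 : M (dHv g q z) = M 0 := by
    rw [map_zero, ← h1, ← hMd]; rfl
  exact congrFun (hM h2) l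

lemma Setup.sign (hn : 1 ≤ n) (D : HomDist n) (s : Setup O S p E ρ r F U0 φ) {tS : Hpt n → MVec n (2*n+1-n)}
    (htS : IsHOrient n (2*n+1-n) (O ∩ S) tS) :
    ∃ σ : Ww n → ℝ, ContinuousOn σ (Bset S p E ρ φ) ∧ (∀ w, σ w = 1 ∨ σ w = -1) ∧
      ∀ w ∈ Bset S p E ρ φ, tS (Th E w (φ w)) = σ w • tau (yv E (Aof E (dHv F (Th E w (φ w))))) := by
  classical
  set T : Ww n → MVec n (2*n+1-n) := fun w => tau (yv E (Aof E (dHv F (Th E w (φ w))))) with hT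
  have hcphi := s.cphi hn D
  have hBW : Bset S p E ρ φ ⊆ Metric.ball (wc E p) ρ := fun w hw => hw.1
  have hcPhi : ContinuousOn (fun w => Th E w (φ w)) (Bset S p E ρ φ) :=
    (continuous_Th E).comp_continuousOn (continuousOn_id.prodMk (hcphi.mono hBW))
  have hcT : ContinuousOn T (Bset S p E ρ φ) := by
    intro w hw
    have h1 : ContinuousWithinAt (fun w => dHv F (Th E w (φ w))) (Bset S p E ρ φ) w :=
      ((continuousOn_dHv s.c1).comp hcPhi fun w hw => s.mem_U0 hw.1) w hw
    have h2 := ContinuousAt.comp_continuousWithinAt (f := fun w => dHv F (Th E w (φ w)))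
      (Aof_continuousAt ((s.near _ (s.mem_U0 hw.1)).trans (by norm_num : (1:ℝ)/4 ≤ 1/2))) h1
    exact ContinuousAt.comp_continuousWithinAt (f := fun w => Aof E (dHv F (Th E w (φ w))))
      (continuous_tau_yv E).continuousAt h2
  have hct : ContinuousOn (fun w => tS (Th E w (φ w))) (Bset S p E ρ φ) :=
    htS.1.comp hcPhi fun w hw => ⟨s.sub (s.mem_U0 hw.1), hw.2⟩
  set num : Ww n → ℝ := fun w => ∑ i, tS (Th E w (φ w)) i * T w i with hnum
  set den : Ww n → ℝ := fun w => ∑ i, T w i * T w i with hden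
  have hTne : ∀ w, T w ≠ 0 := fun w => tau_ne_zero (yv_li E _)
  have hdpos : ∀ w, 0 < den w := by
    intro w
    obtain ⟨i, hi⟩ := Function.ne_iff.1 (hTne w)
    exact Finset.sum_pos' (fun i _ => mul_self_nonneg _) ⟨i, Finset.mem_univ _, mul_self_pos.2 hi⟩
  have hcase : ∀ w ∈ Bset S p E ρ φ, (num w / den w = 1 ∧ tS (Th E w (φ w)) = T w) ∨
      (num w / den w = -1 ∧ tS (Th E w (φ w)) = - T w) := by
    intro w hw
    rcases s.tangent hn D htS hw with h | h
    · left
      have h' : tS (Th E w (φ w)) = T w := h.symm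
      refine ⟨?_, h'⟩
      rw [div_eq_one_iff_eq (hdpos w).ne']
      simp only [hnum, hden, h']
    · right
      have h' : tS (Th E w (φ w)) = - T w := by rw [hT]; simp only []; rw [h, neg_neg]
      refine ⟨?_, h'⟩
      rw [div_eq_iff (hdpos w).ne']
      simp only [hnum, hden, h', Pi.neg_apply, neg_mul, Finset.sum_neg_distrib, one_mul]
  refine ⟨fun w => if w ∈ Bset S p E ρ φ then num w / den w else 1, ?_, fun w => ?_, fun w hw => ?_⟩
  · have : ContinuousOn (fun w => num w / den w) (Bset S p E ρ φ) := by
      refine ContinuousOn.div ?_ ?_ fun w _ => (hdpos w).ne'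
      · exact continuousOn_finsetSum _ fun i _ => (continuousOn_pi.1 hct i).mul (continuousOn_pi.1 hcT i)
      · exact continuousOn_finsetSum _ fun i _ => (continuousOn_pi.1 hcT i).mul (continuousOn_pi.1 hcT i)
    exact this.congr fun w hw => if_pos hw
  · by_cases hw : w ∈ Bset S p E ρ φ
    · simp only [if_pos hw]
      rcases hcase w hw with h | h
      · exact Or.inl h.1
      · exact Or.inr h.1
    · simp only [if_neg hw]; exact Or.inl trivial
  · simp only [if_pos hw]
    rcases hcase w hw with h | h
    · rw [h.1, h.2, one_smul]
    · rw [h.1, h.2, neg_one_smul]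

lemma dHv_close {f f' : Fin n → Hpt n → ℝ} {x : Hpt n} {η : ℝ} (hη : 0 ≤ η)
    (h : ∀ i j, |gradH (f i) x j - gradH (f' i) x j| ≤ η) : ‖dHv f x - dHv f' x‖ ≤ 2 * n * η := by
  refine ContinuousLinearMap.opNorm_le_bound _ (by positivity) fun u => ?_
  rw [pi_norm_le_iff_of_nonneg (by positivity)]
  intro i
  have h0 : (dHv f x - dHv f' x) u i = ∑ j, cz u j * (gradH (f i) x j - gradH (f' i) x j) := by
    show dHL (f i) x u - dHL (f' i) x u = _
    rw [dHL_apply, dHL_apply, ← Finset.sum_sub_distrib]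
    exact Finset.sum_congr rfl fun j _ => by ring
  rw [h0, Real.norm_eq_abs]
  calc |∑ j, cz u j * (gradH (f i) x j - gradH (f' i) x j)|
      ≤ ∑ j : Fin (2*n), |cz u j * (gradH (f i) x j - gradH (f' i) x j)| := Finset.abs_sum_le_sum_abs _ _
    _ ≤ ∑ j : Fin (2*n), ‖u‖ * η := by
        refine Finset.sum_le_sum fun j _ => ?_
        rw [abs_mul]
        exact mul_le_mul (abs_cz_le u j) (h i j) (abs_nonneg _) (norm_nonneg _)
    _ = 2 * n * η * ‖u‖ := by simp; ring

structure Appr (p : Hpt n) (E : Hz n ≃L[ℝ] Hz n) (r : ℝ) (F : Fin n → Hpt n → ℝ)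
    (φ : Ww n → Fin n → ℝ) (B : Set (Ww n)) (g : Ww n → ℝ) (η : ℝ) (f : Fin n → Hpt n → ℝ) (ψ : Ww n → Fin n → ℝ) : Prop where
  smooth : ∀ i, ContDiffOn ℝ 1 (f i) {x | wc E x ∈ B}
  good : Good E B (ac E p) r f
  ball : ∀ w ∈ B, ψ w ∈ Metric.ball (ac E p) r
  zero : ∀ w ∈ B, ∀ i, f i (Th E w (ψ w)) = 0
  close : ∀ w ∈ B, ‖ψ w - φ w‖ ≤ 2 * η * g w
  dclose : ∀ x ∈ cyl E B (ac E p) r, ‖dHv f x - dHv F x‖ ≤ 2 * n * η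

theorem Setup.appr (hn : 1 ≤ n) (D : HomDist n) (s : Setup O S p E ρ r F U0 φ) {B : Set (Ww n)} (hBo : IsOpen B)
    (hB : B ⊆ Metric.ball (wc E p) ρ) {g : Ww n → ℝ} (hg : ContDiff ℝ 1 g) (hg1 : ∀ w, g w ≤ 1)
    (hgB : ∀ w, 0 < g w ↔ w ∈ B) {η : ℝ} (hη : 0 < η) (hη1 : 2 * n * η * ‖(E : Hz n →L[ℝ] Hz n)‖ ≤ 1 / 4)
    (hη2 : 2 * η ≤ r / 4) : ∃ f ψ, Appr p E r F φ B g η f ψ := by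
  set Box : Set (Hpt n) := (fun x : Ww n × (Fin n → ℝ) => Th E x.1 x.2) '' (Metric.closedBall (wc E p) ρ ×ˢ Metric.closedBall (ac E p) r) with hBox
  have hBoxc : IsCompact Box := ((isCompact_closedBall _ _).prod (isCompact_closedBall _ _)).image (continuous_Th E)
  have hBoxU : Box ⊆ U0 := by
    rintro _ ⟨⟨w, a⟩, ⟨hw, ha⟩, rfl⟩
    exact s.box w hw a ha
  have hBoxc' : cyl E B (ac E p) r ⊆ Box := by
    intro x hx
    exact ⟨(wc E x, ac E x), ⟨Metric.ball_subset_closedBall (hB hx.1), Metric.ball_subset_closedBall hx.2⟩, Th_wc_ac E x⟩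
  have hGc : ContDiff ℝ 1 (fun x => g (wc E x)) := hg.comp (contDiff_wc E)
  have hgl := fun i => glue s.opn (s.c1 i) hBoxc hBoxU hGc hη
  choose f hf hfx using hgl
  have hset : {x | 0 < g (wc E x)} = {x : Hpt n | wc E x ∈ B} := by
    ext x; exact hgB _
  rw [hset] at hf
  have hopen : IsOpen {x : Hpt n | wc E x ∈ B} := hBo.preimage (continuous_wc E)
  have hd : ∀ x ∈ cyl E B (ac E p) r, ‖dHv f x - dHv F x‖ ≤ 2 * n * η := fun x hx =>
    dHv_close hη.le fun i j => (hfx i x (hBoxc' hx) ((hgB _).2 hx.1)).2 j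
  have hcU : cyl E B (ac E p) r ⊆ U0 := fun x hx => hBoxU (hBoxc' hx)
  have hgood : Good E B (ac E p) r f := by
    refine ⟨hBo, fun i => (isC1H_of_contDiffOn hopen (hf i)).mono' fun x hx => hx.1, fun x hx => ?_⟩
    have e : (dHv f x).comp (E : Hz n →L[ℝ] Hz n) - ContinuousLinearMap.fst ℝ _ _ =
      (dHv f x - dHv F x).comp (E : Hz n →L[ℝ] Hz n) + ((dHv F x).comp (E : Hz n →L[ℝ] Hz n) - ContinuousLinearMap.fst ℝ _ _) := by
      rw [ContinuousLinearMap.sub_comp]; abel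
    rw [e]
    refine (norm_add_le _ _).trans ?_
    have h1 := s.near x (hcU hx)
    have h2 := ContinuousLinearMap.opNorm_comp_le (dHv f x - dHv F x) (E : Hz n →L[ℝ] Hz n)
    have h3 := mul_le_mul_of_nonneg_right (hd x hx) (norm_nonneg (E : Hz n →L[ℝ] Hz n))
    linarith
  have hex : ∀ w ∈ B, ∃ a ∈ Metric.closedBall (φ w) (2 * η * g w), ∀ i, f i (Th E w a) = 0 := by
    intro w hw
    have hgw := (hgB w).2 hw
    have hle : 2 * η * g w ≤ r / 4 := by nlinarith [hg1 w]
    refine hgood.exists_zero hn D s.hE hw ?_ ?_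
    · intro a ha
      have h1 := s.ball w (hB hw)
      rw [Metric.mem_closedBall] at h1 ha
      rw [Metric.mem_ball]
      linarith [dist_triangle a (φ w) (ac E p), s.rpos]
    · have : ‖fun i => f i (Th E w (φ w))‖ ≤ η * g w := by
        rw [pi_norm_le_iff_of_nonneg (by positivity)]
        intro i
        have hm : Th E w (φ w) ∈ cyl E B (ac E p) r := Th_mem_cyl hw (s.ball' w (hB hw))
        have h1 := (hfx i _ (hBoxc' hm) ((hgB _).2 hm.1)).1
        rw [s.phiz w (hB hw), sub_zero, wc_Th] at h1
        exact h1
      linarith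
  choose! ψ hψ1 hψ2 using hex
  refine ⟨f, ψ, hf, hgood, fun w hw => ?_, hψ2, fun w hw => ?_, hd⟩
  · have hgw := (hgB w).2 hw
    have hle : 2 * η * g w ≤ r / 4 := by nlinarith [hg1 w]
    have h1 := s.ball w (hB hw)
    have ha := hψ1 w hw
    rw [Metric.mem_closedBall] at h1 ha
    rw [Metric.mem_ball]
    linarith [dist_triangle (ψ w) (φ w) (ac E p), s.rpos]
  · have := hψ1 w hw
    rwa [mem_closedBall_iff_norm] at this
end

section
variable {D : HomDist n} {O S : Set (Hpt n)} {p : Hpt n} {E : Hz n ≃L[ℝ] Hz n} {ρ r : ℝ}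
  {F : Fin n → Hpt n → ℝ} {U0 : Set (Hpt n)} {φ : Ww n → Fin n → ℝ}
  {B : Set (Ww n)} {g : Ww n → ℝ} {η : ℝ} {f : Fin n → Hpt n → ℝ} {ψ : Ww n → Fin n → ℝ}

/-- the graph of `ψ` over `B` -/
def Gph (E : Hz n ≃L[ℝ] Hz n) (B : Set (Ww n)) (ψ : Ww n → Fin n → ℝ) : Set (Hpt n) := (fun w => Th E w (ψ w)) '' B

lemma Appr.sub (a : Appr p E r F φ B g η f ψ) : Gph E B ψ ⊆ cyl E B (ac E p) r := by
  rintro _ ⟨w, hw, rfl⟩; exact Th_mem_cyl hw (a.ball w hw)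

lemma Appr.eqz (hn : 1 ≤ n) (D : HomDist n) (hE : ∀ x y, om (E x) (E y) = om x y) (a : Appr p E r F φ B g η f ψ) :
    Gph E B ψ ∩ cyl E B (ac E p) r = {x ∈ cyl E B (ac E p) r | ∀ i, f i x = 0} := by
  rw [inter_eq_left.2 a.sub, a.good.zeros hn D hE a.ball a.zero]; rfl

lemma Appr.c1h (hn : 1 ≤ n) (D : HomDist n) (hE : ∀ x y, om (E x) (E y) = om x y) (a : Appr p E r F φ B g η f ψ) :
    IsC1HCodim n (Gph E B ψ) := fun _ hx =>
  ⟨cyl E B (ac E p) r, isOpen_cyl E a.good.opn _ _, a.sub hx, f, a.good.c1, fun _ hq => a.good.li hq, a.eqz hn D hE⟩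

lemma Appr.c1e (hn : 1 ≤ n) (D : HomDist n) (hE : ∀ x y, om (E x) (E y) = om x y) (a : Appr p E r F φ B g η f ψ) :
    IsC1ECodim n (Gph E B ψ) := by
  intro x hx
  have hV := isOpen_cyl E a.good.opn (ac E p) r
  obtain ⟨ε, hε, hεV⟩ := Metric.nhds_basis_closedBall.mem_iff.1 (hV.mem_nhds (a.sub hx))
  let χ : ContDiffBump x := ⟨ε / 2, ε, by linarith, by linarith⟩
  have hfV : ∀ i, ContDiffOn ℝ 1 (f i) (cyl E B (ac E p) r) := fun i => (a.smooth i).mono fun y hy => hy.1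
  have hball : Metric.ball x (ε / 2) ⊆ cyl E B (ac E p) r := fun y hy =>
    hεV (Metric.closedBall_subset_closedBall (by linarith) (Metric.ball_subset_closedBall hy))
  have heq : ∀ i, ∀ y ∈ Metric.ball x (ε / 2), (fun y => χ y * f i y) =ᶠ[𝓝 y] f i := by
    intro i y hy
    filter_upwards [Metric.isOpen_ball.mem_nhds hy] with z hz
    rw [χ.one_of_mem_closedBall (Metric.ball_subset_closedBall hz), one_mul]
  refine ⟨Metric.ball x (ε / 2), Metric.isOpen_ball, Metric.mem_ball_self (by linarith),
    fun i y => χ y * f i y, fun i => ?_, fun y hy => ?_, ?_⟩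
  · rw [contDiff_iff_contDiffAt]
    intro y
    by_cases hy : y ∈ cyl E B (ac E p) r
    · exact χ.contDiff.contDiffAt.mul ((hfV i).contDiffAt (hV.mem_nhds hy))
    · have hy' : y ∈ (Metric.closedBall x ε)ᶜ := fun h => hy (hεV h)
      have : (fun y => χ y * f i y) =ᶠ[𝓝 y] fun _ => 0 := by
        filter_upwards [Metric.isClosed_closedBall.isOpen_compl.mem_nhds hy'] with z hz
        have : ε ≤ dist z x := by
          by_contra h; push Not at h; exact hz h.le
        rw [χ.zero_of_le_dist this, zero_mul]
      exact contDiffAt_const.congr_of_eventuallyEq this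
  · have h1 := a.good.li (hball hy)
    have h2 : (fun i => fderiv ℝ (fun y => χ y * f i y) y) = fun i => fderiv ℝ (f i) y :=
      funext fun i => (heq i y hy).fderiv_eq
    have h3 : LinearIndependent ℝ (fun i => fderiv ℝ (f i) y) := by
      let P : (Hpt n →L[ℝ] ℝ) →ₗ[ℝ] (Fin (2*n) → ℝ) :=
        { toFun := fun T j => T (frameVec (hIdx j) y), map_add' := fun _ _ => rfl, map_smul' := fun _ _ => rfl }
      refine LinearIndependent.of_comp P ?_
      convert h1 using 1
      funext i j
      exact (gradH_eq_fderiv (((hfV i).contDiffAt (hV.mem_nhds (hball hy))).differentiableAt one_ne_zero) j).symm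
    rw [← h2] at h3
    exact h3
  · ext y
    have hz := a.eqz hn D hE
    constructor
    · rintro ⟨hy, hyb⟩
      have : y ∈ Gph E B ψ ∩ cyl E B (ac E p) r := ⟨hy, a.sub hy⟩
      rw [hz] at this
      exact ⟨hyb, fun i => (heq i y hyb).eq_of_nhds.trans (this.2 i)⟩
    · rintro ⟨hyb, hy⟩
      have : y ∈ {x ∈ cyl E B (ac E p) r | ∀ i, f i x = 0} :=
        ⟨hball hyb, fun i => (heq i y hyb).eq_of_nhds.symm.trans (hy i)⟩
      rw [← hz] at this
      exact ⟨this.1, hyb⟩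

def thF (E : Hz n ≃L[ℝ] Hz n) (σ : Ww n → ℝ) (f : Fin n → Hpt n → ℝ) (x : Hpt n) : MVec n (2*n+1-n) :=
  σ (wc E x) • tau (yv E (Aof E (dHv f x)))

lemma Good.cont_tau {W : Set (Ww n)} {a0 : Fin n → ℝ} (h : Good E W a0 r f) :
    ContinuousOn (fun x => tau (yv E (Aof E (dHv f x)))) (cyl E W a0 r) := by
  intro x hx
  have h2 := ContinuousAt.comp_continuousWithinAt (f := fun x => dHv f x)
      (Aof_continuousAt (h.near x hx)) (continuousOn_dHv h.c1 x hx)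
  exact ContinuousAt.comp_continuousWithinAt (f := fun x => Aof E (dHv f x))
      (continuous_tau_yv E).continuousAt h2

lemma Appr.orient (hn : 1 ≤ n) (D : HomDist n) (hE : ∀ x y, om (E x) (E y) = om x y) (a : Appr p E r F φ B g η f ψ)
    {σ : Ww n → ℝ} (hσ : ContinuousOn σ B) (hσ1 : ∀ w, σ w = 1 ∨ σ w = -1) :
    IsHOrient n (2*n+1-n) (Gph E B ψ) (thF E σ f) := by
  refine ⟨?_, fun x hx => ?_⟩
  · have h1 : ContinuousOn (fun x => σ (wc E x)) (cyl E B (ac E p) r) :=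
      hσ.comp (continuous_wc E).continuousOn fun x hx => hx.1
    exact (h1.smul a.good.cont_tau).mono a.sub
  · obtain ⟨v, hv1, hv2, hv3⟩ := orient_exists (k := n) (m := 2*n+1-n) (by omega) (by omega) (gradF_li (a.good.li (a.sub hx)))
      (yv_li E _) (a.good.orth (a.sub hx)) (hσ1 (wc E x))
    exact ⟨cyl E B (ac E p) r, f, isOpen_cyl E a.good.opn _ _, a.sub hx, a.good.c1, fun _ hq => a.good.li hq,
      a.eqz hn D hE, v, hv1, hv2, hv3⟩

lemma Appr.locfin (hn : 1 ≤ n) (D : HomDist n) (hE : ∀ x y, om (E x) (E y) = om x y) (a : Appr p E r F φ B g η f ψ)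
    (hvol : volume B < ⊤) (O : Set (Hpt n)) : LocFin (sphMeasure D ((n:ℝ)+2)) (Gph E B ψ) O := by
  intro q _
  refine ⟨univ, isOpen_univ, mem_univ _, ?_⟩
  rw [inter_univ]
  exact area_finite hn hE (a.good.igraph hn D hE a.ball a.zero hvol)

/-- boundary of a graph inside the cylinder -/
lemma bdry_graph {W : Set (Ww n)} {a0 : Fin n → ℝ} (hW : IsOpen W) (hBW : B ⊆ W) (hψ : ContinuousOn ψ W)
    (hb : ∀ w ∈ W, ψ w ∈ Metric.ball a0 r) :
    cyl E W a0 r ∩ bdry (Gph E B ψ) = (fun w => Th E w (ψ w)) '' (W ∩ (closure B \ B)) := by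
  apply Subset.antisymm
  · rintro x ⟨hx, hxc, hxn⟩
    have hne : (𝓝[Gph E B ψ] x).NeBot := mem_closure_iff_nhdsWithin_neBot.1 hxc
    have hwx : Tendsto (wc E) (𝓝[Gph E B ψ] x) (𝓝 (wc E x)) := (continuous_wc E).continuousAt.mono_left nhdsWithin_le_nhds
    have hax : Tendsto (ac E) (𝓝[Gph E B ψ] x) (𝓝 (ac E x)) := (continuous_ac E).continuousAt.mono_left nhdsWithin_le_nhds
    have hψx : Tendsto (fun y => ψ (wc E y)) (𝓝[Gph E B ψ] x) (𝓝 (ψ (wc E x))) :=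
      (hψ.continuousAt (hW.mem_nhds hx.1)).tendsto.comp hwx
    have hmem : ∀ y ∈ Gph E B ψ, wc E y ∈ B ∧ ac E y = ψ (wc E y) := by
      rintro _ ⟨w, hw, rfl⟩; simp [hw]
    have he : (fun y => ψ (wc E y)) =ᶠ[𝓝[Gph E B ψ] x] ac E := by
      filter_upwards [self_mem_nhdsWithin] with y hy using (hmem y hy).2.symm
    have hacx : ac E x = ψ (wc E x) := tendsto_nhds_unique hax (hψx.congr' he)
    have hxeq : Th E (wc E x) (ψ (wc E x)) = x := by rw [← hacx, Th_wc_ac]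
    refine ⟨wc E x, ⟨hx.1, ?_, fun hB => hxn ⟨wc E x, hB, hxeq⟩⟩, hxeq⟩
    exact mem_closure_of_tendsto hwx (by filter_upwards [self_mem_nhdsWithin] with y hy using (hmem y hy).1)
  · rintro _ ⟨w, ⟨hw, hwc, hwn⟩, rfl⟩
    refine ⟨Th_mem_cyl hw (hb w hw), ?_, ?_⟩
    · have hc : ContinuousWithinAt (fun w => Th E w (ψ w)) B w :=
        (((continuous_Th E).comp_continuousOn (continuousOn_id.prodMk hψ)) w hw).mono hBW
      exact hc.mem_closure_image hwc
    · rintro ⟨w', hw', h⟩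
      have := congrArg (wc E) h
      simp only [wc_Th] at this
      exact hwn (this ▸ hw')

lemma Appr.bdry_eq (hn : 1 ≤ n) (D : HomDist n) (s : Setup O S p E ρ r F U0 φ)
    (hBe : B = Bset S p E ρ φ) (hgc : Continuous g) (hgB : ∀ w, 0 < g w ↔ w ∈ B) (hg0 : ∀ w, 0 ≤ g w)
    (hη : 0 < η) (a : Appr p E r F φ B g η f ψ) :
    cyl E (Metric.ball (wc E p) ρ) (ac E p) r ∩ bdry (Gph E B ψ) =
    cyl E (Metric.ball (wc E p) ρ) (ac E p) r ∩ bdry S := by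
  classical
  set W := Metric.ball (wc E p) ρ with hW
  have hWo : IsOpen W := Metric.isOpen_ball
  have hBW : B ⊆ W := by rw [hBe]; exact fun w hw => hw.1
  have hBo := a.good.opn
  have hφc := s.cphi hn D
  set ψ' : Ww n → Fin n → ℝ := fun w => if w ∈ B then ψ w else φ w with hψ'
  have hG : Gph E B ψ = Gph E B ψ' := by
    refine image_congr fun w hw => ?_
    simp only [hψ', if_pos hw]
  have hcl : ∀ w ∈ W, ‖ψ' w - φ w‖ ≤ 2 * η * g w := by
    intro w hw
    by_cases hwB : w ∈ B
    · simp only [hψ', if_pos hwB]; exact a.close w hwB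
    · simp only [hψ', if_neg hwB, sub_self, norm_zero]
      have := hg0 w; positivity
  have hψc : ContinuousOn ψ' W := by
    intro w hw
    by_cases hwB : w ∈ B
    · have h1 : ContinuousAt ψ w := (a.good.cont hn D s.hE a.ball a.zero).continuousAt (hBo.mem_nhds hwB)
      refine (h1.congr ?_).continuousWithinAt
      filter_upwards [hBo.mem_nhds hwB] with z hz
      simp only [hψ', if_pos hz]
    · have hg : g w = 0 := le_antisymm (not_lt.1 fun h => hwB ((hgB w).1 h)) (hg0 w)
      have h1 : Tendsto (fun z => ψ' z - φ z) (𝓝[W] w) (𝓝 0) := by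
        have h2 : Tendsto (fun z => 2 * η * g z) (𝓝[W] w) (𝓝 0) := by
          have : Tendsto (fun z => 2 * η * g z) (𝓝 w) (𝓝 (2 * η * g w)) :=
            (continuous_const.mul hgc).tendsto w
          rw [hg, mul_zero] at this
          exact this.mono_left nhdsWithin_le_nhds
        refine squeeze_zero_norm' ?_ h2
        filter_upwards [self_mem_nhdsWithin] with z hz using hcl z hz
      have h3 := h1.add (hφc w hw)
      have h4 : ψ' w = φ w := by simp only [hψ', if_neg hwB]
      rw [ContinuousWithinAt, h4]
      simpa using h3
  have hψb : ∀ w ∈ W, ψ' w ∈ Metric.ball (ac E p) r := by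
    intro w hw
    by_cases hwB : w ∈ B
    · simp only [hψ', if_pos hwB]; exact a.ball w hwB
    · simp only [hψ', if_neg hwB]; exact s.ball' w hw
  have hUo : IsOpen (cyl E W (ac E p) r) := isOpen_cyl E hWo _ _
  have hS : cyl E W (ac E p) r ∩ bdry S = cyl E W (ac E p) r ∩ bdry (Gph E B φ) := by
    have e : Gph E B φ = S ∩ cyl E W (ac E p) r := by rw [s.inter_S hn D, hBe]; rfl
    rw [e]
    ext x
    constructor
    · rintro ⟨hx, hxc, hxn⟩
      refine ⟨hx, ?_, fun h => hxn h.1⟩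
      have := hUo.inter_closure ⟨hx, hxc⟩
      rwa [inter_comm] at this
    · rintro ⟨hx, hxc, hxn⟩
      exact ⟨hx, closure_mono inter_subset_left hxc, fun h => hxn ⟨h, hx⟩⟩
  rw [hS, hG, bdry_graph hWo hBW hψc hψb, bdry_graph hWo hBW hφc s.ball']
  refine image_congr fun w hw => ?_
  simp only [hψ', if_neg hw.2.2]
end

section
variable {D : HomDist n} {O S : Set (Hpt n)} {p : Hpt n} {E : Hz n ≃L[ℝ] Hz n} {ρ r : ℝ}
  {F : Fin n → Hpt n → ℝ} {U0 : Set (Hpt n)} {φ : Ww n → Fin n → ℝ}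
  {B : Set (Ww n)} {g : Ww n → ℝ} {η : ℝ} {f : Fin n → Hpt n → ℝ} {ψ : Ww n → Fin n → ℝ}

lemma continuous_frameVec' (j : Fin (2*n+1)) : Continuous (fun x : Hpt n => frameVec j x) := by
  unfold frameVec
  split_ifs
  · fun_prop
  · fun_prop
  · fun_prop

lemma form_cont {k : ℕ} {U : Set (Hpt n)} {ω : Hpt n → Cov n k} (hω : IsHFormD k U ω) (s : IdxSet n k) :
    Continuous (fun x => ω x (fun i => frameVec (idxTuple s i) x)) := by
  let b := Module.finBasis ℝ (Hpt n)
  have h : ∀ x, ω x (fun i => frameVec (idxTuple s i) x) =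
      ∑ c : Fin k → Fin (Module.finrank ℝ (Hpt n)), (∏ i, b.repr (frameVec (idxTuple s i) x) (c i)) * ω x (fun i => b (c i)) := by
    intro x
    have h1 : (fun i => frameVec (idxTuple s i) x) = fun i => ∑ l, b.repr (frameVec (idxTuple s i) x) l • b l :=
      funext fun i => (b.sum_repr _).symm
    conv_lhs => rw [h1]
    have h2 := (ω x).toMultilinearMap.map_sum (fun i l => b.repr (frameVec (idxTuple s i) x) l • b l)
    refine h2.trans (Finset.sum_congr rfl fun c _ => ?_)
    exact (ω x).toMultilinearMap.map_smul_univ (fun i => b.repr (frameVec (idxTuple s i) x) (c i)) (fun i => b (c i))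
  simp only [h]
  refine continuous_finsetSum _ fun c _ => Continuous.mul (continuous_finsetProd _ fun i _ => ?_) (hω.smooth _).continuous
  have h3 : Continuous (b.coord (c i)) := (b.coord (c i)).continuous_of_finiteDimensional
  exact h3.comp (continuous_frameVec' _)

/-- the integrand of the current in graph coordinates -/
def Hfun (D : HomDist n) (E : Hz n ≃L[ℝ] Hz n) (ω : Hpt n → Cov n (2*n+1-n)) (A : Am n) (x : Hpt n) : ℝ :=
  2 ^ (n + 2) / gr D E A * pairF (tau (yv E A)) x (fun v => ω x v)

lemma continuous_Hfun (hn : 1 ≤ n) (hE : ∀ x y, om (E x) (E y) = om x y) {U : Set (Hpt n)}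
    {ω : Hpt n → Cov n (2*n+1-n)} (hω : IsHFormD (2*n+1-n) U ω) :
    Continuous (fun y : Am n × Hpt n => Hfun D E ω y.1 y.2) := by
  unfold Hfun pairF
  refine Continuous.mul (continuous_const.div ((continuous_gr hn D hE).comp continuous_fst) fun y => (gr_pos hn D _).ne') ?_
  refine continuous_finsetSum _ fun s _ => Continuous.mul ?_ ((form_cont hω s).comp continuous_snd)
  exact (continuous_apply s).comp ((continuous_tau_yv E).comp continuous_fst)

lemma Hfun_bound (hn : 1 ≤ n) (hE : ∀ x y, om (E x) (E y) = om x y) {U : Set (Hpt n)}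
    {ω : Hpt n → Cov n (2*n+1-n)} (hω : IsHFormD (2*n+1-n) U ω) :
    ∃ C : ℝ, ∀ A x, ‖A‖ ≤ 1 → |Hfun D E ω A x| ≤ C := by
  obtain ⟨K, hK, -, hK0⟩ := hω.cptSupp
  obtain ⟨C, hC⟩ := ((isCompact_closedBall (0 : Am n) 1).prod hK).exists_bound_of_continuousOn
    (continuous_Hfun (D := D) hn hE hω).continuousOn
  refine ⟨max C 0, fun A x hA => ?_⟩
  by_cases hx : x ∈ K
  · exact (hC (A, x) ⟨by simpa using hA, hx⟩).trans (le_max_left _ _)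
  · have : Hfun D E ω A x = 0 := by
      simp [Hfun, pairF, hK0 x hx]
    rw [this, abs_zero]; exact le_max_right _ _

lemma pairF_smul {k : ℕ} (c : ℝ) (t : MVec n k) (x : Hpt n) (η : (Fin k → Hpt n) → ℝ) :
    pairF (c • t) x η = c * pairF t x η := by
  simp [pairF, Finset.mul_sum, mul_assoc]

lemma pairF_cont {k : ℕ} {U T : Set (Hpt n)} {ω : Hpt n → Cov n k} (hω : IsHFormD k U ω) {t : Hpt n → MVec n k}
    (ht : ContinuousOn t T) : ContinuousOn (fun x => pairF (t x) x (fun v => ω x v)) T := by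
  unfold pairF
  exact continuousOn_finsetSum _ fun s _ => (continuousOn_pi.1 ht s).mul (form_cont hω s).continuousOn

lemma currF_graph (hn : 1 ≤ n) (hE : ∀ x y, om (E x) (E y) = om x y) {U : Set (Hpt n)}
    {ω : Hpt n → Cov n (2*n+1-n)} (hω : IsHFormD (2*n+1-n) U ω) {A : Ww n → Am n} (h : IGraph D E B ψ A)
    {t : Hpt n → MVec n (2*n+1-n)} (ht : ContinuousOn t (Gph E B ψ)) {σ : Ww n → ℝ}
    (htw : ∀ w ∈ B, t (Th E w (ψ w)) = σ w • tau (yv E (A w))) :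
    currF D n (Gph E B ψ) t (fun p v => ω p v) =
      (CnkC D n)⁻¹ * ∫ w in B, σ w * Hfun D E ω (A w) (Th E w (ψ w)) := by
  unfold currF
  have e : (2*n+2 : ℝ) - (n : ℝ) = (n:ℝ) + 2 := by ring
  rw [e]
  congr 1
  refine (area_integral hn hE h _ (pairF_cont hω ht)).trans ?_
  refine setIntegral_congr_fun h.opn.measurableSet fun w hw => ?_
  simp only [htw w hw, pairF_smul, dens, Hfun]
  ring

lemma currF_restrict {U : Set (Hpt n)} (hU : IsOpen U) {ω : Hpt n → Cov n (2*n+1-n)} (hω : IsHFormD (2*n+1-n) U ω)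
    (t : Hpt n → MVec n (2*n+1-n)) :
    currF D n S t (fun p v => ω p v) = currF D n (S ∩ U) t (fun p v => ω p v) := by
  obtain ⟨K, hK, hKU, hK0⟩ := hω.cptSupp
  unfold currF
  rw [← setIntegral_indicator hU.measurableSet]
  have : (fun x => pairF (t x) x (fun v => ω x v)) = U.indicator (fun x => pairF (t x) x (fun v => ω x v)) := by
    symm
    rw [indicator_eq_self]
    intro x hx
    by_contra hxU
    exact hx (by simp [pairF, hK0 x fun h => hxU (hKU h)])
  conv_lhs => rw [this]

lemma Hfun_contOn (hn : 1 ≤ n) (hE : ∀ x y, om (E x) (E y) = om x y) {U : Set (Hpt n)}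
    {ω : Hpt n → Cov n (2*n+1-n)} (hω : IsHFormD (2*n+1-n) U ω) {B : Set (Ww n)} {A : Ww n → Am n} {x : Ww n → Hpt n}
    (hA : ContinuousOn A B) (hx : ContinuousOn x B) : ContinuousOn (fun w => Hfun D E ω (A w) (x w)) B :=
  Continuous.comp_continuousOn (g := fun y : Am n × Hpt n => Hfun D E ω y.1 y.2) (f := fun w => (A w, x w))
    (continuous_Hfun hn hE hω) (hA.prodMk hx)

lemma Hfun_tendsto (hn : 1 ≤ n) (hE : ∀ x y, om (E x) (E y) = om x y) {U : Set (Hpt n)}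
    {ω : Hpt n → Cov n (2*n+1-n)} (hω : IsHFormD (2*n+1-n) U ω) {A : ℕ → Am n} {x : ℕ → Hpt n} {A0 : Am n} {x0 : Hpt n}
    (hA : Tendsto A atTop (𝓝 A0)) (hx : Tendsto x atTop (𝓝 x0)) :
    Tendsto (fun h => Hfun D E ω (A h) (x h)) atTop (𝓝 (Hfun D E ω A0 x0)) :=
  Tendsto.comp (g := fun y : Am n × Hpt n => Hfun D E ω y.1 y.2) (f := fun h => (A h, x h))
    ((continuous_Hfun hn hE hω).tendsto (A0, x0)) (hA.prodMk_nhds hx)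

theorem curr_tendsto (hn : 1 ≤ n) (D : HomDist n) (s : Setup O S p E ρ r F U0 φ)
    (hBe : B = Bset S p E ρ φ) (hBo : IsOpen B) {η : ℕ → ℝ} (hη : Tendsto η atTop (𝓝 0))
    {f : ℕ → Fin n → Hpt n → ℝ} {ψ : ℕ → Ww n → Fin n → ℝ}
    (a : ∀ h, Appr p E r F φ B g (η h) (f h) (ψ h)) {σ : Ww n → ℝ} (hσ : ContinuousOn σ B)
    (hσ1 : ∀ w, σ w = 1 ∨ σ w = -1) {tS : Hpt n → MVec n (2*n+1-n)} (htS : ContinuousOn tS (O ∩ S))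
    (hσt : ∀ w ∈ B, tS (Th E w (φ w)) = σ w • tau (yv E (Aof E (dHv F (Th E w (φ w))))))
    {ω : Hpt n → Cov n (2*n+1-n)} (hω : IsHFormD (2*n+1-n) (cyl E (Metric.ball (wc E p) ρ) (ac E p) r) ω) :
    Tendsto (fun h => currF D n (Gph E B (ψ h)) (thF E σ (f h)) (fun p v => ω p v)) atTop
      (𝓝 (currF D n S tS (fun p v => ω p v))) := by
  have hBW : B ⊆ Metric.ball (wc E p) ρ := by rw [hBe]; exact fun w hw => hw.1
  have hvol : volume B < ⊤ := (measure_mono hBW).trans_lt measure_ball_lt_top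
  have hgF := s.good.mono hBo hBW
  have igF := hgF.igraph hn D s.hE (fun w hw => s.ball' w (hBW hw)) (fun w hw => s.phiz w (hBW hw)) hvol
  have hBS : ∀ w ∈ B, Th E w (φ w) ∈ S := by rw [hBe]; exact fun w hw => hw.2
  have hSeq : currF D n S tS (fun p v => ω p v) =
      (CnkC D n)⁻¹ * ∫ w in B, σ w * Hfun D E ω (Aof E (dHv F (Th E w (φ w)))) (Th E w (φ w)) := by
    rw [currF_restrict (isOpen_cyl E Metric.isOpen_ball _ _) hω tS, s.inter_S hn D, ← hBe]
    refine currF_graph hn s.hE hω igF (htS.mono ?_) hσt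
    rintro _ ⟨w, hw, rfl⟩
    exact ⟨s.sub (s.mem_U0 (hBW hw)), hBS w hw⟩
  have ig := fun h => (a h).good.igraph hn D s.hE (a h).ball (a h).zero hvol
  have heq : ∀ h, currF D n (Gph E B (ψ h)) (thF E σ (f h)) (fun p v => ω p v) =
      (CnkC D n)⁻¹ * ∫ w in B, σ w * Hfun D E ω (Aof E (dHv (f h) (Th E w (ψ h w)))) (Th E w (ψ h w)) := by
    intro h
    refine currF_graph hn s.hE hω (ig h) ((a h).orient hn D s.hE hσ hσ1).1 fun w hw => ?_
    simp [thF]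
  simp only [heq, hSeq]
  refine Tendsto.const_mul _ ?_
  obtain ⟨C, hC⟩ := Hfun_bound (D := D) hn s.hE hω
  have hfin : IsFiniteMeasure (volume.restrict B) := ⟨by rwa [Measure.restrict_apply_univ]⟩
  refine tendsto_integral_of_dominated_convergence (fun _ => C) (fun h => ?_) (integrable_const _) (fun h => ?_) ?_
  · refine ContinuousOn.aestronglyMeasurable ?_ hBo.measurableSet
    have hT : ContinuousOn (fun w => Th E w (ψ h w)) B :=
      (continuous_Th E).comp_continuousOn (continuousOn_id.prodMk (ig h).cphi)
    have hcA := (ig h).cA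
    exact hσ.mul (Hfun_contOn (D := D) hn s.hE hω hcA hT)
  · filter_upwards [ae_restrict_mem hBo.measurableSet] with w hw
    have h1 := hC (Aof E (dHv (f h) (Th E w (ψ h w)))) (Th E w (ψ h w))
      (Aof_norm ((a h).good.near _ (Th_mem_cyl hw ((a h).ball w hw))))
    rw [Real.norm_eq_abs, abs_mul]
    have : |σ w| = 1 := by rcases hσ1 w with h | h <;> simp [h]
    rw [this, one_mul]; exact h1
  · filter_upwards [ae_restrict_mem hBo.measurableSet] with w hw
    refine Tendsto.const_mul _ ?_
    have hψ : Tendsto (fun h => ψ h w) atTop (𝓝 (φ w)) := by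
      rw [tendsto_iff_norm_sub_tendsto_zero]
      refine squeeze_zero (fun _ => norm_nonneg _) (fun h => (a h).close w hw) ?_
      simpa using (hη.const_mul 2).mul_const (g w)
    have hTh : Tendsto (fun h => Th E w (ψ h w)) atTop (𝓝 (Th E w (φ w))) :=
      ((continuous_Th E).tendsto (w, φ w)).comp (tendsto_const_nhds.prodMk_nhds hψ)
    have hU := s.mem_U0 (hBW hw)
    have hdF : Tendsto (fun h => dHv F (Th E w (ψ h w))) atTop (𝓝 (dHv F (Th E w (φ w)))) :=
      ((continuousOn_dHv s.c1).continuousAt (s.opn.mem_nhds hU)).tendsto.comp hTh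
    have hdiff : Tendsto (fun h => dHv (f h) (Th E w (ψ h w)) - dHv F (Th E w (ψ h w))) atTop (𝓝 0) := by
      refine squeeze_zero_norm (fun h => (a h).dclose _ (Th_mem_cyl hw ((a h).ball w hw))) ?_
      simpa using hη.const_mul (2 * (n:ℝ))
    have hd : Tendsto (fun h => dHv (f h) (Th E w (ψ h w))) atTop (𝓝 (dHv F (Th E w (φ w)))) := by
      have := hdiff.add hdF
      simpa using this
    have hA := (Aof_continuousAt (E := E) ((s.near _ hU).trans (by norm_num : (1:ℝ)/4 ≤ 1/2))).tendsto.comp hd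
    exact Hfun_tendsto (D := D) hn s.hE hω hA hTh

theorem main_thm {n : ℕ} (hn : 1 ≤ n) (D : HomDist n)
    (O : Set (Hpt n)) (hO : IsOpen O) (S : Set (Hpt n))
    (hS : IsC1HSubWithBdry D n O S)
    (tS : Hpt n → MVec n (2*n+1-n)) (htS : IsHOrient n (2*n+1-n) (O ∩ S) tS) :
    ∀ p ∈ O ∩ bdry S, ∃ U : Set (Hpt n), IsOpen U ∧ p ∈ U ∧
      ∃ (Sh : ℕ → Set (Hpt n)) (th : ℕ → Hpt n → MVec n (2*n+1-n)),
        (∀ h : ℕ,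
          Sh h ⊆ U ∧ IsC1ECodim n (Sh h) ∧ IsC1HCodim n (Sh h) ∧
          U ∩ bdry (Sh h) = U ∩ bdry S ∧
          IsHOrient n (2*n+1-n) (Sh h) (th h) ∧
          LocFin (sphMeasure D ((n:ℝ)+2)) (Sh h) O) ∧
        ∀ ω : Hpt n → Cov n (2*n+1-n), IsHFormD (2*n+1-n) U ω →
          Filter.Tendsto (fun h => currF D n (Sh h) (th h) (fun p v => ω p v)) Filter.atTop
            (𝓝 (currF D n S tS (fun p v => ω p v))) := by
  intro p hp
  obtain ⟨E, ρ, r, F, U0, φ, s⟩ := exists_setup hn D hO hS hp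
  have hSc : IsC1HCodim n (O ∩ S) := by
    have := hS.2.1
    unfold IsC1HSub at this
    rwa [if_pos le_rfl] at this
  obtain ⟨B, hBe⟩ : ∃ B, B = Bset S p E ρ φ := ⟨_, rfl⟩
  have hBo : IsOpen B := by rw [hBe]; exact s.isOpen_B hn D hSc
  have hBW : B ⊆ Metric.ball (wc E p) ρ := by rw [hBe]; exact fun w hw => hw.1
  have hvol : volume B < ⊤ := (measure_mono hBW).trans_lt measure_ball_lt_top
  obtain ⟨σ, hσ, hσ1, hσt⟩ := s.sign hn D htS
  rw [← hBe] at hσ hσt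
  obtain ⟨g, hgs, hgc, hgr⟩ := hBo.exists_contDiff_support_eq (n := 1)
  have hg01 : ∀ w, 0 ≤ g w ∧ g w ≤ 1 := fun w => hgr (mem_range_self w)
  have hgB : ∀ w, 0 < g w ↔ w ∈ B := by
    intro w
    rw [← hgs, Function.mem_support]
    exact ⟨fun h => h.ne', fun h => lt_of_le_of_ne (hg01 w).1 h.symm⟩
  -- step sizes
  set C : ℝ := 2 * n * ‖(E : Hz n →L[ℝ] Hz n)‖ with hC
  have hC0 : 0 ≤ C := by positivity
  set η0 : ℝ := min (1 / (4 * (C + 1))) (r / 8) with hη0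
  have hη0pos : 0 < η0 := lt_min (by positivity) (by linarith [s.rpos])
  set η : ℕ → ℝ := fun h => η0 * (1 / ((h:ℝ) + 1)) with hη
  have hηpos : ∀ h, 0 < η h := fun h => by simp only [hη]; positivity
  have hηle : ∀ h, η h ≤ η0 := by
    intro h
    simp only [hη]
    refine mul_le_of_le_one_right hη0pos.le ?_
    rw [div_le_one (by positivity)]
    linarith [(Nat.cast_nonneg h : (0:ℝ) ≤ h)]
  have hηt : Tendsto η atTop (𝓝 0) := by
    have := (tendsto_one_div_add_atTop_nhds_zero_nat (𝕜 := ℝ)).const_mul η0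
    simpa [hη] using this
  have hex : ∀ h, ∃ f ψ, Appr p E r F φ B g (η h) f ψ := by
    intro h
    refine s.appr hn D hBo hBW hgc (fun w => (hg01 w).2) hgB (hηpos h) ?_ ?_
    · have h1 : η h ≤ 1 / (4 * (C + 1)) := (hηle h).trans (min_le_left _ _)
      have h2 : 2 * n * η h * ‖(E : Hz n →L[ℝ] Hz n)‖ = C * η h := by rw [hC]; ring
      rw [h2]
      calc C * η h ≤ (C + 1) * (1 / (4 * (C + 1))) :=
            mul_le_mul (by linarith) h1 (hηpos h).le (by linarith)
        _ = 1 / 4 := by field_simp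
    · have h1 : η h ≤ r / 8 := (hηle h).trans (min_le_right _ _)
      linarith
  choose f ψ a using hex
  have hpU : p ∈ cyl E (Metric.ball (wc E p) ρ) (ac E p) r :=
    ⟨Metric.mem_ball_self s.ρpos, Metric.mem_ball_self s.rpos⟩
  refine ⟨cyl E (Metric.ball (wc E p) ρ) (ac E p) r, isOpen_cyl E Metric.isOpen_ball _ _, hpU,
    fun h => Gph E B (ψ h), fun h => thF E σ (f h), fun h => ⟨?_, (a h).c1e hn D s.hE, (a h).c1h hn D s.hE,
      (a h).bdry_eq hn D s hBe hgc.continuous hgB (fun w => (hg01 w).1) (hηpos h),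
      (a h).orient hn D s.hE hσ hσ1, (a h).locfin hn D s.hE hvol O⟩, fun ω hω => ?_⟩
  · exact fun x hx => ⟨hBW ((a h).sub hx).1, ((a h).sub hx).2⟩
  · exact curr_tendsto hn D s hBe hBo hηt a hσ hσ1 htS.1 hσt hω
end

/-- **Approximation of submanifolds with boundary in critical codimension with fixed
boundary** (Lemma 4.2): if `S` is an oriented `n`-codimensional `C¹_ℍ`-regular submanifold
with boundary in `O` such that `S, ∂S` have locally finite measures on `O`, then every
`p ∈ O ∩ ∂S` admits an open neighbourhood `U` and a sequence `(S_h)` of oriented Euclidean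
`C¹` and `C¹_ℍ`-regular codimension-`n` submanifolds of `U` with `U ∩ ∂S_h = U ∩ ∂S` for all
`h` and locally finite measures in `O`, such that `⟦S_h⟧(ω) → ⟦S⟧(ω)` for every
`ω ∈ 𝒟^{n+1}_ℍ(U)`. -/
theorem approx_with_boundary_critical {n : ℕ} (hn : 1 ≤ n) (D : HomDist n)
    (O : Set (Hpt n)) (hO : IsOpen O) (S : Set (Hpt n)) (hSO : S ⊆ O)
    (hS : IsC1HSubWithBdry D n O S)
    (tS : Hpt n → MVec n (2*n+1-n)) (htS : IsHOrient n (2*n+1-n) (O ∩ S) tS)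
    (hfinS : LocFin (sphMeasure D ((n:ℝ)+2)) S O)
    (hfinB : LocFin (sphMeasure D (n:ℝ)) (bdry S) O) :
    ∀ p ∈ O ∩ bdry S, ∃ U : Set (Hpt n), IsOpen U ∧ p ∈ U ∧
      ∃ (Sh : ℕ → Set (Hpt n)) (th : ℕ → Hpt n → MVec n (2*n+1-n)),
        (∀ h : ℕ,
          Sh h ⊆ U ∧ IsC1ECodim n (Sh h) ∧ IsC1HCodim n (Sh h) ∧
          U ∩ bdry (Sh h) = U ∩ bdry S ∧
          IsHOrient n (2*n+1-n) (Sh h) (th h) ∧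
          LocFin (sphMeasure D ((n:ℝ)+2)) (Sh h) O) ∧
        ∀ ω : Hpt n → Cov n (2*n+1-n), IsHFormD (2*n+1-n) U ω →
          Filter.Tendsto (fun h => currF D n (Sh h) (th h) (fun p v => ω p v)) Filter.atTop
            (𝓝 (currF D n S tS (fun p v => ω p v))) := by
  exact main_thm hn D O hO S hS tS htS

end Heis
end
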